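/- Let K ⊨ DCF₀ be a differentially closed field of characteristic zero, k a differential subfield of K, and G an L_{D-rg}(k)-definable group. Then there exists an L_{rg}(k)-definable group H and an L_{D-rg}(k)-definable one-to-one group morphism embedding G into H. -/

import Mathlib

/-! # Common framework: partial types, definable types, pro-definable sets and groups -/

namespace PaperGroups

open FirstOrder FirstOrder.Language Set

/-- An *instance* `φ(x; m)`: a formula `φ` whose free variables are split into the
variables `ι` of the type and a finite tuple of parameter variables, together with a
tuple `m` of parameters from `M`. -/
structure Inst (L : FirstOrder.Language.{0, 0}) (M : Type) (ι : Type) where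
  n : ℕ
  φ : L.Formula (ι ⊕ Fin n)
  m : Fin n → M

variable {L : FirstOrder.Language.{0, 0}} {M : Type} [L.Structure M] {ι κ μ : Type}

/-- The instance `φ(x;m)` holds of the tuple `a`. -/
def Inst.Holds (I : Inst L M ι) (a : ι → M) : Prop :=
  I.φ.Realize (Sum.elim a I.m)

/-- `a` realizes the set of instances `p`. -/
def Realizes (a : ι → M) (p : Set (Inst L M ι)) : Prop := ∀ I ∈ p, I.Holds a

/-- The set of realizations (in `M`) of a set of instances. -/
def realizSet (p : Set (Inst L M ι)) : Set (ι → M) := {a | Realizes a p}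

/-- Semantic entailment (in the monster model `M`). -/
def Entails (p : Set (Inst L M ι)) (I : Inst L M ι) : Prop :=
  ∀ a : ι → M, Realizes a p → I.Holds a

/-- A partial type over `M` (identified with its deductive closure): a consistent set of
instances closed under implication. -/
structure IsPartialType (p : Set (Inst L M ι)) : Prop where
  consistent : ∃ a : ι → M, Realizes a p
  closed : ∀ I : Inst L M ι, Entails p I → I ∈ p

/-- A complete type over `M`: a partial type deciding every instance. -/
structure IsCompleteType (p : Set (Inst L M ι)) : Prop where
  toIsPartialType : IsPartialType p
  complete : ∀ I : Inst L M ι, I ∈ p ∨ (⟨I.n, I.φ.not, I.m⟩ : Inst L M ι) ∈ p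

/-- `p` is `L(A)`-definable: for every formula `φ(x;y)` the set of parameter tuples `m`
with `p ⊢ φ(x;m)` is definable over `A`. -/
def DefinableOver (p : Set (Inst L M ι)) (A : Set M) : Prop :=
  ∀ (n : ℕ) (φ : L.Formula (ι ⊕ Fin n)),
    A.Definable L {m : Fin n → M | (⟨n, φ, m⟩ : Inst L M ι) ∈ p}

/-- `p` concentrates on the set `X`: `p ⊢ x ∈ X`. -/
def ConcentratesOn (p : Set (Inst L M ι)) (X : Set (ι → M)) : Prop :=
  realizSet p ⊆ X

/-- Restriction `p|_B` of a set of instances to those with parameters in `B`. -/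
def restrictTo (p : Set (Inst L M ι)) (B : Set M) : Set (Inst L M ι) :=
  {I ∈ p | ∀ i, I.m i ∈ B}

/-- The pushforward `f₊p = {φ(y;z) : φ(f(x);z) ∈ p}` of a partial type under a map
(defined semantically, types being identified with their deductive closures). -/
def pushforward (f : (ι → M) → (κ → M)) (p : Set (Inst L M ι)) : Set (Inst L M κ) :=
  {I | ∀ a : ι → M, Realizes a p → I.Holds (f a)}

/-- The tensor product `p ⊗ q` of two `L(A)`-definable partial types. -/
def tensor (A : Set M) (p : Set (Inst L M ι)) (q : Set (Inst L M κ)) :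
    Set (Inst L M (ι ⊕ κ)) :=
  {I | ∀ a : ι → M, Realizes a (restrictTo p (A ∪ Set.range I.m)) →
      ∀ b : κ → M, Realizes b (restrictTo q (A ∪ Set.range I.m ∪ Set.range a)) →
      I.Holds (Sum.elim a b)}

/-- The image of an instance under a map of parameters. -/
def Inst.map (g : M → M) (I : Inst L M ι) : Inst L M ι := ⟨I.n, I.φ, g ∘ I.m⟩

/-- The image `σ(p)` of a set of instances under a map (e.g. an automorphism) `σ`. -/
def typeMap (g : M → M) (p : Set (Inst L M ι)) : Set (Inst L M ι) := Inst.map g '' p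

/-- A type-definable ("pro-definable", viewed as a set of points in possibly infinitely
many variables) set over `A`: an intersection of `A`-definable conditions. -/
def TypeDefinableOver (L : FirstOrder.Language.{0, 0}) [L.Structure M] (A : Set M)
    (X : Set (ι → M)) : Prop :=
  ∃ F : Set (Set (ι → M)), (∀ s ∈ F, A.Definable L s) ∧ X = ⋂₀ F

/-- A pro-`L(A)`-definable function on `X`: a function whose graph (over `X`) is
pro-definable over `A`. -/
def ProDefFunOn (L : FirstOrder.Language.{0, 0}) [L.Structure M] (A : Set M)
    (X : Set (ι → M)) (f : (ι → M) → (κ → M)) : Prop :=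
  TypeDefinableOver L A
    {z : (ι ⊕ κ) → M | z ∘ Sum.inl ∈ X ∧ z ∘ Sum.inr = f (z ∘ Sum.inl)}

/-- The set of pairs from `X` and `Y`, as a set in the disjoint union of the variables. -/
def pairSet (X : Set (ι → M)) (Y : Set (κ → M)) : Set ((ι ⊕ κ) → M) :=
  {z | z ∘ Sum.inl ∈ X ∧ z ∘ Sum.inr ∈ Y}

/-- Uncurrying a binary function on tuples. -/
def uncurry₂ (f : (ι → M) → (κ → M) → (μ → M)) : ((ι ⊕ κ) → M) → (μ → M) :=
  fun z => f (z ∘ Sum.inl) (z ∘ Sum.inr)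

/-- A pro-`L(A)`-definable binary function on `X × Y`. -/
def ProDefFun₂ (L : FirstOrder.Language.{0, 0}) [L.Structure M] (A : Set M)
    (X : Set (ι → M)) (Y : Set (κ → M)) (f : (ι → M) → (κ → M) → (μ → M)) : Prop :=
  ProDefFunOn L A (pairSet X Y) (uncurry₂ f)

/-- A pro-`L(A)`-definable group, viewed through its points: a type-definable set in the
variables `ι` together with a pro-definable group law. -/
structure ProDefGroup (L : FirstOrder.Language.{0, 0}) (M : Type) [L.Structure M]
    (A : Set M) (ι : Type) where
  carrier : Set (ι → M)
  mul : (ι → M) → (ι → M) → (ι → M)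
  one : ι → M
  inv : (ι → M) → (ι → M)
  carrier_typeDef : TypeDefinableOver L A carrier
  mul_proDef : ProDefFun₂ L A carrier carrier mul
  inv_proDef : ProDefFunOn L A carrier inv
  one_mem : one ∈ carrier
  mul_mem : ∀ x ∈ carrier, ∀ y ∈ carrier, mul x y ∈ carrier
  inv_mem : ∀ x ∈ carrier, inv x ∈ carrier
  mul_assoc : ∀ x ∈ carrier, ∀ y ∈ carrier, ∀ z ∈ carrier, mul (mul x y) z = mul x (mul y z)
  one_mul : ∀ x ∈ carrier, mul one x = x
  mul_one : ∀ x ∈ carrier, mul x one = x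
  inv_mul : ∀ x ∈ carrier, mul (inv x) x = one

/-- The translate `g ⋅ p := {φ(x;y) : p ⊢ φ(g⋅x;y)}` of a partial type by a group
element. -/
def ProDefGroup.translate {A : Set M} (G : ProDefGroup L M A ι) (g : ι → M)
    (p : Set (Inst L M ι)) : Set (Inst L M ι) :=
  pushforward (G.mul g) p

/-- `p` is a `d`-generic of `G` over `A'`: it concentrates on `G` and all of its
translates are `L(A')`-definable. -/
def IsDGeneric {A : Set M} (G : ProDefGroup L M A ι) (p : Set (Inst L M ι))
    (A' : Set M) : Prop :=
  ConcentratesOn p G.carrier ∧ ∀ g ∈ G.carrier, DefinableOver (G.translate g p) A'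

/-- `p` is `G(M)`-invariant. -/
def ProDefGroup.Invariant {A : Set M} (G : ProDefGroup L M A ι)
    (p : Set (Inst L M ι)) : Prop :=
  ∀ g ∈ G.carrier, G.translate g p = p

/-- A pro-`L(A)`-definable group chunk `(F, H, K)` over the partial type `p`. -/
structure IsGroupChunk (L : FirstOrder.Language.{0, 0}) [L.Structure M] (A : Set M)
    (p : Set (Inst L M ι)) (F H K : (ι → M) → (ι → M) → (ι → M)) : Prop where
  F_proDef : ProDefFun₂ L A (realizSet p) (realizSet p) F
  H_proDef : ProDefFun₂ L A (realizSet p) (realizSet p) H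
  K_proDef : ProDefFun₂ L A (realizSet p) (realizSet p) K
  gen_inv : ∀ a : ι → M, Realizes a (restrictTo p A) → pushforward (F a) p = p
  cancel_left : ∀ c : (ι ⊕ ι) → M, Realizes c (tensor A p p) →
    H (c ∘ Sum.inl) (F (c ∘ Sum.inl) (c ∘ Sum.inr)) = c ∘ Sum.inr
  cancel_right : ∀ c : (ι ⊕ ι) → M, Realizes c (tensor A p p) →
    K (F (c ∘ Sum.inl) (c ∘ Sum.inr)) (c ∘ Sum.inr) = c ∘ Sum.inl
  assoc : ∀ c : ((ι ⊕ ι) ⊕ ι) → M, Realizes c (tensor A (tensor A p p) p) →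
    F (c ∘ Sum.inl ∘ Sum.inl) (F (c ∘ Sum.inl ∘ Sum.inr) (c ∘ Sum.inr)) =
      F (F (c ∘ Sum.inl ∘ Sum.inl) (c ∘ Sum.inl ∘ Sum.inr)) (c ∘ Sum.inr)

/-- An `L(A)`-definable group (in finitely many variables). -/
structure DefGroupOn (L : FirstOrder.Language.{0, 0}) (M : Type) [L.Structure M]
    (A : Set M) (n : ℕ) where
  carrier : Set (Fin n → M)
  mul : (Fin n → M) → (Fin n → M) → (Fin n → M)
  one : Fin n → M
  inv : (Fin n → M) → (Fin n → M)
  carrier_def : A.Definable L carrier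
  mul_def : A.Definable L {z : ((Fin n ⊕ Fin n) ⊕ Fin n) → M |
    z ∘ Sum.inl ∘ Sum.inl ∈ carrier ∧ z ∘ Sum.inl ∘ Sum.inr ∈ carrier ∧
    mul (z ∘ Sum.inl ∘ Sum.inl) (z ∘ Sum.inl ∘ Sum.inr) = z ∘ Sum.inr}
  inv_def : A.Definable L {z : Fin n ⊕ Fin n → M |
    z ∘ Sum.inl ∈ carrier ∧ inv (z ∘ Sum.inl) = z ∘ Sum.inr}
  one_mem : one ∈ carrier
  mul_mem : ∀ x ∈ carrier, ∀ y ∈ carrier, mul x y ∈ carrier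
  inv_mem : ∀ x ∈ carrier, inv x ∈ carrier
  mul_assoc : ∀ x ∈ carrier, ∀ y ∈ carrier, ∀ z ∈ carrier, mul (mul x y) z = mul x (mul y z)
  one_mul : ∀ x ∈ carrier, mul one x = x
  mul_one : ∀ x ∈ carrier, mul x one = x
  inv_mul : ∀ x ∈ carrier, mul (inv x) x = one

/-- The translate of a partial type by an element of a definable group. -/
def DefGroupOn.translate {A : Set M} {n : ℕ} (G : DefGroupOn L M A n) (g : Fin n → M)
    (p : Set (Inst L M (Fin n))) : Set (Inst L M (Fin n)) :=
  pushforward (G.mul g) p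

/-- `M` is `κ`-saturated: every small finitely satisfiable set of instances is realized. -/
def IsSaturated (L : FirstOrder.Language.{0, 0}) (M : Type) [L.Structure M]
    (κ : Cardinal) : Prop :=
  ∀ (ι : Type) (p : Set (Inst L M ι)), Cardinal.mk ι < κ → Cardinal.mk p < κ →
    (∀ s : Finset (Inst L M ι), ↑s ⊆ p → ∃ a : ι → M, ∀ I ∈ s, I.Holds a) →
    ∃ a : ι → M, Realizes a p

/-- `M` is strongly `κ`-homogeneous: every partial elementary map between small subsets
extends to an automorphism. -/
def IsStronglyHomogeneous (L : FirstOrder.Language.{0, 0}) (M : Type) [L.Structure M]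
    (κ : Cardinal) : Prop :=
  ∀ (A : Set M) (f : A → M), Cardinal.mk A < κ →
    (∀ (k : ℕ) (φ : L.Formula (Fin k)) (v : Fin k → A),
      (φ.Realize (fun i => (v i : M)) ↔ φ.Realize (fun i => f (v i)))) →
    ∃ σ : M ≃[L] M, ∀ a : A, σ a = f a

/-- `M` eliminates imaginaries: every definable set (with parameters) has a canonical
parameter, i.e. a finite real tuple with the same pointwise automorphism stabilizer. -/
def EliminatesImaginaries (L : FirstOrder.Language.{0, 0}) (M : Type) [L.Structure M] : Prop :=
  ∀ (k : ℕ) (S : Set (Fin k → M)), (Set.univ : Set M).Definable L S →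
    ∃ (r : ℕ) (c : Fin r → M), ∀ σ : M ≃[L] M,
      ((fun v : Fin k → M => (σ : M → M) ∘ v) '' S = S) ↔ ∀ i, σ (c i) = c i

/-- The (syntactic) definable closure of `A`. -/
def dclSet (L : FirstOrder.Language.{0, 0}) (M : Type) [L.Structure M] (A : Set M) :
    Set M :=
  {a | A.Definable₁ L {a}}

/-- The (syntactic) algebraic closure of `A`. -/
def aclSet (L : FirstOrder.Language.{0, 0}) (M : Type) [L.Structure M] (A : Set M) :
    Set M :=
  {a | ∃ s : Set M, a ∈ s ∧ s.Finite ∧ A.Definable₁ L s}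

end PaperGroups

namespace PaperGroups

open FirstOrder FirstOrder.Language FirstOrder.Ring

/-- The function symbols of the language `{D}` of a derivation. -/
inductive DerFunc : ℕ → Type
  | D : DerFunc 1

/-- The language `{D}` consisting of a single unary function symbol. -/
def LDer : FirstOrder.Language.{0, 0} := ⟨DerFunc, fun _ => Empty⟩

/-- The language `L_{D-rg} = L_rg ∪ {D}` of differential rings. -/
def LDrg : FirstOrder.Language.{0, 0} := Language.ring.sum LDer

/-- A field equipped with a derivation. -/
class DiffFieldStruct (K : Type) [Field K] where
  der : K → K
  der_add : ∀ x y : K, der (x + y) = der x + der y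
  der_mul : ∀ x y : K, der (x * y) = x * der y + der x * y

noncomputable instance (K : Type) [Field K] : CompatibleRing K := compatibleRingOfRing K

instance (K : Type) [Field K] [DiffFieldStruct K] : LDer.Structure K where
  funMap := fun f x => match f with | .D => DiffFieldStruct.der (x 0)
  RelMap := fun r => r.elim

noncomputable instance (K : Type) [Field K] [DiffFieldStruct K] : LDrg.Structure K :=
  Language.sumStructure _ _ K

/-- `K ⊨ DCF₀`: `K` is a differentially closed field of characteristic zero, i.e. a
differential field of characteristic zero which is existentially closed in every
differential field extension: every finite system of differential polynomial equations
and inequations over `K` with a solution in a differential field extension has a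
solution in `K`. -/
def IsDCF0 (K : Type) [Field K] [DiffFieldStruct K] : Prop :=
  CharZero K ∧
  ∀ (L : Type) [Field L] (dL : L → L),
    (∀ x y : L, dL (x + y) = dL x + dL y) →
    (∀ x y : L, dL (x * y) = x * dL y + dL x * y) →
    ∀ ι : K →+* L, (∀ x : K, ι (DiffFieldStruct.der x) = dL (ι x)) →
    ∀ (mv nord s t : ℕ)
      (Peq : Fin s → MvPolynomial (Fin mv × Fin nord) K)
      (Pneq : Fin t → MvPolynomial (Fin mv × Fin nord) K),
      (∃ a : Fin mv → L,
        (∀ u, MvPolynomial.eval (fun q => dL^[(q.2 : ℕ)] (a q.1))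
          (MvPolynomial.map ι (Peq u)) = 0) ∧
        (∀ u, MvPolynomial.eval (fun q => dL^[(q.2 : ℕ)] (a q.1))
          (MvPolynomial.map ι (Pneq u)) ≠ 0)) →
      (∃ a : Fin mv → K,
        (∀ u, MvPolynomial.eval (fun q => DiffFieldStruct.der^[(q.2 : ℕ)] (a q.1))
          (Peq u) = 0) ∧
        (∀ u, MvPolynomial.eval (fun q => DiffFieldStruct.der^[(q.2 : ℕ)] (a q.1))
          (Pneq u) ≠ 0))

end PaperGroups


namespace PG
open PaperGroups MvPolynomial

/-- derivations, as plain functions -/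
def IsDer {S : Type} [CommRing S] (D : S → S) : Prop :=
  (∀ x y, D (x + y) = D x + D y) ∧ ∀ x y, D (x * y) = x * D y + D x * y

theorem extend_der {A F : Type} [CommRing A] [Field F] [Algebra A F]
    [Algebra.FormallyEtale A F] (d : A → F) (d1 : ∀ x y, d (x + y) = d x + d y)
    (d2 : ∀ x y, d (x * y) = algebraMap A F x * d y + d x * algebraMap A F y) :
    ∃ D : F → F, IsDer D ∧ ∀ a, D (algebraMap A F a) = d a := by
  let d' : Derivation ℤ A F := Derivation.mk' (AddMonoidHom.toIntLinearMap
    { toFun := d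
      map_zero' := by simpa using d1 0 0
      map_add' := d1 }) (by
    intro a b
    simp only [AddMonoidHom.coe_toIntLinearMap, AddMonoidHom.coe_mk, ZeroHom.coe_mk,
      Algebra.smul_def, d2]
    ring)
  let l : TensorProduct A F (Ω[A⁄ℤ]) →ₗ[F] F := LinearMap.liftBaseChange F d'.liftKaehlerDifferential
  let e := KaehlerDifferential.tensorKaehlerEquivOfFormallyEtale ℤ A F
  let D := (l ∘ₗ e.symm.toLinearMap).compDer (KaehlerDifferential.D ℤ F)
  refine ⟨D, ⟨fun x y => map_add D x y, fun x y => ?_⟩, fun a => ?_⟩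
  · rw [D.leibniz]; simp only [smul_eq_mul]; ring
  · have h : D (algebraMap A F a) = l (e.symm (KaehlerDifferential.D ℤ F (algebraMap A F a))) := rfl
    have : e.symm (KaehlerDifferential.D ℤ F (algebraMap A F a)) = _ :=
      KaehlerDifferential.tensorKaehlerEquivOfFormallyEtale_symm_D_algebraMap ℤ A F a
    rw [h, this]; simp [l]; rfl

theorem poly_der {σ K F : Type} [Field K] [Field F] {dK : K → K} (hK : IsDer dK) (i : K →+* F)
    [Algebra (MvPolynomial σ K) F]
    (hi : ∀ c, algebraMap (MvPolynomial σ K) F (C c) = i c) (v : σ → F) :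
    ∃ d : MvPolynomial σ K → F, (∀ x y, d (x + y) = d x + d y) ∧
      (∀ x y, d (x * y) = algebraMap _ F x * d y + d x * algebraMap _ F y) ∧
      (∀ c, d (C c) = i (dK c)) ∧ ∀ s, d (X s) = v s := by
  have h1 : dK 1 = 0 := by simpa using hK.2 1 1
  have h0 : dK 0 = 0 := by simpa using hK.1 0 0
  let φ : K →+* DualNumber F :=
    { toFun := fun c => TrivSqZeroExt.inl (i c) + TrivSqZeroExt.inr (i (dK c))
      map_one' := by ext <;> simp [h1]
      map_zero' := by ext <;> simp [h0]
      map_add' := fun x y => by ext <;> simp [hK.1]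
      map_mul' := fun x y => by
        ext
        · simp
        · simp [hK.2, mul_comm] }
  let Φ : MvPolynomial σ K →+* DualNumber F := eval₂Hom φ
    (fun s => TrivSqZeroExt.inl (algebraMap _ F (X s : MvPolynomial σ K)) + TrivSqZeroExt.inr (v s))
  have hfst : ∀ a, (Φ a).fst = algebraMap _ F a := by
    intro a
    have : ((TrivSqZeroExt.fstHom F F F).toRingHom.comp Φ) = algebraMap (MvPolynomial σ K) F := by
      apply MvPolynomial.ringHom_ext
      · intro r
        simp [Φ, φ, hi]
      · intro s
        simp [Φ]
    exact congrArg (fun g => g a) this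
  refine ⟨fun a => (Φ a).snd, ?_, ?_, ?_, ?_⟩
  · intro a b
    simp
  · intro a b
    simp [hfst]
  · intro c; simp [Φ, φ]
  · intro s; simp [Φ]

/-- Blum axioms -/
def Blum {K : Type} [Field K] (D : K → K) : Prop :=
  ∀ (n : ℕ) (f : Polynomial (MvPolynomial (Fin n) K)) (g : MvPolynomial (Fin n) K),
    0 < f.natDegree → g ≠ 0 →
    ∃ c : K, Polynomial.eval₂ (eval (fun j : Fin n => D^[j] c)) (D^[n] c) f = 0 ∧
      eval (fun j : Fin n => D^[j] c) g ≠ 0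

theorem blum_of_dcf {K : Type} [Field K] [DiffFieldStruct K] (hK : IsDCF0 K) :
    Blum (DiffFieldStruct.der : K → K) := by
  intro n f g hf hg
  have := hK.1
  let A := MvPolynomial (Fin n) K
  let F0 := FractionRing A
  let F := AlgebraicClosure F0
  have : CharZero F0 := by
    have : CharZero A := inferInstance
    exact IsFractionRing.charZero_of_isFractionRing A
  have e1 : Algebra.FormallyEtale A F0 := Algebra.FormallyEtale.of_isLocalization (nonZeroDivisors A)
  have e2 : Algebra.FormallyEtale F0 F := Algebra.FormallyEtale.of_isSeparable _ _
  have e3 : Algebra.FormallyEtale A F := Algebra.FormallyEtale.comp A F0 F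
  have inj : Function.Injective (algebraMap A F) := by
    rw [IsScalarTower.algebraMap_eq A F0 F]
    exact (algebraMap F0 F).injective.comp (IsFractionRing.injective A F0)
  obtain ⟨r, hr⟩ : ∃ r : F, Polynomial.eval₂ (algebraMap A F) r f = 0 := by
    obtain ⟨r, hr⟩ := IsAlgClosed.exists_root (f.map (algebraMap A F)) (by
      rw [Polynomial.degree_map_eq_of_injective inj]
      exact (Polynomial.natDegree_pos_iff_degree_pos.mp hf).ne')
    exact ⟨r, by simpa [Polynomial.IsRoot, Polynomial.eval_map] using hr⟩
  let i : K →+* F := (algebraMap A F).comp C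
  let v : Fin n → F := fun j => if h : (j : ℕ) + 1 < n then algebraMap A F (X ⟨j + 1, h⟩) else r
  obtain ⟨d, hda, hdm, hd1, hd2⟩ := poly_der (dK := (DiffFieldStruct.der : K → K))
    ⟨DiffFieldStruct.der_add, DiffFieldStruct.der_mul⟩ i (fun c => rfl) v
  obtain ⟨D, hDD, hD⟩ := extend_der d hda hdm
  -- the generic solution
  have key : ∃ b : F, (∀ j : Fin n, D^[j] b = algebraMap A F (X j)) ∧ D^[n] b = r := by
    rcases Nat.eq_zero_or_pos n with h0 | hpos
    · subst h0
      exact ⟨r, fun j => j.elim0, rfl⟩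
    · have h : ∀ j (hj : j < n), D^[j] (algebraMap A F (X ⟨0, hpos⟩)) = algebraMap A F (X ⟨j, hj⟩) := by
        intro j
        induction j with
        | zero => intro hj; rfl
        | succ j ih =>
          intro hj
          rw [Function.iterate_succ_apply', ih (by omega), hD, hd2]
          simp [v, hj]
      refine ⟨algebraMap A F (X ⟨0, hpos⟩), fun j => h j j.2, ?_⟩
      obtain ⟨m, rfl⟩ : ∃ m, n = m + 1 := ⟨n - 1, by omega⟩
      rw [Function.iterate_succ_apply', h m (by omega), hD, hd2]
      simp [v]
  obtain ⟨b, hb1, hb2⟩ := key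
  -- polynomial in n+1 variables
  have hP : ∀ {T : Type} [Field T] (t : K →+* T) (w : Fin 1 × Fin (n+1) → T),
      eval₂ t w (Polynomial.eval₂ (eval₂Hom C (fun j : Fin n => X (0, j.castSucc)))
      (X (0, Fin.last n)) f : MvPolynomial (Fin 1 × Fin (n+1)) K) =
      Polynomial.eval₂ (eval₂Hom t (fun j : Fin n => w (0, j.castSucc))) (w (0, Fin.last n)) f := by
    intro T _ t w
    have h := Polynomial.hom_eval₂ f (eval₂Hom C (fun j : Fin n => (X (0, j.castSucc) :
      MvPolynomial (Fin 1 × Fin (n+1)) K))) (eval₂Hom t w) (X (0, Fin.last n))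
    rw [coe_eval₂Hom] at h
    rw [h]
    congr 1
    · apply MvPolynomial.ringHom_ext <;> intro x <;> simp
    · simp
  have hQ : ∀ {T : Type} [Field T] (t : K →+* T) (w : Fin 1 × Fin (n+1) → T),
      eval₂ t w (rename (fun j : Fin n => ((0 : Fin 1), j.castSucc)) g) =
        eval₂ t (fun j : Fin n => w (0, j.castSucc)) g := by
    intro T _ t w
    rw [eval₂_rename]; rfl
  have hΦ : eval₂Hom i (fun j : Fin n => D^[j] b) = algebraMap (MvPolynomial (Fin n) K) F := by
    apply MvPolynomial.ringHom_ext
    · intro x; simp [i]; rfl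
    · intro x
      simp only [coe_eval₂Hom, eval₂_X]
      exact hb1 x
  obtain ⟨a, ha1, ha2⟩ := hK.2 F D hDD.1 hDD.2 i (fun x => by
      change _ = D (algebraMap A F (C x)); rw [hD, hd1]) 1 (n+1) 1 1
    (fun _ => Polynomial.eval₂ (eval₂Hom C (fun j : Fin n => X (0, j.castSucc)))
      (X (0, Fin.last n)) f)
    (fun _ => rename (fun j : Fin n => ((0 : Fin 1), j.castSucc)) g)
    ⟨fun _ => b, fun _ => by
      rw [eval_map, hP]
      simp only [Fin.val_castSucc, Fin.val_last]
      rw [hb2, hΦ]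
      exact hr, fun _ => by
      rw [eval_map, hQ]
      have : eval₂ i (fun j : Fin n => D^[((j.castSucc : Fin (n+1)) : ℕ)] b) g
          = algebraMap A F g := congrArg (fun h => h g) hΦ
      intro h
      rw [this] at h
      exact hg (inj (by rw [h, map_zero]))⟩
  refine ⟨a 0, ?_, ?_⟩
  · have := ha1 0
    rw [← eval₂_id, hP] at this
    exact this
  · have := ha2 0
    rw [← eval₂_id, hQ] at this
    exact this

end PG


namespace PG
open PaperGroups MvPolynomial

section
variable {k S ι : Type} [Field k] [CommRing S]

def nab (D : S → S) (x : ι → S) : ι × ℕ → S := fun q => D^[q.2] (x q.1)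

noncomputable def ev (φ : k →+* S) (D : S → S) (x : ι → S) : MvPolynomial (ι × ℕ) k →+* S :=
  eval₂Hom φ (nab D x)

abbrev Rn (k ι : Type) [Field k] (n : ℕ) := MvPolynomial ((ι × ℕ) ⊕ Fin n) k

def wv (n : ℕ) : (ι × ℕ) ⊕ Fin n → Option ι × ℕ :=
  Sum.elim (fun q => (some q.1, q.2)) (fun j => (none, j))

noncomputable def ev0 (n : ℕ) (φ : k →+* S) (D : S → S) (x : Option ι → S) : Rn k ι n →+* S :=
  eval₂Hom φ (nab D x ∘ wv n)

theorem ev_nat {S' : Type} [CommRing S'] (h : S →+* S') {D : S → S} {D' : S' → S'}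
    (hD : ∀ z, h (D z) = D' (h z)) (φ : k →+* S) (x : ι → S) (p) :
    h (ev φ D x p) = ev (h.comp φ) D' (h ∘ x) p := by
  have hh : ∀ n z, h (D^[n] z) = D'^[n] (h z) := fun n z => by
    induction n generalizing z with
    | zero => rfl
    | succ n ih => rw [Function.iterate_succ_apply, Function.iterate_succ_apply, ih, hD]
  have : h.comp (ev φ D x) = ev (h.comp φ) D' (h ∘ x) := by
    apply MvPolynomial.ringHom_ext
    · intro r; simp [ev]
    · intro i; simp [ev, nab, hh]
  exact congrArg (fun g => g p) this

theorem ev0_eq (n : ℕ) (φ : k →+* S) (D : S → S) (x : Option ι → S) (r) :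
    ev0 n φ D x r = ev φ D x (rename (wv n) r) := by
  simp [ev0, ev, eval₂_rename]

theorem ev_some (φ : k →+* S) (D : S → S) (x : Option ι → S) (p) :
    ev φ D x (rename (fun q => (some q.1, q.2)) p) = ev φ D (x ∘ some) p := by
  simp only [ev, coe_eval₂Hom, eval₂_rename]; rfl

theorem IsDer.zero {D : S → S} (h : IsDer D) : D 0 = 0 := by simpa using h.1 0 0
theorem IsDer.one {D : S → S} (h : IsDer D) : D 1 = 0 := by simpa using h.2 1 1
theorem IsDer.pow {D : S → S} (h : IsDer D) (x : S) (j : ℕ) :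
    D (x ^ j) = j * x ^ (j - 1) * D x := by
  induction j with
  | zero => simp [h.one]
  | succ j ih =>
    rw [pow_succ, h.2, ih]
    rcases j with _ | j
    · simp
    · simp only [Nat.add_sub_cancel, Nat.cast_add, Nat.cast_one]; ring

theorem os {D : S → S} (hD : IsDer D) {φ : k →+* S} {δ : k → k} (hφ : ∀ c, D (φ c) = φ (δ c))
    (x : Option ι → S) (n : ℕ) (f : Polynomial (Rn k ι n))
    (hf : f.eval₂ (ev0 n φ D x) (D^[n] (x none)) = 0) (i0 : Rn k ι n) (u : S)
    (hu : u = ev0 n φ D x i0 * (Polynomial.derivative f).eval₂ (ev0 n φ D x) (D^[n] (x none)))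
    (p : MvPolynomial (Option ι × ℕ) k) :
    ∃ (m : ℕ) (g : Polynomial (Rn k ι n)),
      u ^ m * ev φ D x p = g.eval₂ (ev0 n φ D x) (D^[n] (x none)) := by
  set e := ev0 n φ D x with he
  set y := D^[n] (x none) with hy
  set A : Subring S := (Polynomial.eval₂RingHom e y).range with hA
  have memA : ∀ g : Polynomial (Rn k ι n), g.eval₂ e y ∈ A := fun g => ⟨g, rfl⟩
  have eA : ∀ r, e r ∈ A := fun r => by simpa using memA (Polynomial.C r)
  have yA : y ∈ A := by simpa using memA Polynomial.X
  have φA : ∀ c, φ c ∈ A := fun c => by simpa [e, ev0] using eA (C c)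
  have sA : ∀ q j, D^[j] (x (some q)) ∈ A := fun q j => by
    simpa [e, ev0, nab, wv] using eA (X (Sum.inl (q, j)))
  have nA : ∀ j, j ≤ n → D^[j] (x none) ∈ A := fun j hj => by
    rcases Nat.lt_or_ge j n with h | h
    · simpa [e, ev0, nab, wv] using eA (X (Sum.inr ⟨j, h⟩))
    · obtain rfl : j = n := le_antisymm hj h
      exact yA
  have hb : ∀ r, D (e r) ∈ A := by
    intro r
    induction r using MvPolynomial.induction_on with
    | C c => simpa [e, ev0, hφ] using φA (δ c)
    | add p q hp hq => rw [map_add, hD.1]; exact A.add_mem hp hq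
    | mul_X p q hp =>
      rw [map_mul, hD.2]
      refine A.add_mem (A.mul_mem (eA _) ?_) (A.mul_mem hp (eA _))
      rcases q with q | q
      · simpa [e, ev0, nab, wv, Function.iterate_succ_apply'] using sA q.1 (q.2 + 1)
      · simpa [e, ev0, nab, wv, Function.iterate_succ_apply'] using nA (q + 1) q.2
  have hc : ∀ g : Polynomial (Rn k ι n),
      D (g.eval₂ e y) - (Polynomial.derivative g).eval₂ e y * D y ∈ A := by
    intro g
    induction g using Polynomial.induction_on' with
    | add p q hp hq =>
      rw [Polynomial.eval₂_add, hD.1, Polynomial.derivative_add, Polynomial.eval₂_add]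
      convert A.add_mem hp hq using 1; ring
    | monomial j a =>
      rw [Polynomial.eval₂_monomial, hD.2, Polynomial.derivative_monomial,
        Polynomial.eval₂_monomial, hD.pow]
      convert A.mul_mem (hb a) (A.pow_mem yA j) using 1
      simp only [map_mul, map_natCast]; ring
  set s := (Polynomial.derivative f).eval₂ e y with hs
  have hsA : s * D y ∈ A := by
    have := hc f
    rw [hf, hD.zero, zero_sub] at this
    simpa using A.neg_mem this
  have hE : ∀ z ∈ A, u * D z ∈ A := by
    rintro _ ⟨g, rfl⟩
    have h1 := A.mul_mem (memA (Polynomial.derivative f)) (hc g)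
    have h2 := A.mul_mem (memA (Polynomial.derivative g)) hsA
    have := A.mul_mem (eA i0) (A.add_mem h1 h2)
    convert this using 1
    simp only [Polynomial.coe_eval₂RingHom, hu]; ring
  have uA : u ∈ A := hu ▸ A.mul_mem (eA _) (memA _)
  have hB : ∀ z, (∃ m : ℕ, u ^ m * z ∈ A) → ∃ m : ℕ, u ^ m * D z ∈ A := by
    rintro z ⟨m, hm⟩
    refine ⟨2 * m + 1, ?_⟩
    have h1 := A.mul_mem (A.pow_mem uA m) (hE _ hm)
    have h2 := A.mul_mem (hE _ (A.pow_mem uA m)) hm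
    rw [hD.2] at h1
    convert A.sub_mem h1 h2 using 1; ring
  have hX : ∀ q : Option ι × ℕ, ∃ m : ℕ, u ^ m * nab D x q ∈ A := by
    rintro ⟨q | q, j⟩
    · rcases Nat.lt_or_ge n j with h | h
      · induction j, h using Nat.le_induction with
        | base =>
          obtain ⟨m, hm⟩ := hB y ⟨0, by simpa using yA⟩
          exact ⟨m, by simpa [nab, Function.iterate_succ_apply', hy] using hm⟩
        | succ j hj ih =>
          obtain ⟨m, hm⟩ := hB _ ih
          exact ⟨m, by simpa [nab, Function.iterate_succ_apply'] using hm⟩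
      · exact ⟨0, by simpa [nab] using nA j h⟩
    · exact ⟨0, by simpa [nab] using sA q j⟩
  have : ∃ m : ℕ, u ^ m * ev φ D x p ∈ A := by
    induction p using MvPolynomial.induction_on with
    | C c => exact ⟨0, by simpa [ev] using φA c⟩
    | add p q hp hq =>
      obtain ⟨m, hm⟩ := hp
      obtain ⟨m', hm'⟩ := hq
      refine ⟨m + m', ?_⟩
      have := A.add_mem (A.mul_mem (A.pow_mem uA m') hm) (A.mul_mem (A.pow_mem uA m) hm')
      convert this using 1
      rw [map_add]; ring
    | mul_X p q hp =>
      obtain ⟨m, hm⟩ := hp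
      obtain ⟨m', hm'⟩ := hX q
      refine ⟨m + m', ?_⟩
      convert A.mul_mem hm hm' using 1
      rw [map_mul]; simp [ev]; ring
  obtain ⟨m, g, hg⟩ := this
  exact ⟨m, g, hg.symm⟩

theorem pseudo_div {R : Type} [CommRing R] [IsDomain R] (f : Polynomial R) (hf : 0 < f.natDegree)
    (g : Polynomial R) : ∃ (m : ℕ) (q r : Polynomial R),
      Polynomial.C f.leadingCoeff ^ m * g = f * q + r ∧ r.natDegree < f.natDegree := by
  induction hN : g.natDegree using Nat.strong_induction_on generalizing g with
  | _ N ih =>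
    rcases Nat.lt_or_ge g.natDegree f.natDegree with h | h
    · exact ⟨0, 0, g, by simp, h⟩
    · let g' := Polynomial.C f.leadingCoeff * g -
        f * (Polynomial.C g.leadingCoeff * Polynomial.X ^ (g.natDegree - f.natDegree))
      have hf0 : f ≠ 0 := by rintro rfl; simp at hf
      have hg0 : g ≠ 0 := by rintro rfl; simp at h; omega
      have hlt : g'.natDegree < g.natDegree := by
        have hi : f.leadingCoeff ≠ 0 := by simpa using hf0
        have hj : g.leadingCoeff ≠ 0 := by simpa using hg0
        have hXj : Polynomial.C g.leadingCoeff * Polynomial.X ^ (g.natDegree - f.natDegree) ≠ 0 := by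
          simpa using hg0
        have hd1 : (Polynomial.C f.leadingCoeff * g).natDegree = g.natDegree :=
          Polynomial.natDegree_C_mul hi
        by_cases h0 : g' = 0
        · rw [h0, Polynomial.natDegree_zero]; omega
        · rw [← hd1]
          refine Polynomial.natDegree_lt_natDegree h0 (Polynomial.degree_sub_lt_left ?_ ?_ ?_)
          · rw [Polynomial.degree_eq_natDegree (by simp [hf0, hg0]),
              Polynomial.degree_eq_natDegree (mul_ne_zero hf0 hXj), hd1,
              Polynomial.natDegree_mul hf0 hXj, Polynomial.natDegree_C_mul_X_pow _ _ hj]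
            congr 1; omega
          · simp [hf0, hg0]
          · rw [Polynomial.leadingCoeff_mul, Polynomial.leadingCoeff_mul,
              Polynomial.leadingCoeff_C_mul_X_pow, Polynomial.leadingCoeff_C]
      obtain ⟨m, q, r, h1, h2⟩ := ih _ (hN ▸ hlt) g' rfl
      refine ⟨m + 1, q + Polynomial.C f.leadingCoeff ^ m *
        (Polynomial.C g.leadingCoeff * Polynomial.X ^ (g.natDegree - f.natDegree)), r, ?_, h2⟩
      have : Polynomial.C f.leadingCoeff ^ m * (Polynomial.C f.leadingCoeff * g) =
        Polynomial.C f.leadingCoeff ^ m * g' + Polynomial.C f.leadingCoeff ^ m * (f * (Polynomial.C g.leadingCoeff * Polynomial.X ^ (g.natDegree - f.natDegree))) := by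
        simp only [g']; ring
      rw [pow_succ, mul_assoc, this, h1]; ring

noncomputable def th0 (k ι : Type) [Field k] (n : ℕ) :
    Rn k ι n →+* MvPolynomial (Fin n) (MvPolynomial (ι × ℕ) k) :=
  eval₂Hom (C.comp C) (Sum.elim (fun q => C (X q)) X)

noncomputable def th (n : ℕ) (φ : k →+* S) (D : S → S) (a : ι → S) :
    Rn k ι n →+* MvPolynomial (Fin n) S :=
  (MvPolynomial.map (ev φ D a)).comp (th0 k ι n)

theorem ev0_th (n : ℕ) (φ : k →+* S) (D : S → S) (x : Option ι → S) (r) :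
    ev0 n φ D x r = eval (fun j : Fin n => D^[j] (x none)) (th n φ D (x ∘ some) r) := by
  have : ev0 n φ D x = (eval (fun j : Fin n => D^[j] (x none))).comp (th n φ D (x ∘ some)) := by
    apply MvPolynomial.ringHom_ext
    · intro r; simp [ev0, th, th0, ev]
    · rintro (q | q) <;> simp [ev0, th, th0, ev, nab, wv]
  exact congrArg (fun g => g r) this

theorem th_mono {S' : Type} [CommRing S'] {n : ℕ} {φ : k →+* S} {D : S → S} {a : ι → S}
    {φ' : k →+* S'} {D' : S' → S'} {a' : ι → S'} (hI : ∀ p, ev φ D a p = 0 → ev φ' D' a' p = 0)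
    (r) (h : th n φ D a r = 0) : th n φ' D' a' r = 0 := by
  ext m
  have := congrArg (coeff m) h
  simp only [th, RingHom.comp_apply, coeff_map, coeff_zero] at this ⊢
  exact hI _ this

/-- all orders are transcendental -/
def Tr (φ : k →+* S) (D : S → S) (b : Option ι → S) (n : ℕ) : Prop :=
  ∀ r, ev0 n φ D b r = 0 → th n φ D (b ∘ some) r = 0

structure Mini (φ : k →+* S) (D : S → S) (b : Option ι → S) (n : ℕ)
    (f : Polynomial (Rn k ι n)) : Prop where
  root : f.eval₂ (ev0 n φ D b) (D^[n] (b none)) = 0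
  lead : ev0 n φ D b f.leadingCoeff ≠ 0
  pos : 0 < f.natDegree
  min : ∀ g : Polynomial (Rn k ι n), g.eval₂ (ev0 n φ D b) (D^[n] (b none)) = 0 →
    g.natDegree < f.natDegree → ∀ j, ev0 n φ D b (g.coeff j) = 0
  tr : Tr φ D b n

theorem exists_rn (p : MvPolynomial (Option ι × ℕ) k) :
    ∃ (n : ℕ) (r : Rn k ι n), rename (wv n) r = p := by
  have up : ∀ n m, n ≤ m → ∀ r : Rn k ι n, ∃ r' : Rn k ι m, rename (wv m) r' = rename (wv n) r := by
    intro n m h r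
    refine ⟨rename (Sum.map id (Fin.castLE h)) r, ?_⟩
    rw [rename_rename]; congr 1
    ext q <;> rcases q with q | q <;> simp [wv]
  induction p using MvPolynomial.induction_on with
  | C c => exact ⟨0, C c, by simp⟩
  | add p q hp hq =>
    obtain ⟨n, r, rfl⟩ := hp
    obtain ⟨m, r', rfl⟩ := hq
    obtain ⟨t, ht⟩ := up n (max n m) (le_max_left _ _) r
    obtain ⟨t', ht'⟩ := up m (max n m) (le_max_right _ _) r'
    exact ⟨_, t + t', by rw [map_add, ht, ht']⟩
  | mul_X p q hp =>
    obtain ⟨n, r, rfl⟩ := hp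
    rcases q with ⟨q | q, j⟩
    · obtain ⟨t, ht⟩ := up n (max n (j + 1)) (le_max_left _ _) r
      refine ⟨_, t * X (Sum.inr ⟨j, lt_of_lt_of_le (Nat.lt_succ_self j) (le_max_right _ _)⟩), ?_⟩
      rw [map_mul, ht, rename_X]; rfl
    · exact ⟨n, r * X (Sum.inl (q, j)), by simp [wv]⟩

noncomputable def psi (k ι : Type) [Field k] (n : ℕ) : Rn k ι (n + 1) →+* Polynomial (Rn k ι n) :=
  eval₂Hom (Polynomial.C.comp C) (Sum.elim (fun q => Polynomial.C (X (Sum.inl q)))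
    (Fin.lastCases Polynomial.X (fun j => Polynomial.C (X (Sum.inr j)))))

theorem psi_ev (n : ℕ) (φ : k →+* S) (D : S → S) (x : Option ι → S) (r) :
    (psi k ι n r).eval₂ (ev0 n φ D x) (D^[n] (x none)) = ev0 (n + 1) φ D x r := by
  have : (Polynomial.eval₂RingHom (ev0 n φ D x) (D^[n] (x none))).comp (psi k ι n) =
      ev0 (n + 1) φ D x := by
    apply MvPolynomial.ringHom_ext
    · intro r; simp [ev0, psi]
    · rintro (q | q)
      · simp [ev0, psi, nab, wv]
      · refine Fin.lastCases ?_ (fun j => ?_) q <;> simp [ev0, psi, nab, wv]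
  exact congrArg (fun g => g r) this

theorem psi_th (n : ℕ) (φ : k →+* S) (D : S → S) (a : ι → S) (r) :
    (psi k ι n r).eval₂ ((rename Fin.castSucc).toRingHom.comp (th n φ D a)) (X (Fin.last n)) =
      th (n + 1) φ D a r := by
  have : (Polynomial.eval₂RingHom ((rename Fin.castSucc).toRingHom.comp (th n φ D a))
      (X (Fin.last n))).comp (psi k ι n) = th (n + 1) φ D a := by
    apply MvPolynomial.ringHom_ext
    · intro r; simp [th, th0, psi]
    · rintro (q | q)
      · simp [th, th0, psi]
      · refine Fin.lastCases ?_ (fun j => ?_) q <;> simp [th, th0, psi]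
  exact congrArg (fun g => g r) this

theorem dichotomy {L : Type} [Field L] (φ : k →+* L) (D : L → L) (b : Option ι → L) :
    (∀ n, Tr φ D b n) ∨ ∃ n f, Mini φ D b n f := by
  classical
  by_cases h : ∀ n, Tr φ D b n
  · exact Or.inl h
  · right
    push Not at h
    have hn0 := Nat.find_spec h
    set N := Nat.find h with hN
    have hmin : ∀ m < N, Tr φ D b m := fun m hm => not_not.mp (Nat.find_min h hm)
    have hN0 : N ≠ 0 := by
      intro h0
      rw [h0] at hn0
      apply hn0
      intro r hr
      rw [ev0_th] at hr
      rw [MvPolynomial.eq_C_of_isEmpty (th 0 φ D (b ∘ some) r)] at hr ⊢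
      simpa using hr
    obtain ⟨n, hn⟩ := Nat.exists_eq_succ_of_ne_zero hN0
    rw [hn] at hn0
    simp only [Tr] at hn0
    push Not at hn0
    obtain ⟨r, hr1, hr2⟩ := hn0
    have tr : Tr φ D b n := hmin n (by omega)
    have ex : ∃ d, ∃ f : Polynomial (Rn k ι n), f.natDegree = d ∧
        f.eval₂ (ev0 n φ D b) (D^[n] (b none)) = 0 ∧ ∃ j, ev0 n φ D b (f.coeff j) ≠ 0 := by
      refine ⟨_, psi k ι n r, rfl, by rw [psi_ev]; exact hr1, ?_⟩
      by_contra hcon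
      push Not at hcon
      apply hr2
      refine (psi_th n φ D (b ∘ some) r).symm.trans ?_
      rw [Polynomial.eval₂_eq_sum, Polynomial.sum]
      refine Finset.sum_eq_zero fun j _ => ?_
      rw [RingHom.comp_apply, tr _ (hcon j), map_zero, zero_mul]
    obtain ⟨f, hf1, hf2, j, hj⟩ := Nat.find_spec ex
    have hm : ∀ g : Polynomial (Rn k ι n), g.eval₂ (ev0 n φ D b) (D^[n] (b none)) = 0 →
        g.natDegree < f.natDegree → ∀ j, ev0 n φ D b (g.coeff j) = 0 := by
      intro g hg hlt j
      by_contra hne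
      exact Nat.find_min ex (hf1 ▸ hlt) ⟨g, rfl, hg, j, hne⟩
    have hlead : ev0 n φ D b f.leadingCoeff ≠ 0 := by
      intro h0
      have he : (f.eraseLead).eval₂ (ev0 n φ D b) (D^[n] (b none)) = 0 := by
        have := congrArg (Polynomial.eval₂ (ev0 n φ D b) (D^[n] (b none)))
          f.eraseLead_add_C_mul_X_pow
        rw [Polynomial.eval₂_add, hf2] at this
        simpa [h0] using this
      rcases Nat.eq_zero_or_pos f.natDegree with h1 | h1
      · rw [Polynomial.leadingCoeff, h1] at h0
        rcases Nat.eq_zero_or_pos j with h2 | h2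
        · rw [h2] at hj; exact hj h0
        · rw [Polynomial.coeff_eq_zero_of_natDegree_lt (by omega), map_zero] at hj
          exact hj rfl
      · have hlt : f.eraseLead.natDegree < f.natDegree := by
          have := f.eraseLead_natDegree_le
          omega
        have := hm _ he hlt j
        rw [Polynomial.eraseLead_coeff] at this
        split_ifs at this with h3
        · rw [h3] at hj; exact hj h0
        · exact hj this
    refine ⟨n, f, hf2, hlead, ?_, hm, tr⟩
    rcases Nat.eq_zero_or_pos f.natDegree with h1 | h1
    · rw [Polynomial.eq_C_of_natDegree_eq_zero h1] at hf2
      rw [Polynomial.leadingCoeff, h1] at hlead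
      simp only [Polynomial.eval₂_C] at hf2
      exact absurd hf2 hlead
    · exact h1

theorem tr_step {L M : Type} [Field L] [Field M] {φ : k →+* L} {D : L → L} {b : Option ι → L}
    {φ' : k →+* M} {D' : M → M} {x : Option ι → M} (htr : ∀ n, Tr φ D b n)
    (hI : ∀ p, ev φ D (b ∘ some) p = 0 → ev φ' D' (x ∘ some) p = 0) (p)
    (hp : ev φ D b p = 0) : ev φ' D' x p = 0 := by
  obtain ⟨n, r, rfl⟩ := exists_rn p
  rw [← ev0_eq] at hp ⊢
  rw [ev0_th, th_mono hI _ (htr n r hp), map_zero]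

theorem mini_van {L M : Type} [Field L] [Field M] {φ : k →+* L} {D : L → L} {b : Option ι → L}
    {φ' : k →+* M} {D' : M → M} {x : Option ι → M} {n : ℕ}
    {f : Polynomial (Rn k ι n)} (hf : Mini φ D b n f)
    (hI : ∀ p, ev φ D (b ∘ some) p = 0 → ev φ' D' (x ∘ some) p = 0)
    (h1 : f.eval₂ (ev0 n φ' D' x) (D'^[n] (x none)) = 0)
    (h2 : ev0 n φ' D' x f.leadingCoeff ≠ 0) (g : Polynomial (Rn k ι n))
    (hg : g.eval₂ (ev0 n φ D b) (D^[n] (b none)) = 0) :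
    g.eval₂ (ev0 n φ' D' x) (D'^[n] (x none)) = 0 := by
  obtain ⟨m', q, r, hqr, hr⟩ := pseudo_div f hf.pos g
  have e2 := congrArg (Polynomial.eval₂ (ev0 n φ D b) (D^[n] (b none))) hqr
  have e1 := congrArg (Polynomial.eval₂ (ev0 n φ' D' x) (D'^[n] (x none))) hqr
  rw [Polynomial.eval₂_mul, Polynomial.eval₂_add, Polynomial.eval₂_mul, hg, hf.root] at e2
  simp only [mul_zero, zero_mul, zero_add] at e2
  have hr0 : r.eval₂ (ev0 n φ' D' x) (D'^[n] (x none)) = 0 := by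
    rw [Polynomial.eval₂_eq_sum, Polynomial.sum]
    refine Finset.sum_eq_zero fun j _ => ?_
    rw [ev0_th, th_mono hI _ (hf.tr _ (hf.min r e2.symm hr j)), map_zero, zero_mul]
  rw [Polynomial.eval₂_mul, Polynomial.eval₂_add, Polynomial.eval₂_mul, h1, hr0,
    Polynomial.eval₂_pow, Polynomial.eval₂_C] at e1
  simp only [zero_mul, add_zero, mul_eq_zero] at e1
  exact e1.resolve_left (pow_ne_zero _ h2)

theorem mini_step {L M : Type} [Field L] [Field M] {φ : k →+* L} {D : L → L} {b : Option ι → L}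
    {φ' : k →+* M} {D' : M → M} {x : Option ι → M} (hD : IsDer D) (hD' : IsDer D') {δ : k → k}
    (hφ : ∀ c, D (φ c) = φ (δ c)) (hφ' : ∀ c, D' (φ' c) = φ' (δ c)) {n : ℕ}
    {f : Polynomial (Rn k ι n)} (hf : Mini φ D b n f)
    (hI : ∀ p, ev φ D (b ∘ some) p = 0 → ev φ' D' (x ∘ some) p = 0)
    (h1 : f.eval₂ (ev0 n φ' D' x) (D'^[n] (x none)) = 0)
    (h2 : ev0 n φ' D' x f.leadingCoeff ≠ 0)
    (h3 : (Polynomial.derivative f).eval₂ (ev0 n φ' D' x) (D'^[n] (x none)) ≠ 0)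
    (p) (hp : ev φ D b p = 0) : ev φ' D' x p = 0 := by
  let DD : M × L → M × L := Prod.map D' D
  let Φ : k →+* M × L := φ'.prod φ
  let z : Option ι → M × L := fun i => (x i, b i)
  have hDD : IsDer DD := by
    refine ⟨fun x y => ?_, fun x y => ?_⟩
    · ext
      · exact hD'.1 _ _
      · exact hD.1 _ _
    · ext
      · exact hD'.2 _ _
      · exact hD.2 _ _
  have n1 : ∀ p, (ev Φ DD z p).1 = ev φ' D' x p := fun p =>
    ev_nat (RingHom.fst M L) (D := DD) (D' := D') (fun _ => rfl) Φ z p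
  have n2 : ∀ p, (ev Φ DD z p).2 = ev φ D b p := fun p =>
    ev_nat (RingHom.snd M L) (D := DD) (D' := D) (fun _ => rfl) Φ z p
  have i1 : ∀ n y, (DD^[n] y).1 = D'^[n] y.1 := fun n y => by simp [DD]
  have i2 : ∀ n y, (DD^[n] y).2 = D^[n] y.2 := fun n y => by simp [DD]
  have g1 : ∀ g : Polynomial (Rn k ι n), (g.eval₂ (ev0 n Φ DD z) (DD^[n] (z none))).1 =
      g.eval₂ (ev0 n φ' D' x) (D'^[n] (x none)) := fun g => by
    have := Polynomial.hom_eval₂ g (ev0 n Φ DD z) (RingHom.fst M L) (DD^[n] (z none))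
    simp only [RingHom.coe_fst, i1] at this
    rw [this]; congr 1
    ext r <;> simp [ev0_eq, n1]
  have g2 : ∀ g : Polynomial (Rn k ι n), (g.eval₂ (ev0 n Φ DD z) (DD^[n] (z none))).2 =
      g.eval₂ (ev0 n φ D b) (D^[n] (b none)) := fun g => by
    have := Polynomial.hom_eval₂ g (ev0 n Φ DD z) (RingHom.snd M L) (DD^[n] (z none))
    simp only [RingHom.coe_snd, i2] at this
    rw [this]; congr 1
    ext r <;> simp [ev0_eq, n2]
  obtain ⟨m, g, hg⟩ := os hDD (φ := Φ) (δ := δ) (fun c => by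
    ext
    · exact hφ' c
    · exact hφ c) z n f (by
      ext
      · rw [g1]; exact h1
      · rw [g2]; exact hf.root) f.leadingCoeff _ rfl p
  have hg2 := congrArg Prod.snd hg
  have hg1 := congrArg Prod.fst hg
  rw [g2, Prod.snd_mul, n2, hp, mul_zero] at hg2
  rw [g1, Prod.fst_mul, n1, Prod.pow_fst, Prod.fst_mul, g1, ev0_eq, n1, ← ev0_eq] at hg1
  rw [mini_van hf hI h1 h2 g hg2.symm] at hg1
  exact (mul_eq_zero.mp hg1).resolve_left (pow_ne_zero _ (mul_ne_zero h2 h3))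
end
end PG


namespace PG
open PaperGroups MvPolynomial

section
variable {k ι : Type} [Field k]

noncomputable def lft {n : ℕ} (g : Polynomial (Rn k ι n)) : MvPolynomial (Option ι × ℕ) k :=
  g.eval₂ (rename (wv n)).toRingHom (X (none, n))

theorem ev_lft {S : Type} [CommRing S] {n : ℕ} (g : Polynomial (Rn k ι n)) (φ : k →+* S)
    (D : S → S) (x : Option ι → S) :
    ev φ D x (lft g) = g.eval₂ (ev0 n φ D x) (D^[n] (x none)) := by
  rw [lft, Polynomial.hom_eval₂]
  congr 1
  · ext r
    · simp [ev0_eq]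
    · simp [ev0_eq]
  · simp [ev, nab]

theorem Mini.sep {L : Type} [Field L] [CharZero L] {φ : k →+* L} {D : L → L} {b : Option ι → L}
    {n : ℕ} {f : Polynomial (Rn k ι n)} (hf : Mini φ D b n f) :
    (Polynomial.derivative f).eval₂ (ev0 n φ D b) (D^[n] (b none)) ≠ 0 := by
  intro h
  have hp := hf.pos
  have := hf.min _ h (Polynomial.natDegree_derivative_lt hp.ne') (f.natDegree - 1)
  rw [Polynomial.coeff_derivative, Nat.sub_add_cancel hp, map_mul] at this
  rcases mul_eq_zero.mp this with h | h
  · exact hf.lead h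
  · rw [map_add, map_natCast, map_one] at h
    exact Nat.cast_add_one_ne_zero (R := L) _ h

def B8S (k : Type) [Field k] (ι : Type) : Prop :=
  ∀ (L : Type) [Field L] [CharZero L] (φ : k →+* L) (D : L → L)
    (b : ι → L) (δ : k → k), IsDer D → (∀ c, D (φ c) = φ (δ c)) →
    ∃ (P : Finset (MvPolynomial (ι × ℕ) k)) (Q : MvPolynomial (ι × ℕ) k),
      (∀ p ∈ P, ev φ D b p = 0) ∧ ev φ D b Q ≠ 0 ∧
      ∀ (M : Type) [Field M] (φ' : k →+* M) (D' : M → M) (x : ι → M), IsDer D' →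
        (∀ c, D' (φ' c) = φ' (δ c)) → (∀ p ∈ P, ev φ' D' x p = 0) → ev φ' D' x Q ≠ 0 →
        ∀ p, ev φ D b p = 0 → ev φ' D' x p = 0

theorem B8 (ι : Type) [Finite ι] : B8S k ι := by
  classical
  have rn : ∀ {α β S : Type} [CommRing S] (e : α → β) (φ : k →+* S) (D : S → S) (x : β → S) p,
      ev φ D x (rename (Prod.map e id) p) = ev φ D (x ∘ e) p := by
    intro α β S _ e φ D x p
    simp only [ev, coe_eval₂Hom, eval₂_rename]; rfl
  refine Finite.induction_empty_option (P := fun ι => B8S k ι) ?_ ?_ ?_ ι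
  · intro α β e ih L _ _ φ D b δ hD hφ
    obtain ⟨P, Q, h1, h2, h3⟩ := ih L φ D (b ∘ e) δ hD hφ
    refine ⟨P.image (rename (Prod.map e id)), rename (Prod.map e id) Q, ?_, ?_, ?_⟩
    · simpa [rn] using h1
    · rwa [rn]
    · intro M _ φ' D' x hD' hφ' hP hQ p hp
      rw [rn] at hQ
      have hh : ∀ p : MvPolynomial (β × ℕ) k, rename (Prod.map e id) (rename (Prod.map e.symm id) p) = p := fun p => by
        rw [rename_rename]; convert rename_id_apply p; ext <;> simp
      rw [← hh p, rn] at hp ⊢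
      exact h3 M φ' D' _ hD' hφ' (fun p hp => by
        rw [← rn]; exact hP _ (Finset.mem_image_of_mem _ hp)) hQ _ hp
  · intro L _ _ φ D b δ hD hφ
    refine ⟨∅, 1, by simp, by simp, ?_⟩
    intro M _ φ' D' x hD' hφ' _ _ p hp
    rw [MvPolynomial.eq_C_of_isEmpty p] at hp ⊢
    simp [ev] at hp ⊢
    exact hp
  · intro α _ ih L _ _ φ D b δ hD hφ
    obtain ⟨P, Q, h1, h2, h3⟩ := ih L φ D (b ∘ some) δ hD hφ
    rcases dichotomy φ D b with h | ⟨n, f, hf⟩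
    · refine ⟨P.image (rename (fun q => (some q.1, q.2))), rename (fun q => (some q.1, q.2)) Q,
        by simpa [ev_some] using h1, by rwa [ev_some], ?_⟩
      intro M _ φ' D' x hD' hφ' hP hQ
      rw [ev_some] at hQ
      exact tr_step h (h3 M φ' D' _ hD' hφ' (fun p hp => by
        rw [← ev_some]; exact hP _ (Finset.mem_image_of_mem _ hp)) hQ)
    · refine ⟨insert (lft f) (P.image (rename (fun q => (some q.1, q.2)))),
        rename (fun q => (some q.1, q.2)) Q * (rename (wv n) f.leadingCoeff *
          lft (Polynomial.derivative f)), ?_, ?_, ?_⟩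
      · simpa [ev_some, ev_lft, hf.root] using h1
      · rw [map_mul, map_mul, ev_some, ← ev0_eq, ev_lft]
        exact mul_ne_zero h2 (mul_ne_zero hf.lead hf.sep)
      · intro M _ φ' D' x hD' hφ' hP hQ
        rw [map_mul, map_mul, ev_some, ← ev0_eq, ev_lft] at hQ
        have hQ2 := right_ne_zero_of_mul hQ
        refine mini_step hD hD' hφ hφ' hf (h3 M φ' D' _ hD' hφ' (fun p hp => by
          rw [← ev_some]
          exact hP _ (Finset.mem_insert_of_mem (Finset.mem_image_of_mem _ hp)))
          (left_ne_zero_of_mul hQ)) ?_ (left_ne_zero_of_mul hQ2) (right_ne_zero_of_mul hQ2)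
        rw [← ev_lft]; exact hP _ (Finset.mem_insert_self _ _)

theorem Mini.alg {L : Type} [Field L] {φ : k →+* L} {D : L → L} {b : Option ι → L}
    {n : ℕ} {f : Polynomial (Rn k ι n)} (hf : Mini φ D b n f) (g : Polynomial (Rn k ι n))
    (hg : g.eval₂ (ev0 n φ D b) (D^[n] (b none)) ≠ 0) :
    ∃ (w : Polynomial (Rn k ι n)) (r : Rn k ι n), ev0 n φ D b r ≠ 0 ∧
      (g * w - Polynomial.C r).eval₂ (ev0 n φ D b) (D^[n] (b none)) = 0 := by
  set e := ev0 n φ D b with he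
  set y := D^[n] (b none)
  let A : Subring L := e.range
  have key : ∀ h : Polynomial (Rn k ι n),
      Polynomial.aeval y (h.map e.rangeRestrict) = h.eval₂ e y := fun h => by
    rw [Polynomial.aeval_def, Polynomial.eval₂_map]; rfl
  have hy : IsAlgebraic A y := by
    refine ⟨f.map e.rangeRestrict, ?_, ?_⟩
    · intro h0
      have := congrArg (fun p : Polynomial A => ((p.coeff f.natDegree : A) : L)) h0
      simp only [Polynomial.coeff_map] at this
      exact hf.lead this
    · rw [key]; exact hf.root
  have hs : g.eval₂ e y ∈ Algebra.adjoin A {y} := by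
    rw [Algebra.adjoin_singleton_eq_range_aeval]
    exact ⟨g.map e.rangeRestrict, key g⟩
  have hal : Algebra.IsAlgebraic A (Algebra.adjoin A {y}) :=
    ⟨fun s => (isAlgebraic_algebraMap_iff (A := L) Subtype.val_injective).mp
      ((Algebra.adjoin_le (S := Subalgebra.algebraicClosure A L) (by simpa [Subalgebra.mem_algebraicClosure] using hy)) s.2)⟩
  obtain ⟨⟨_, r, rfl⟩, hr, w, hw⟩ := IsAlgebraic.exists_nonzero_dvd (R := A)
    (hal.isAlgebraic ⟨_, hs⟩) (mem_nonZeroDivisors_of_ne_zero (by simpa [Subtype.ext_iff] using hg))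
  obtain ⟨w', hw'⟩ : (w : L) ∈ (Polynomial.aeval (R := A) y).range :=
    (Algebra.adjoin_singleton_eq_range_aeval A y) ▸ w.2
  have hsur : Function.Surjective e.rangeRestrict := e.rangeRestrict_surjective
  obtain ⟨w0, rfl⟩ := Polynomial.map_surjective _ hsur w'
  refine ⟨w0, r, fun h => hr (Subtype.ext h), ?_⟩
  have h1 := congrArg (Subtype.val) hw
  have h2 : (w : L) = w0.eval₂ e y := by rw [← hw', ← key]; rfl
  rw [Polynomial.eval₂_sub, Polynomial.eval₂_mul, Polynomial.eval₂_C, ← h2, sub_eq_zero]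
  exact h1.symm

theorem Blum.algClosed {K : Type} [Field K] {D : K → K} (h : Blum D) : IsAlgClosed K := by
  refine IsAlgClosed.of_exists_root _ fun p _ hp => ?_
  obtain ⟨c, hc, -⟩ := h 0 (p.map C) 1 (by
    rw [Polynomial.natDegree_map]; exact hp.natDegree_pos) one_ne_zero
  refine ⟨c, ?_⟩
  rw [Polynomial.eval₂_map] at hc
  have e : (eval (fun j : Fin 0 => D^[j] c)).comp C = RingHom.id K := by ext; simp
  rw [e] at hc
  simpa [Polynomial.eval₂_id] using hc

theorem ev0_zero {S : Type} [CommRing S] (φ : k →+* S) (D : S → S) (x : Option ι → S)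
    (r : Rn k ι 0) : ev0 0 φ D x r = ev φ D (x ∘ some) (coeff 0 (th0 k ι 0 r)) := by
  rw [ev0_th, th, RingHom.comp_apply, MvPolynomial.eq_C_of_isEmpty (th0 k ι 0 r)]
  simp

theorem th_ne {L K : Type} [Field L] [Field K] {n : ℕ} (φ : k →+* L) (D : L → L)
    (b : Option ι → L) (r : Rn k ι n) (h : ev0 n φ D b r ≠ 0) :
    ∃ Q, ev φ D (b ∘ some) Q ≠ 0 ∧ ∀ (φ' : k →+* K) (D' : K → K) (a : ι → K),
      ev φ' D' a Q ≠ 0 → th n φ' D' a r ≠ 0 := by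
  have : th n φ D (b ∘ some) r ≠ 0 := fun h0 => h (by rw [ev0_th, h0, map_zero])
  obtain ⟨m, hm⟩ := MvPolynomial.ne_zero_iff.mp this
  refine ⟨coeff m (th0 k ι n r), by simpa [th, coeff_map] using hm, fun φ' D' a ha h0 => ha ?_⟩
  simpa [th, coeff_map] using congrArg (coeff m) h0

/-- the type of axioms used -/
def Ax {K : Type} [Field K] (D' : K → K) (Z : Prop) : Prop :=
  Blum D' ∨ ((∀ z, D' z = 0) ∧ IsAlgClosed K ∧ Z)

theorem Ax.algClosed {K : Type} [Field K] {D' : K → K} {Z : Prop} (h : Ax D' Z) :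
    IsAlgClosed K := h.elim Blum.algClosed (fun h => h.2.1)

theorem no_tr {L : Type} [Field L] {φ : k →+* L} {D : L → L} {b : Option ι → L}
    (hZ : ∀ z, D z = 0) {n : ℕ} (hn : 2 ≤ n) (h : Tr φ D b n) : False := by
  have := h (X (Sum.inr ⟨1, hn⟩)) (by simp [ev0, nab, wv, hZ])
  simp [th, th0] at this

abbrev cns {K : Type} (c : K) (a : ι → K) : Option ι → K := fun o => o.elim c a

def Rat {S : Type} [CommRing S] (φ : k →+* S) (D : S → S) (b : Option ι → S) : Prop :=
  ∃ P Q, ev φ D (b ∘ some) Q ≠ 0 ∧ ev φ D (b ∘ some) Q * b none = ev φ D (b ∘ some) P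

theorem KEY {L K : Type} [Field L] [CharZero L] [Field K] [CharZero K] {φ : k →+* L} {D : L → L}
    {φ' : k →+* K} {D' : K → K} (hD : IsDer D) (hD' : IsDer D') {δ : k → k}
    (hφ : ∀ c, D (φ c) = φ (δ c)) (hφ' : ∀ c, D' (φ' c) = φ' (δ c))
    (hB : Ax D' (∀ z : L, D z = 0)) (b : Option ι → L) (q) (hq : ev φ D b q ≠ 0) :
    ∃ Q, ev φ D (b ∘ some) Q ≠ 0 ∧ ∀ a : ι → K,
      (∀ p, ev φ D (b ∘ some) p = 0 → ev φ' D' a p = 0) → ev φ' D' a Q ≠ 0 →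
      ∀ e : K, ∃ c, (∀ p, ev φ D b p = 0 → ev φ' D' (cns c a) p = 0) ∧
        ev φ' D' (cns c a) q ≠ 0 ∧ (¬ Rat φ D b → c ≠ e) := by
  have cs : ∀ (c : K) (a : ι → K), cns c a ∘ some = a := fun c a => rfl
  rcases dichotomy φ D b with h | ⟨n, f, hf⟩
  · obtain ⟨n, r, rfl⟩ := exists_rn q
    rw [← ev0_eq] at hq
    obtain ⟨Q, hQ, hQ'⟩ := th_ne (K := K) φ D b r hq
    refine ⟨Q, hQ, fun a hI ha e => ?_⟩
    rcases hB with hB | ⟨-, -, hZ⟩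
    swap
    · exact (no_tr hZ le_rfl (h 2)).elim
    obtain ⟨c, -, hc⟩ := hB (n + 1) Polynomial.X
      (rename Fin.castSucc (th n φ' D' a r) * (X 0 - C e)) (by simp)
      (mul_ne_zero (by
        rw [Ne, map_eq_zero_iff _ (rename_injective _ (Fin.castSucc_injective n))]
        exact hQ' _ _ _ ha) (fun h0 => by
          have := congrArg (eval (fun _ => e + 1)) h0
          simp at this))
    rw [map_mul] at hc
    refine ⟨c, tr_step h (by rw [cs]; exact hI), ?_, fun _ => ?_⟩
    · rw [← ev0_eq, ev0_th]
      have := left_ne_zero_of_mul hc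
      rw [eval_rename] at this
      exact this
    · have := right_ne_zero_of_mul hc
      simpa [sub_eq_zero] using this
  · obtain ⟨m, g, hg⟩ := os hD hφ b n f hf.root f.leadingCoeff _ rfl q
    have hu := mul_ne_zero hf.lead hf.sep
    obtain ⟨w1, r1, hr1, hw1⟩ := hf.alg _ hf.sep
    obtain ⟨w2, r2, hr2, hw2⟩ := hf.alg g (hg ▸ mul_ne_zero (pow_ne_zero _ hu) hq)
    obtain ⟨Q, hQ, hQ'⟩ := th_ne (K := K) φ D b (f.leadingCoeff * (r1 * r2)) (by
      rw [map_mul, map_mul]; exact mul_ne_zero hf.lead (mul_ne_zero hr1 hr2))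
    refine ⟨Q, hQ, fun a hI ha e => ?_⟩
    have hH := hQ' φ' D' a ha
    have hl : th n φ' D' a f.leadingCoeff ≠ 0 := by
      rw [map_mul] at hH; exact left_ne_zero_of_mul hH
    have der : ∀ c, f.eval₂ (ev0 n φ' D' (cns c a)) (D'^[n] c) = 0 →
        eval (fun j : Fin n => D'^[j] c) (th n φ' D' a (f.leadingCoeff * (r1 * r2))) ≠ 0 →
        (Polynomial.derivative f).eval₂ (ev0 n φ' D' (cns c a)) (D'^[n] c) ≠ 0 ∧
        (∀ p, ev φ D b p = 0 → ev φ' D' (cns c a) p = 0) ∧ ev φ' D' (cns c a) q ≠ 0 := by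
      intro c h1 h2
      have h2' : ev0 n φ' D' (cns c a) (f.leadingCoeff * (r1 * r2)) ≠ 0 := by rw [ev0_th]; exact h2
      rw [map_mul, map_mul] at h2'
      have h3 := left_ne_zero_of_mul h2'
      have h4 := right_ne_zero_of_mul h2'
      have van := fun g => mini_van (x := cns c a) hf hI h1 h3 g
      have nz : ∀ g w r, (g * w - Polynomial.C r).eval₂ (ev0 n φ D b) (D^[n] (b none)) = 0 →
          ev0 n φ' D' (cns c a) r ≠ 0 → g.eval₂ (ev0 n φ' D' (cns c a)) (D'^[n] c) ≠ 0 := by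
        intro g w r h5 h6 h7
        have := van _ h5
        rw [Polynomial.eval₂_sub, Polynomial.eval₂_mul, Polynomial.eval₂_C] at this
        change Polynomial.eval₂ _ (D'^[n] c) g * _ - _ = 0 at this
        rw [h7, zero_mul, zero_sub, neg_eq_zero] at this
        exact h6 this
      have h5 := nz _ _ _ hw1 (left_ne_zero_of_mul h4)
      have h6 := nz _ _ _ hw2 (right_ne_zero_of_mul h4)
      have st := mini_step hD hD' hφ hφ' (x := cns c a) hf hI h1 h3 h5
      refine ⟨h5, st, ?_⟩
      have := st ((rename (wv n) f.leadingCoeff * lft (Polynomial.derivative f)) ^ m * q - lft g)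
        (by rw [map_sub, map_mul, map_pow, map_mul, ev_lft, ev_lft, ← ev0_eq, hg, sub_self])
      rw [map_sub, map_mul, map_pow, ev_lft] at this
      intro h0
      rw [h0, mul_zero, zero_sub, neg_eq_zero] at this
      exact h6 this
    have emap : ∀ c, (f.map (th n φ' D' a)).eval₂ (eval (fun j : Fin n => D'^[j] c)) (D'^[n] c)
        = f.eval₂ (ev0 n φ' D' (cns c a)) (D'^[n] c) := fun c => by
      rw [Polynomial.eval₂_map]; congr 1
      ext r
      · exact (ev0_th n φ' D' (cns c a) _).symm
      · exact (ev0_th n φ' D' (cns c a) _).symm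
    have hdeg : (f.map (th n φ' D' a)).natDegree = f.natDegree :=
      Polynomial.natDegree_map_of_leadingCoeff_ne_zero _ hl
    rcases n with _ | n
    · haveI := hB.algClosed
      let E : Rn k ι 0 →+* K := (eval (fun j : Fin 0 => D'^[j] e)).comp (th 0 φ' D' a)
      have hE : ∀ c r, ev0 0 φ' D' (cns c a) r = E r := fun c r => by
        rw [ev0_th]; simp only [E, RingHom.comp_apply]
        congr 2; exact Subsingleton.elim _ _
      have hE' : ∀ c, ev0 0 φ' D' (cns c a) = E := fun c => RingHom.ext (hE c)
      have hlE : E f.leadingCoeff ≠ 0 := fun h0 => hl (by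
        have : eval (fun j : Fin 0 => D'^[j] e) (th 0 φ' D' a f.leadingCoeff) = 0 := h0
        rw [MvPolynomial.eq_C_of_isEmpty (th 0 φ' D' a f.leadingCoeff)] at this ⊢
        simpa using this)
      have hHE : ∀ c, eval (fun j : Fin 0 => D'^[j] c)
          (th 0 φ' D' a (f.leadingCoeff * (r1 * r2))) ≠ 0 := fun c h0 => hH (by
        rw [MvPolynomial.eq_C_of_isEmpty (th 0 φ' D' a _)] at h0 ⊢
        simpa using h0)
      have hdE : (f.map E).natDegree = f.natDegree :=
        Polynomial.natDegree_map_of_leadingCoeff_ne_zero _ hlE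
      have fin : ∀ c, (f.map E).eval c = 0 → (Polynomial.derivative (f.map E)).eval c ≠ 0 ∧
        (∀ p, ev φ D b p = 0 → ev φ' D' (cns c a) p = 0) ∧ ev φ' D' (cns c a) q ≠ 0 := by
        intro c hc
        rw [Polynomial.derivative_map, Polynomial.eval_map]
        rw [Polynomial.eval_map] at hc
        simpa [hE'] using der c (by simpa [hE'] using hc) (hHE c)
      have root : ∀ g : Polynomial K, 0 < g.natDegree → ∃ c, g.eval c = 0 := fun g hg =>
        IsAlgClosed.exists_root g (by
          rw [Polynomial.degree_eq_natDegree (by rintro rfl; simp at hg)]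
          exact_mod_cast hg.ne')
      by_cases hr : Rat φ D b
      · obtain ⟨c, hc⟩ := root (f.map E) (hdE ▸ hf.pos)
        exact ⟨c, (fin c hc).2.1, (fin c hc).2.2, fun h => absurd hr h⟩
      · have h2 : 2 ≤ f.natDegree := by
          by_contra h2
          have h1 : f.natDegree = 1 := by have := hf.pos; omega
          apply hr
          have hroot := hf.root
          rw [Polynomial.eval₂_eq_sum_range, h1, Finset.sum_range_succ, Finset.sum_range_one] at hroot
          have hlead := hf.lead
          rw [Polynomial.leadingCoeff, h1] at hlead
          rw [ev0_zero] at hlead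
          refine ⟨-coeff 0 (th0 k ι 0 (f.coeff 0)), _, hlead, ?_⟩
          rw [map_neg, ← ev0_zero, ← ev0_zero]
          simp only [pow_zero, mul_one, pow_one, Function.iterate_zero, id] at hroot
          linear_combination hroot
        by_cases he : (f.map E).eval e = 0
        · obtain ⟨F1, hF1⟩ := Polynomial.dvd_iff_isRoot.mpr he
          have hd := congrArg Polynomial.natDegree hF1
          have hF10 : F1 ≠ 0 := by
            rintro rfl
            rw [mul_zero, Polynomial.natDegree_zero, hdE] at hd; omega
          rw [Polynomial.natDegree_mul (Polynomial.X_sub_C_ne_zero e) hF10,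
            Polynomial.natDegree_X_sub_C, hdE] at hd
          obtain ⟨c, hc⟩ := root F1 (by omega)
          have hc' := fin c (by rw [hF1, Polynomial.eval_mul, hc, mul_zero])
          refine ⟨c, hc'.2.1, hc'.2.2, ?_⟩
          rintro - rfl
          apply hc'.1
          rw [hF1]; simp [hc]
        · obtain ⟨c, hc⟩ := root (f.map E) (by omega)
          exact ⟨c, (fin c hc).2.1, (fin c hc).2.2, fun _ h => he (h ▸ hc)⟩
    · have hne : th (n + 1) φ' D' a (f.leadingCoeff * (r1 * r2)) * (X 0 - C e) ≠ 0 :=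
        mul_ne_zero hH (fun h0 => by
          have := congrArg (eval (fun _ => e + 1)) h0
          simp at this)
      have hc : ∃ c, f.eval₂ (ev0 (n + 1) φ' D' (cns c a)) (D'^[n + 1] c) = 0 ∧
          eval (fun j : Fin (n + 1) => D'^[j] c)
            (th (n + 1) φ' D' a (f.leadingCoeff * (r1 * r2)) * (X 0 - C e)) ≠ 0 := by
        rcases hB with hB | ⟨hZ', -, hZ⟩
        · obtain ⟨c, h1, h2⟩ := hB (n + 1) (f.map (th (n + 1) φ' D' a)) _ (hdeg ▸ hf.pos) hne
          exact ⟨c, by rw [← emap]; exact h1, h2⟩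
        · obtain rfl : n = 0 := by
            by_contra hn
            exact no_tr hZ (by omega) hf.tr
          have : ∃ v, eval v (th (0 + 1) φ' D' a (f.leadingCoeff * (r1 * r2)) * (X 0 - C e)) ≠ 0 := by
            by_contra hcon
            push Not at hcon
            exact hne (MvPolynomial.funext fun v => by rw [hcon v, map_zero])
          obtain ⟨v, hv⟩ := this
          have hv' : v = fun j : Fin (0 + 1) => D'^[j] (v 0) := by
            ext j; fin_cases j; rfl
          refine ⟨v 0, ?_, hv' ▸ hv⟩
          have hr := hf.root
          have z0 : ∀ (S : Type) [CommRing S] (e : Rn k ι (0 + 1) →+* S),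
            f.eval₂ e 0 = e (f.coeff 0) := fun S _ e => by simp [Polynomial.eval₂_at_zero]
          simp only [zero_add, Function.iterate_one, hZ, hZ'] at hr ⊢
          rw [Polynomial.eval₂_at_zero] at hr ⊢
          rw [ev0_th, cs, th_mono hI _ (hf.tr _ hr), map_zero]
      obtain ⟨c, h1, h2⟩ := hc
      rw [map_mul] at h2
      have := der c h1 (left_ne_zero_of_mul h2)
      refine ⟨c, this.2.1, this.2.2, fun _ => ?_⟩
      have := right_ne_zero_of_mul h2
      simpa [sub_eq_zero] using this
end
end PG


namespace PG
open PaperGroups MvPolynomial Filter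

structure Cx (K : Type) [Field K] where
  k : Type
  fk : Field k
  φ : k →+* K
  D : K → K
  δ : k → k
  hD : IsDer D
  hφ : ∀ c, D (φ c) = φ (δ c)
  ax : Blum D ∨ ((∀ z, D z = 0) ∧ IsAlgClosed K)

attribute [instance] Cx.fk

variable {K : Type} [Field K] [CharZero K]

section
variable (C : Cx K) {ι α β : Type}

noncomputable abbrev Cx.e (x : ι → K) : MvPolynomial (ι × ℕ) C.k →+* K := ev C.φ C.D x

noncomputable def gD (U : Ultrafilter α) (D : K → K) : Germ (U : Filter α) K → Germ (U : Filter α) K :=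
  Germ.map D

noncomputable def gφ (U : Ultrafilter α) : C.k →+* Germ (U : Filter α) K :=
  (Germ.coeRingHom (U : Filter α)).comp ((Pi.constRingHom α K).comp C.φ)

def gb (U : Ultrafilter α) (f : α → ι → K) : ι → Germ (U : Filter α) K := fun i => ↑(fun x => f x i)

theorem losz (U : Ultrafilter α) (f : α → ι → K) (p) :
    ev (gφ C U) (gD U C.D) (gb U f) p = 0 ↔ ∀ᶠ x in U, C.e (f x) p = 0 := by
  have h1 : ∀ x, C.e (f x) p =
      ev ((Pi.constRingHom α K).comp C.φ) (fun g a => C.D (g a)) (fun i x => f x i) p x := fun x => by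
    have := ev_nat (Pi.evalRingHom (fun _ : α => K) x) (D' := C.D) (D := fun g a => C.D (g a)) (fun z => rfl)
      ((Pi.constRingHom α K).comp C.φ) (fun i x => f x i) p
    rw [Pi.evalRingHom_apply] at this
    exact this.symm
  have h2 := ev_nat (Germ.coeRingHom (R := K) (U : Filter α)) (D' := gD U C.D)
    (D := fun g a => C.D (g a)) (fun z => rfl) ((Pi.constRingHom α K).comp C.φ)
    (fun i x => f x i) p
  rw [show ev (gφ C U) (gD U C.D) (gb U f) p = _ from h2.symm]
  simp only [h1]
  exact Germ.coe_eq

theorem gD_der (U : Ultrafilter α) : IsDer (gD U C.D) := by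
  constructor
  · intro x y
    induction x, y using Germ.inductionOn₂ with
    | _ f g => exact Germ.coe_eq.mpr (Eventually.of_forall fun x => C.hD.1 _ _)
  · intro x y
    induction x, y using Germ.inductionOn₂ with
    | _ f g => exact Germ.coe_eq.mpr (Eventually.of_forall fun x => C.hD.2 _ _)

theorem gφ_der (U : Ultrafilter α) (c) : gD U C.D (gφ C U c) = gφ C U (C.δ c) :=
  Germ.coe_eq.mpr (Eventually.of_forall fun x => C.hφ _)

theorem gchar (U : Ultrafilter α) : CharZero (Germ (U : Filter α) K) :=
  charZero_of_injective_ringHom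
    (f := (Germ.coeRingHom (R := K) (U : Filter α)).comp (Pi.constRingHom α K)) (RingHom.injective _)

theorem gax (U : Ultrafilter α) : Ax C.D (∀ z : Germ (U : Filter α) K, gD U C.D z = 0) := by
  rcases C.ax with h | ⟨h, h'⟩
  · exact .inl h
  · refine .inr ⟨h, h', fun z => ?_⟩
    induction z using Germ.inductionOn with
    | _ f => exact Germ.coe_eq.mpr (Eventually.of_forall fun x => h _)

inductive Con (C : Cx K) {ι : Type} : Set (ι → K) → Prop
  | z (p) : Con C {x | C.e x p = 0}
  | inter {S T} : Con C S → Con C T → Con C (S ∩ T)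
  | compl {S} : Con C S → Con C Sᶜ

variable {C}

theorem Con.union {S T : Set (ι → K)} (hS : Con C S) (hT : Con C T) : Con C (S ∪ T) := by
  have := (hS.compl.inter hT.compl).compl
  rwa [Set.compl_inter, compl_compl, compl_compl] at this

theorem Con.univ : Con C (Set.univ : Set (ι → K)) := by
  simpa using Con.z (C := C) (ι := ι) 0

theorem Con.iUnion {γ : Type} (t : Finset γ) (B : γ → Set (ι → K)) (h : ∀ i ∈ t, Con C (B i)) :
    Con C (⋃ i ∈ t, B i) := by
  classical
  induction t using Finset.induction_on with
  | empty => simpa using (Con.univ (C := C) (ι := ι)).compl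
  | insert a t _ ih =>
    rw [Finset.set_biUnion_insert]
    exact (h _ (Finset.mem_insert_self _ _)).union (ih fun i hi => h i (Finset.mem_insert_of_mem hi))

theorem Con.iInter {γ : Type} (t : Finset γ) (B : γ → Set (ι → K)) (h : ∀ i ∈ t, Con C (B i)) :
    Con C (⋂ i ∈ t, B i) := by
  have := (Con.iUnion t (fun i => (B i)ᶜ) fun i hi => (h i hi).compl).compl
  simpa using this

theorem Con.agree {S : Set (ι → K)} (hS : Con C S) (U : Ultrafilter α) (V : Ultrafilter β)
    (f : α → ι → K) (g : β → ι → K)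
    (h : ∀ p, (∀ᶠ x in U, C.e (f x) p = 0) ↔ ∀ᶠ x in V, C.e (g x) p = 0) :
    (∀ᶠ x in U, f x ∈ S) ↔ ∀ᶠ x in V, g x ∈ S := by
  induction hS with
  | z p => exact h p
  | inter _ _ h1 h2 => simp only [Set.mem_inter_iff, eventually_and, h1, h2]
  | compl _ h1 => simp only [Set.mem_compl_iff, Ultrafilter.eventually_not, h1]

theorem Con.isol {S : Set (ι → K)} (hS : Con C S) (U : Ultrafilter (ι → K)) :
    ∃ q, (¬ ∀ᶠ x in U, C.e x q = 0) ∧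
      ((S ∈ U ∧ ∀ x, (∀ p, (∀ᶠ x in U, C.e x p = 0) → C.e x p = 0) → C.e x q ≠ 0 → x ∈ S) ∨
      (Sᶜ ∈ U ∧ ∀ x, (∀ p, (∀ᶠ x in U, C.e x p = 0) → C.e x p = 0) → C.e x q ≠ 0 → x ∉ S)) := by
  induction hS with
  | z p =>
    by_cases h : ∀ᶠ x in U, C.e x p = 0
    · exact ⟨1, by simp [U.neBot.ne], .inl ⟨h, fun x hx _ => hx p h⟩⟩
    · exact ⟨p, h, .inr ⟨Ultrafilter.compl_mem_iff_notMem.mpr h, fun x _ hx => hx⟩⟩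
  | @inter S T _ _ h1 h2 =>
    obtain ⟨q1, h1, h1'⟩ := h1
    obtain ⟨q2, h2, h2'⟩ := h2
    rcases h1' with ⟨a1, b1⟩ | ⟨a1, b1⟩
    · rcases h2' with ⟨a2, b2⟩ | ⟨a2, b2⟩
      · refine ⟨q1 * q2, ?_, .inl ⟨inter_mem a1 a2, fun x hx hq => ?_⟩⟩
        · simp only [map_mul, mul_eq_zero, Ultrafilter.eventually_or]; tauto
        · rw [map_mul, mul_ne_zero_iff] at hq
          exact ⟨b1 x hx hq.1, b2 x hx hq.2⟩
      · exact ⟨q2, h2, .inr ⟨mem_of_superset a2 (Set.compl_subset_compl.mpr Set.inter_subset_right),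
          fun x hx hq h => b2 x hx hq h.2⟩⟩
    · exact ⟨q1, h1, .inr ⟨mem_of_superset a1 (Set.compl_subset_compl.mpr Set.inter_subset_left),
          fun x hx hq h => b1 x hx hq h.1⟩⟩
  | compl _ h1 =>
    obtain ⟨q, h, h'⟩ := h1
    refine ⟨q, h, h'.symm.imp (fun h => ⟨h.1, fun x hx hq => h.2 x hx hq⟩)
      (fun h => ⟨by simpa using h.1, fun x hx hq => by simpa using h.2 x hx hq⟩)⟩

variable (C) in
/-- basic sets -/
def bas (P : Finset (MvPolynomial (ι × ℕ) C.k)) (Q : MvPolynomial (ι × ℕ) C.k) : Set (ι → K) :=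
  {x | (∀ p ∈ P, C.e x p = 0) ∧ C.e x Q ≠ 0}

theorem Con.bass (P : Finset (MvPolynomial (ι × ℕ) C.k)) (Q : MvPolynomial (ι × ℕ) C.k) :
    Con C (bas C P Q) := by
  have := (Con.iInter P (fun p => {x : ι → K | C.e x p = 0}) fun p _ => Con.z p).inter (Con.z Q).compl
  convert this using 1
  ext x; simp [bas]

theorem b8 [Finite ι] (U : Ultrafilter α) (f : α → ι → K) :
    ∃ P Q, (∀ᶠ x in U, f x ∈ bas C P Q) ∧ ∀ x ∈ bas C P Q, ∀ p, (∀ᶠ x in U, C.e (f x) p = 0) → C.e x p = 0 := by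
  haveI := gchar (K := K) U
  obtain ⟨P, Q, h1, h2, h3⟩ := B8 (k := C.k) ι _ (gφ C U) (gD U C.D) (gb U f) C.δ (gD_der C U) (gφ_der C U)
  refine ⟨P, Q, ?_, fun x hx p hp => h3 K C.φ C.D x C.hD C.hφ hx.1 hx.2 p ((losz C U f p).mpr hp)⟩
  simp only [bas, Set.mem_setOf_eq, eventually_and, Ultrafilter.eventually_not, ne_eq]
  refine ⟨?_, fun h => h2 ((losz C U f Q).mpr h)⟩
  rw [Filter.eventually_all_finset]
  exact fun p hp => (losz C U f p).mp (h1 p hp)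

theorem cpt {S : Set α} (𝓑 : Set (Set α)) (h : ∀ U : Ultrafilter α, S ∈ U → ∃ B ∈ 𝓑, B ∈ U) :
    ∃ t : Finset (Set α), ↑t ⊆ 𝓑 ∧ S ⊆ ⋃ B ∈ t, B := by
  classical
  by_contra hn
  push Not at hn
  let g : Finset 𝓑 → Set α := fun t => S \ ⋃ B ∈ t, B.1
  have hne : ∀ t, (g t).Nonempty := fun t => by
    have := hn (t.image Subtype.val) (by simp)
    obtain ⟨x, hx, hx'⟩ := Set.not_subset.mp this
    exact ⟨x, hx, by simpa using hx'⟩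
  have hdir : Directed (· ≥ ·) (fun t => 𝓟 (g t)) := fun s t =>
    ⟨s ∪ t, by
      simp only [ge_iff_le, le_principal_iff, mem_principal]
      exact Set.diff_subset_diff_right (Set.biUnion_subset_biUnion_left fun x hx => Finset.mem_union_left _ hx), by
      simp only [ge_iff_le, le_principal_iff, mem_principal]
      exact Set.diff_subset_diff_right (Set.biUnion_subset_biUnion_left fun x hx => Finset.mem_union_right _ hx)⟩
  haveI : NeBot (⨅ t, 𝓟 (g t)) := iInf_neBot_of_directed' hdir fun t => principal_neBot_iff.mpr (hne t)
  let U := Ultrafilter.of (⨅ t, 𝓟 (g t))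
  have hU : ∀ t, g t ∈ U := fun t => Ultrafilter.of_le _ (mem_iInf_of_mem t (mem_principal_self _))
  obtain ⟨B, hB, hBU⟩ := h U (mem_of_superset (hU ∅) (by simp [g]))
  obtain ⟨x, hx⟩ := U.nonempty_of_mem (inter_mem hBU (hU {⟨B, hB⟩}))
  simp [g] at hx
  exact hx.2.2 hB hx.1

theorem loc [Finite ι] {S : Set (Option ι → K)} (hS : Con C S) (U : Ultrafilter (Option ι → K)) (hU : S ∈ U) :
    ∃ P Q, (∀ᶠ x in U, x ∘ some ∈ bas C P Q) ∧ ∀ a ∈ bas C P Q, ∀ e, ∃ c, cns c a ∈ S ∧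
      ((¬ ∃ P' Q' : MvPolynomial (ι × ℕ) C.k, (∀ᶠ x : Option ι → K in U, C.e (x ∘ some) Q' ≠ 0) ∧
        ∀ᶠ x : Option ι → K in U, C.e (x ∘ some) Q' * x none = C.e (x ∘ some) P') → c ≠ e) := by
  haveI := gchar (K := K) U
  obtain ⟨q, hq, h⟩ := hS.isol U
  have h : ∀ x, (∀ p, (∀ᶠ x in U, C.e x p = 0) → C.e x p = 0) → C.e x q ≠ 0 → x ∈ S := by
    rcases h with h | h
    · exact h.2
    · exact absurd hU (Ultrafilter.compl_mem_iff_notMem.mp h.1)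
  obtain ⟨P, Q1, h1, h2⟩ := b8 (C := C) U (fun x : Option ι → K => x ∘ some)
  obtain ⟨Q, hQ, h3⟩ := KEY (gD_der C U) C.hD (gφ_der C U) C.hφ (gax C U) (gb U id) q
    (fun h => hq ((losz C U id q).mp h))
  have hQ : ¬ ∀ᶠ x in U, C.e (x ∘ some) Q = 0 := fun h => hQ ((losz C U (fun x => x ∘ some) Q).mpr h)
  refine ⟨P, Q1 * Q, ?_, fun a ha e => ?_⟩
  · filter_upwards [h1, Ultrafilter.eventually_not.mpr hQ] with x hx hx'
    exact ⟨hx.1, by rw [map_mul]; exact mul_ne_zero hx.2 hx'⟩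
  · have ha2 := ha.2
    rw [map_mul, mul_ne_zero_iff] at ha2
    obtain ⟨c, hc, hc1, hc2⟩ := h3 a (fun p hp => h2 a ⟨ha.1, ha2.1⟩ p ((losz C U (fun x => x ∘ some) p).mp hp)) ha2.2 e
    refine ⟨c, h _ (fun p hp => hc p ((losz C U id p).mpr hp)) hc1, fun hr => hc2 fun ⟨P', Q', hQ', h'⟩ => hr ⟨P', Q', ?_, ?_⟩⟩
    · exact Ultrafilter.eventually_not.mpr fun hh => hQ' ((losz C U (fun x => x ∘ some) Q').mpr hh)
    · have := (losz C U id (rename (fun q => (some q.1, q.2)) Q' * X (none, 0) - rename (fun q => (some q.1, q.2)) P')).mp (by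
        rw [map_sub, map_mul, ev_some, ev_some, sub_eq_zero, ← h']
        simp [ev, nab])
      filter_upwards [this] with x hx
      rw [map_sub, map_mul, Cx.e, ev_some, ev_some, sub_eq_zero] at hx
      simpa [ev, nab] using hx

theorem Con.proj [Finite ι] {S : Set (Option ι → K)} (hS : Con C S) :
    Con C {a : ι → K | ∃ c, cns c a ∈ S} := by
  obtain ⟨t, ht, ht'⟩ := cpt (S := S) {B | ∃ P Q, B = (fun x : Option ι → K => x ∘ some) ⁻¹' bas C P Q ∧
    ∀ a ∈ bas C P Q, ∃ c, cns c a ∈ S} (fun U hU => by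
      obtain ⟨P, Q, h, h'⟩ := loc hS U hU
      exact ⟨_, ⟨P, Q, rfl, fun a ha => (h' a ha 0).imp fun c h => h.1⟩, h⟩)
  have ht : ∀ B : Set (Option ι → K), ∃ P Q, B ∈ t → (B = (fun x : Option ι → K => x ∘ some) ⁻¹' bas C P Q ∧
    ∀ a ∈ bas C P Q, ∃ c, cns c a ∈ S) := fun B => by
      by_cases hB : B ∈ t
      · obtain ⟨P, Q, h⟩ := ht hB; exact ⟨P, Q, fun _ => h⟩
      · exact ⟨∅, 0, fun h => absurd h hB⟩
  choose P Q h using ht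
  convert Con.iUnion t (fun B => bas C (P B) (Q B)) (fun B _ => Con.bass _ _) using 1
  ext a
  simp only [Set.mem_setOf_eq, Set.mem_iUnion, exists_prop]
  constructor
  · rintro ⟨c, hc⟩
    obtain ⟨B, hB, hc⟩ := Set.mem_iUnion₂.mp (ht' hc)
    rw [(h B hB).1] at hc
    exact ⟨B, hB, hc⟩
  · rintro ⟨B, hB, ha⟩
    exact (h B hB).2 a ha

theorem Con.rat [Finite ι] {S : Set (Option ι → K)} (hS : Con C S)
    (hu : ∀ a c c', cns c a ∈ S → cns c' a ∈ S → c = c') :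
    ∃ t : Finset (MvPolynomial (ι × ℕ) C.k × MvPolynomial (ι × ℕ) C.k),
      ∀ a c, cns c a ∈ S → ∃ q ∈ t, C.e a q.2 ≠ 0 ∧ C.e a q.2 * c = C.e a q.1 := by
  classical
  obtain ⟨t, ht, ht'⟩ := cpt (S := S) {B | ∃ P Q, B = {x : Option ι → K | C.e (x ∘ some) Q ≠ 0 ∧ C.e (x ∘ some) Q * x none = C.e (x ∘ some) P}} (fun U hU => by
      obtain ⟨P, Q, h, h'⟩ := loc hS U hU
      by_contra hn
      have hr : ¬ ∃ P' Q', (∀ᶠ x : Option ι → K in U, C.e (x ∘ some) Q' ≠ 0) ∧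
        ∀ᶠ x : Option ι → K in U, C.e (x ∘ some) Q' * x none = C.e (x ∘ some) P' := fun ⟨P', Q', h1, h2⟩ =>
          hn ⟨_, ⟨P', Q', rfl⟩, inter_mem h1 h2⟩
      obtain ⟨x, hx, hx'⟩ := U.nonempty_of_mem (inter_mem h hU)
      obtain ⟨c, hc, hc'⟩ := h' _ hx (x none)
      refine hc' hr (hu _ _ _ hc ?_)
      convert (hx' : x ∈ S) using 1
      ext o; cases o <;> rfl)
  have ht : ∀ B : Set (Option ι → K), ∃ P Q, B ∈ t → B = {x : Option ι → K | C.e (x ∘ some) Q ≠ 0 ∧ C.e (x ∘ some) Q * x none = C.e (x ∘ some) P} := fun B => by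
      by_cases hB : B ∈ t
      · obtain ⟨P, Q, h⟩ := ht hB; exact ⟨P, Q, fun _ => h⟩
      · exact ⟨0, 0, fun h => absurd h hB⟩
  choose P Q h using ht
  refine ⟨t.image fun B => (P B, Q B), fun a c hc => ?_⟩
  obtain ⟨B, hB, hc⟩ := Set.mem_iUnion₂.mp (ht' hc)
  rw [h B hB] at hc
  exact ⟨_, Finset.mem_image_of_mem _ hB, hc⟩

end
end PG


namespace PG
open Set

structure DStr (K : Type) [Field K] where
  Df : ∀ {ι : Type}, Set (ι → K) → Prop
  univ : ∀ {ι : Type}, Df (univ : Set (ι → K))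
  inter : ∀ {ι : Type} {s t : Set (ι → K)}, Df s → Df t → Df (s ∩ t)
  compl : ∀ {ι : Type} {s : Set (ι → K)}, Df s → Df sᶜ
  pre : ∀ {ι κ : Type} (f : ι → κ) {s : Set (ι → K)}, Df s → Df {z : κ → K | z ∘ f ∈ s}
  img : ∀ {ι κ : Type} [Finite ι] [Finite κ] (f : ι → κ) {s : Set (κ → K)}, Df s →
    Df ((fun z : κ → K => z ∘ f) '' s)
  eq : Df {z : Bool → K | z true = z false}
  zero : Df {z : Unit → K | z () = 0}
  one : Df {z : Unit → K | z () = 1}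
  add : Df {z : Fin 3 → K | z 0 + z 1 = z 2}
  mul : Df {z : Fin 3 → K | z 0 * z 1 = z 2}

class Crd (K α : Type) where
  ι : Type
  fin : Finite ι
  c : α → ι → K
  inj : Function.Injective c

attribute [instance] Crd.fin

abbrev cc (K : Type) {α : Type} [h : Crd K α] (a : α) : h.ι → K := h.c a

variable {K : Type} [Field K] {α β γ J : Type} {𝒟 : DStr K}

theorem DStr.allf {ι : Type} [Finite J] {s : J → Set (ι → K)} (h : ∀ j, 𝒟.Df (s j)) :
    𝒟.Df (⋂ j, s j) := by
  classical
  haveI := Fintype.ofFinite J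
  have : ∀ t : Finset J, 𝒟.Df (⋂ j ∈ t, s j) := fun t => by
    induction t using Finset.induction_on with
    | empty => simpa using 𝒟.univ
    | insert a t _ ih => rw [Finset.set_biInter_insert]; exact 𝒟.inter (h a) ih
  simpa using this Finset.univ

theorem DStr.eqv {ι : Type} (i j : ι) : 𝒟.Df {z : ι → K | z i = z j} :=
  𝒟.pre (fun b : Bool => cond b i j) 𝒟.eq

/-- definable predicates -/
def DP (𝒟 : DStr K) [Crd K α] (P : α → Prop) : Prop := 𝒟.Df {z | ∃ a, P a ∧ cc K a = z}

theorem dpof [Crd K α] {P : α → Prop} {s : Set (Crd.ι K α → K)} (h : 𝒟.Df s)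
    (e : ∀ z, (∃ a, P a ∧ cc K a = z) ↔ z ∈ s) : DP 𝒟 P := by
  unfold DP; rwa [show {z | ∃ a, P a ∧ cc K a = z} = s from Set.ext e]

class IsS (𝒟 : DStr K) (α : Type) [Crd K α] : Prop where
  rng : DP 𝒟 (fun _ : α => True)

def Rx (K : Type) [Crd K α] [Crd K β] (f : α → β) : Prop :=
  ∃ r : Crd.ι K β → Crd.ι K α, ∀ a, cc K (f a) = cc K a ∘ r

instance : Crd K K := ⟨Unit, inferInstance, fun a _ => a, fun _ _ h => congrFun h ()⟩
instance [Crd K α] [Crd K β] : Crd K (α × β) :=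
  ⟨Crd.ι K α ⊕ Crd.ι K β, inferInstance, fun p => Sum.elim (cc K p.1) (cc K p.2), fun p q h =>
    Prod.ext (Crd.inj (funext fun i => congrFun h (Sum.inl i)))
      (Crd.inj (funext fun i => congrFun h (Sum.inr i)))⟩
instance [Finite J] [Crd K α] : Crd K (J → α) :=
  ⟨J × Crd.ι K α, inferInstance, fun f q => cc K (f q.1) q.2, fun f g h =>
    funext fun j => Crd.inj (funext fun i => congrFun h (j, i))⟩
open Classical in
noncomputable instance : Crd K Prop :=
  ⟨Unit, inferInstance, fun p _ => if p then 1 else 0, fun p q h => by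
    have := congrFun h ()
    by_cases hp : p <;> by_cases hq : q <;> simp_all⟩

section
variable [Crd K α] [Crd K β] [Crd K γ]

theorem cinj {a b : α} : cc K a = cc K b ↔ a = b := Crd.inj.eq_iff

theorem cprod (p : α × β) : cc K p = Sum.elim (cc K p.1) (cc K p.2) := rfl

theorem Rx.fst : Rx K (Prod.fst : α × β → α) := ⟨Sum.inl, fun _ => rfl⟩
theorem Rx.snd : Rx K (Prod.snd : α × β → β) := ⟨Sum.inr, fun _ => rfl⟩
theorem Rx.mk {f : α → β} {g : α → γ} : Rx K f → Rx K g → Rx K (fun a => (f a, g a)) :=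
  fun ⟨r, h⟩ ⟨s, h'⟩ => ⟨Sum.elim r s, fun a => by rw [cprod, h, h']; ext i; cases i <;> rfl⟩
theorem Rx.comp {f : β → γ} {g : α → β} : Rx K f → Rx K g → Rx K (fun a => f (g a)) :=
  fun ⟨r, h⟩ ⟨s, h'⟩ => ⟨s ∘ r, fun a => by rw [h, h']; rfl⟩
theorem Rx.app [Finite J] (j : J) : Rx K (fun f : J → α => f j) := ⟨fun i => (j, i), fun _ => rfl⟩

theorem DP.pull [IsS 𝒟 α] {P : β → Prop} (h : DP 𝒟 P) {f : α → β} (hf : Rx K f) :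
    DP 𝒟 (fun a => P (f a)) := by
  obtain ⟨r, hr⟩ := hf
  have := 𝒟.inter (IsS.rng (𝒟 := 𝒟) (α := α)) (𝒟.pre r h)
  refine dpof (this) fun z => ?_
  constructor
  · rintro ⟨a, ha, rfl⟩; exact ⟨⟨a, trivial, rfl⟩, f a, ha, hr a⟩
  · rintro ⟨⟨a, -, rfl⟩, b, hb, h⟩
    rw [← hr a, cinj] at h
    exact ⟨a, h ▸ hb, rfl⟩

theorem DP.and {P Q : α → Prop} (h : DP 𝒟 P) (h' : DP 𝒟 Q) : DP 𝒟 (fun a => P a ∧ Q a) := by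
  refine dpof (𝒟.inter h h') fun z => ?_
  constructor
  · rintro ⟨a, ha, rfl⟩; exact ⟨⟨a, ha.1, rfl⟩, a, ha.2, rfl⟩
  · rintro ⟨⟨a, ha, rfl⟩, b, hb, h⟩
    rw [cinj] at h
    exact ⟨a, ⟨ha, h ▸ hb⟩, rfl⟩

theorem DP.not [IsS 𝒟 α] {P : α → Prop} (h : DP 𝒟 P) : DP 𝒟 (fun a => ¬ P a) := by
  refine dpof (𝒟.inter (IsS.rng (𝒟 := 𝒟) (α := α)) (𝒟.compl h)) fun z => ?_
  constructor
  · rintro ⟨a, ha, rfl⟩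
    exact ⟨⟨a, trivial, rfl⟩, fun ⟨b, hb, h⟩ => ha (cinj.mp h ▸ hb)⟩
  · rintro ⟨⟨a, -, rfl⟩, h⟩
    exact ⟨a, fun ha => h ⟨a, ha, rfl⟩, rfl⟩

theorem DP.ex {P : α → β → Prop} (h : DP 𝒟 (fun p : α × β => P p.1 p.2)) :
    DP 𝒟 (fun a => ∃ b, P a b) := by
  refine dpof (𝒟.img (Sum.inl : _ → Crd.ι K α ⊕ Crd.ι K β) h) fun z => ?_
  constructor
  · rintro ⟨a, ⟨b, hb⟩, rfl⟩; exact ⟨_, ⟨(a, b), hb, rfl⟩, rfl⟩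
  · rintro ⟨_, ⟨p, hp, rfl⟩, rfl⟩; exact ⟨p.1, ⟨p.2, hp⟩, rfl⟩

theorem DP.alf [Finite J] [IsS 𝒟 α] {P : J → α → Prop} (h : ∀ j, DP 𝒟 (P j)) :
    DP 𝒟 (fun a => ∀ j, P j a) := by
  refine dpof (𝒟.inter (IsS.rng (𝒟 := 𝒟) (α := α)) (𝒟.allf h)) fun z => ?_
  constructor
  · rintro ⟨a, ha, rfl⟩; exact ⟨⟨a, trivial, rfl⟩, mem_iInter.mpr fun j => ⟨a, ha j, rfl⟩⟩
  · rintro ⟨⟨a, -, rfl⟩, h⟩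
    exact ⟨a, fun j => by obtain ⟨b, hb, h⟩ := mem_iInter.mp h j; exact cinj.mp h ▸ hb, rfl⟩

instance [IsS 𝒟 α] [IsS 𝒟 β] : IsS 𝒟 (α × β) where
  rng := by
    refine dpof (𝒟.inter (𝒟.pre (Sum.inl : _ → Crd.ι K α ⊕ Crd.ι K β) (IsS.rng (𝒟 := 𝒟) (α := α)))
      (𝒟.pre (Sum.inr : _ → Crd.ι K α ⊕ Crd.ι K β) (IsS.rng (𝒟 := 𝒟) (α := β)))) fun z => ?_
    constructor
    · rintro ⟨a, -, rfl⟩; exact ⟨⟨a.1, trivial, rfl⟩, a.2, trivial, rfl⟩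
    · rintro ⟨⟨a, -, h⟩, b, -, h'⟩
      exact ⟨(a, b), trivial, by rw [cprod, h, h']; ext i; cases i <;> rfl⟩

instance : IsS 𝒟 K where
  rng := by
    refine dpof (𝒟.univ) fun z => ?_
    simp only [mem_univ, iff_true]; exact ⟨z (), trivial, rfl⟩

instance [Finite J] [IsS 𝒟 α] : IsS 𝒟 (J → α) where
  rng := by
    refine dpof (𝒟.allf (fun j : J => 𝒟.pre (fun i => ((j, i) : J × Crd.ι K α)) (IsS.rng (𝒟 := 𝒟) (α := α)))) fun z => ?_
    constructor
    · rintro ⟨a, -, rfl⟩; exact mem_iInter.mpr fun j => ⟨a j, trivial, rfl⟩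
    · intro h
      choose f hf using fun j => mem_iInter.mp h j
      exact ⟨f, trivial, funext fun q => congrFun (hf q.1).2 q.2⟩

instance : IsS 𝒟 Prop where
  rng := by
    refine dpof (𝒟.compl (𝒟.inter (𝒟.compl 𝒟.zero) (𝒟.compl 𝒟.one))) fun z => ?_
    rw [compl_inter, compl_compl, compl_compl]; constructor
    · rintro ⟨a, -, rfl⟩
      by_cases ha : a
      · right; exact if_pos ha
      · left; exact if_neg ha
    · rintro (h | h)
      · exact ⟨False, trivial, funext fun i => (if_neg id).trans h.symm⟩
      · exact ⟨True, trivial, funext fun i => (if_pos trivial).trans h.symm⟩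

theorem DP.prop : DP 𝒟 (fun p : Prop => p) := by
  refine dpof (𝒟.one) fun z => ?_
  constructor
  · rintro ⟨a, ha, rfl⟩; exact if_pos ha
  · intro h; exact ⟨True, trivial, funext fun i => (if_pos trivial).trans h.symm⟩

theorem DP.eq [IsS 𝒟 α] : DP 𝒟 (fun p : α × α => p.1 = p.2) := by
  refine dpof (𝒟.inter (IsS.rng (𝒟 := 𝒟) (α := α × α))
    (𝒟.allf fun i : Crd.ι K α => 𝒟.eqv (Sum.inl i : Crd.ι K α ⊕ Crd.ι K α) (Sum.inr i))) fun z => ?_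
  constructor
  · rintro ⟨a, ha, rfl⟩
    exact ⟨⟨a, trivial, rfl⟩, mem_iInter.mpr fun i => congrFun (congrArg (cc K) ha) i⟩
  · rintro ⟨⟨a, -, rfl⟩, h⟩
    exact ⟨a, cinj.mp (funext fun i => mem_iInter.mp h i), rfl⟩

/-- definable functions -/
@[fun_prop] def DF (𝒟 : DStr K) (f : α → β) : Prop := DP 𝒟 (fun p : α × β => f p.1 = p.2)

class Cst (𝒟 : DStr K) (b : β) : Prop where
  h : DP 𝒟 (fun x => x = b)

variable [IsS 𝒟 α] [IsS 𝒟 β] [IsS 𝒟 γ]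

theorem DP.comp {P : β → Prop} (h : DP 𝒟 P) {f : α → β} (hf : DF 𝒟 f) : DP 𝒟 (fun a => P (f a)) := by
  have := DP.ex (P := fun a b => f a = b ∧ P b) (DP.and hf (h.pull Rx.snd))
  simpa using this

theorem Rx.df {f : α → β} (hf : Rx K f) : DF 𝒟 f :=
  DP.pull (DP.eq (α := β)) ((hf.comp Rx.fst).mk Rx.snd)

@[fun_prop] theorem DF.id : DF 𝒟 (fun a : α => a) := DP.eq
@[fun_prop] theorem DF.comp {f : β → γ} {g : α → β} (hf : DF 𝒟 f) (hg : DF 𝒟 g) :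
    DF 𝒟 (fun a => f (g a)) := by
  have h1 : DP 𝒟 (fun p : (α × γ) × β => g p.1.1 = p.2) := DP.pull (f := fun p : (α × γ) × β => (p.1.1, p.2)) hg
    ((Rx.fst.comp Rx.fst).mk Rx.snd)
  have h2 : DP 𝒟 (fun p : (α × γ) × β => f p.2 = p.1.2) := DP.pull (f := fun p : (α × γ) × β => (p.2, p.1.2)) hf
    (Rx.snd.mk (Rx.snd.comp Rx.fst))
  have := DP.ex (P := fun (q : α × γ) (b : β) => g q.1 = b ∧ f b = q.2) (h1.and h2)
  simpa [DF] using this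
@[fun_prop] theorem DF.fst : DF 𝒟 (fun p : α × β => p.1) := Rx.fst.df
@[fun_prop] theorem DF.snd : DF 𝒟 (fun p : α × β => p.2) := Rx.snd.df
@[fun_prop] theorem DF.app [Finite J] (j : J) : DF 𝒟 (fun f : J → α => f j) := (Rx.app j).df
@[fun_prop] theorem DF.mk {f : α → β} {g : α → γ} (hf : DF 𝒟 f) (hg : DF 𝒟 g) :
    DF 𝒟 (fun a => (f a, g a)) := by
  have h1 : DP 𝒟 (fun p : α × (β × γ) => f p.1 = p.2.1) := DP.pull (f := fun p : α × (β × γ) => (p.1, p.2.1)) hf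
    (Rx.fst.mk (Rx.fst.comp Rx.snd))
  have h2 : DP 𝒟 (fun p : α × (β × γ) => g p.1 = p.2.2) := DP.pull (f := fun p : α × (β × γ) => (p.1, p.2.2)) hg
    (Rx.fst.mk (Rx.snd.comp Rx.snd))
  simpa [DF, Prod.ext_iff] using h1.and h2
@[fun_prop] theorem DF.pi [Finite J] {f : α → J → β} (hf : ∀ j, DF 𝒟 (fun a => f a j)) : DF 𝒟 f := by
  have := DP.alf (α := α × (J → β)) (P := fun j p => f p.1 j = p.2 j) fun j =>
    DP.pull (f := fun p : α × (J → β) => (p.1, p.2 j)) (hf j) (Rx.fst.mk ((Rx.app j).comp Rx.snd))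
  simpa [DF, funext_iff] using this
@[fun_prop] theorem DF.const (b : β) [h : Cst 𝒟 b] : DF 𝒟 (fun _ : α => b) := by
  have := DP.pull (α := α × β) h.h Rx.snd
  simpa [DF, eq_comm] using this

theorem DF.iff_dp {P : α → Prop} : DF 𝒟 P ↔ DP 𝒟 P := by
  constructor
  · intro h; exact DP.prop.comp h
  · intro h
    have h1 : DP 𝒟 (fun p : α × Prop => P p.1) := h.pull Rx.fst
    have h2 : DP 𝒟 (fun p : α × Prop => p.2) := DP.prop.pull Rx.snd
    have := ((h1.and h2).not.and (h1.not.and h2.not).not).not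
    have e : (fun p : α × Prop => P p.1 = p.2) =
        fun a => ¬(¬(P a.1 ∧ a.2) ∧ ¬(¬P a.1 ∧ ¬a.2)) := funext fun p => ?_
    · unfold DF; rw [e]; exact this
    by_cases a : P p.1 <;> by_cases b : p.2 <;> simp [a, b]

@[fun_prop] theorem DF.and {P Q : α → Prop} (h : DF 𝒟 P) (h' : DF 𝒟 Q) : DF 𝒟 (fun a => P a ∧ Q a) :=
  DF.iff_dp.mpr ((DF.iff_dp.mp h).and (DF.iff_dp.mp h'))
@[fun_prop] theorem DF.not {P : α → Prop} (h : DF 𝒟 P) : DF 𝒟 (fun a => ¬ P a) :=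
  DF.iff_dp.mpr (DF.iff_dp.mp h).not
@[fun_prop] theorem DF.ne {f g : α → β} (h : DF 𝒟 f) (h' : DF 𝒟 g) : DF 𝒟 (fun a => f a ≠ g a) :=
  DF.iff_dp.mpr (DP.comp (DP.eq (α := β)) (h.mk h')).not
@[fun_prop] theorem DF.eq {f g : α → β} (h : DF 𝒟 f) (h' : DF 𝒟 g) : DF 𝒟 (fun a => f a = g a) :=
  DF.iff_dp.mpr (DP.comp (DP.eq (α := β)) (h.mk h'))
@[fun_prop] theorem DF.or {P Q : α → Prop} (h : DF 𝒟 P) (h' : DF 𝒟 Q) : DF 𝒟 (fun a => P a ∨ Q a) := by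
  have := (h.not.and h'.not).not
  simpa only [not_and_or, not_not] using this
@[fun_prop] theorem DF.imp {P Q : α → Prop} (h : DF 𝒟 P) (h' : DF 𝒟 Q) : DF 𝒟 (fun a => P a → Q a) := by
  have := (h.and h'.not).not
  simpa [not_and_or] using this
@[fun_prop] theorem DF.iff {P Q : α → Prop} (h : DF 𝒟 P) (h' : DF 𝒟 Q) : DF 𝒟 (fun a => (P a ↔ Q a)) := by
  simpa [iff_def] using (h.imp h').and (h'.imp h)
@[fun_prop] theorem DF.ex {P : α → β → Prop} (h : DF 𝒟 (fun p : α × β => P p.1 p.2)) :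
    DF 𝒟 (fun a => ∃ b, P a b) := DF.iff_dp.mpr (DF.iff_dp.mp h).ex
@[fun_prop] theorem DF.all {P : α → β → Prop} (h : DF 𝒟 (fun p : α × β => P p.1 p.2)) :
    DF 𝒟 (fun a => ∀ b, P a b) := by
  have := (DF.ex (P := fun a b => ¬ P a b) (DF.not h)).not
  simpa using this
@[fun_prop] theorem DF.alf [Finite J] {P : α → J → Prop} (h : ∀ j, DF 𝒟 (fun a => P a j)) :
    DF 𝒟 (fun a => ∀ j, P a j) :=
  DF.iff_dp.mpr (DP.alf fun j => DF.iff_dp.mp (h j))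
@[fun_prop] theorem DF.exf [Finite J] {P : α → J → Prop} (h : ∀ j, DF 𝒟 (fun a => P a j)) :
    DF 𝒟 (fun a => ∃ j, P a j) := by
  have := (DF.alf (P := fun a b => ¬ P a b) (fun j => (h j).not)).not
  simpa using this

theorem DF.uniq {f : α → β} {R : α → β → Prop} (h : ∀ a b, R a b ↔ f a = b)
    (hR : DF 𝒟 (fun p : α × β => R p.1 p.2)) : DF 𝒟 f := by
  have := DF.iff_dp.mp hR
  unfold DF
  simpa only [h] using this

open Classical in
@[fun_prop] theorem DF.ite {P : α → Prop} {f g : α → β} (h : DF 𝒟 P) (hf : DF 𝒟 f) (hg : DF 𝒟 g) :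
    DF 𝒟 (fun a => if P a then f a else g a) := by
  refine DF.uniq (R := fun a b => (P a → f a = b) ∧ (¬ P a → g a = b)) (fun a b => ?_) (by fun_prop)
  by_cases h : P a <;> simp [h]

instance (P : Prop) : Cst 𝒟 P where
  h := by
    by_cases h : P
    · have := DP.prop (𝒟 := 𝒟)
      simpa [h] using this
    · have := (DP.prop (𝒟 := 𝒟)).not
      simpa [h] using this

theorem DP.zero : DP 𝒟 (fun x : K => x = 0) := by
  refine dpof (𝒟.zero) fun z => ?_
  constructor
  · rintro ⟨a, rfl, rfl⟩; rfl
  · intro h; exact ⟨z (), h, rfl⟩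

theorem DP.one : DP 𝒟 (fun x : K => x = 1) := by
  refine dpof (𝒟.one) fun z => ?_
  constructor
  · rintro ⟨a, rfl, rfl⟩; rfl
  · intro h; exact ⟨z (), h, rfl⟩

end

instance : Cst 𝒟 (0 : K) := ⟨DP.zero⟩
instance : Cst 𝒟 (1 : K) := ⟨DP.one⟩

theorem DP.of {ι : Type} [Finite ι] {s : Set (ι → K)} : DP 𝒟 (fun x : ι → K => x ∈ s) ↔ 𝒟.Df s := by
  constructor
  · intro h
    have := 𝒟.pre (fun q : ι × Unit => q.1) h
    convert this using 1
    ext z; constructor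
    · intro hz; exact ⟨z, hz, rfl⟩
    · rintro ⟨a, ha, h⟩
      have : a = z := funext fun i => congrFun h (i, ())
      exact this ▸ ha
  · intro h
    refine dpof (𝒟.pre (fun i : ι => (i, ())) h) fun z => ?_
    constructor
    · rintro ⟨a, ha, rfl⟩; exact ha
    · intro hz; exact ⟨_, hz, rfl⟩

section
variable [Crd K α] [IsS 𝒟 α]

theorem DF.op3 {op : K → K → K} (h : 𝒟.Df {z : Fin 3 → K | op (z 0) (z 1) = z 2}) {f g : α → K}
    (hf : DF 𝒟 f) (hg : DF 𝒟 g) : DF 𝒟 (fun a => op (f a) (g a)) := by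
  have h1 : DP 𝒟 (fun x : Fin 3 → K => op (x 0) (x 1) = x 2) := DP.of.mpr h
  have h2 : DF 𝒟 (fun p : (K × K) × K => ![p.1.1, p.1.2, p.2]) :=
    DF.pi fun j => by fin_cases j <;> simp <;> fun_prop
  have h3 : DF 𝒟 (fun p : K × K => op p.1 p.2) := DP.comp h1 h2
  exact h3.comp (hf.mk hg)

@[fun_prop] theorem DF.add {f g : α → K} (hf : DF 𝒟 f) (hg : DF 𝒟 g) : DF 𝒟 (fun a => f a + g a) :=
  DF.op3 𝒟.add hf hg
@[fun_prop] theorem DF.mul {f g : α → K} (hf : DF 𝒟 f) (hg : DF 𝒟 g) : DF 𝒟 (fun a => f a * g a) :=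
  DF.op3 𝒟.mul hf hg
@[fun_prop] theorem DF.sub {f g : α → K} (hf : DF 𝒟 f) (hg : DF 𝒟 g) : DF 𝒟 (fun a => f a - g a) :=
  DF.uniq (R := fun a b => f a = b + g a) (fun a b => by rw [sub_eq_iff_eq_add]) (by fun_prop)
@[fun_prop] theorem DF.pow (n : ℕ) {f : α → K} (hf : DF 𝒟 f) : DF 𝒟 (fun a => f a ^ n) := by
  induction n with
  | zero => simp only [pow_zero]; fun_prop
  | succ n ih => simp only [pow_succ]; fun_prop
@[fun_prop] theorem DF.sumf (t : Finset J) {f : α → J → K} (hf : ∀ j, DF 𝒟 (fun a => f a j)) :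
    DF 𝒟 (fun a => ∑ j ∈ t, f a j) := by
  classical
  induction t using Finset.induction_on with
  | empty => simp only [Finset.sum_empty]; fun_prop
  | insert a t h ih => simp only [Finset.sum_insert h]; have := hf a; fun_prop
@[fun_prop] theorem DF.prodf (t : Finset J) {f : α → J → K} (hf : ∀ j, DF 𝒟 (fun a => f a j)) :
    DF 𝒟 (fun a => ∏ j ∈ t, f a j) := by
  classical
  induction t using Finset.induction_on with
  | empty => simp only [Finset.prod_empty]; fun_prop
  | insert a t h ih => simp only [Finset.prod_insert h]; have := hf a; fun_prop

end

/-- intersection of two structures -/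
def DStr.inf (𝒟 𝒟' : DStr K) : DStr K where
  Df s := 𝒟.Df s ∧ 𝒟'.Df s
  univ := ⟨𝒟.univ, 𝒟'.univ⟩
  inter h h' := ⟨𝒟.inter h.1 h'.1, 𝒟'.inter h.2 h'.2⟩
  compl h := ⟨𝒟.compl h.1, 𝒟'.compl h.2⟩
  pre f _ h := ⟨𝒟.pre f h.1, 𝒟'.pre f h.2⟩
  img f _ h := ⟨𝒟.img f h.1, 𝒟'.img f h.2⟩
  eq := ⟨𝒟.eq, 𝒟'.eq⟩
  zero := ⟨𝒟.zero, 𝒟'.zero⟩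
  one := ⟨𝒟.one, 𝒟'.one⟩
  add := ⟨𝒟.add, 𝒟'.add⟩
  mul := ⟨𝒟.mul, 𝒟'.mul⟩

theorem DF.inf {𝒟' : DStr K} [Crd K α] [Crd K β] {f : α → β} :
    DF (𝒟.inf 𝒟') f ↔ DF 𝒟 f ∧ DF 𝒟' f := Iff.rfl

theorem DF.mono {𝒟' : DStr K} (h : ∀ {ι : Type} (s : Set (ι → K)), 𝒟.Df s → 𝒟'.Df s)
    [Crd K α] [Crd K β] {f : α → β} (hf : DF 𝒟 f) : DF 𝒟' f := h _ hf

end PG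


namespace PG
open PaperGroups MvPolynomial Filter

section
variable {K : Type} [Field K] [CharZero K] {C : Cx K} {ι κ : Type}

theorem ev_ren {S : Type} [CommRing S] {k : Type} [Field k] (φ : k →+* S) (D : S → S) (f : ι → κ) (x : κ → S) (p) :
    ev φ D x (rename (fun q : ι × ℕ => (f q.1, q.2)) p) = ev φ D (x ∘ f) p := by
  simp only [ev, coe_eval₂Hom, eval₂_rename]; rfl

theorem Con.pre (f : ι → κ) {s : Set (ι → K)} (h : Con C s) : Con C {z : κ → K | z ∘ f ∈ s} := by
  induction h with
  | z p =>
    have := Con.z (C := C) (rename (fun q : ι × ℕ => (f q.1, q.2)) p)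
    simpa only [Cx.e, ev_ren, Set.mem_setOf_eq] using this
  | inter _ _ h1 h2 => exact h1.inter h2
  | compl _ h1 => exact h1.compl

theorem Con.projf {J : Type} [Finite J] : ∀ {ι : Type} [Finite ι] {S : Set (ι ⊕ J → K)}, Con C S →
    Con C {a : ι → K | ∃ b, Sum.elim a b ∈ S} := by
  induction J using Finite.induction_empty_option with
  | of_equiv e ih =>
    intro ι _ S h
    convert ih (h.pre (Sum.map id e.symm)) using 1
    ext a; constructor
    · rintro ⟨b, hb⟩
      refine ⟨b ∘ e, ?_⟩
      show _ ∈ S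
      convert hb using 1; ext (i | i) <;> simp
    · rintro ⟨b, hb⟩
      refine ⟨b ∘ e.symm, ?_⟩
      change _ ∈ S at hb
      convert hb using 1; ext (i | i) <;> simp
  | h_empty =>
    intro ι _ S h
    convert h.pre (Sum.elim id PEmpty.elim) using 1
    ext a; constructor
    · rintro ⟨b, hb⟩
      show _ ∈ S
      convert hb using 1; ext (i | i) <;> [rfl; exact i.elim]
    · intro hb
      change _ ∈ S at hb
      refine ⟨PEmpty.elim, ?_⟩
      convert hb using 1; ext (i | i) <;> [rfl; exact i.elim]
  | @h_option J _ ih =>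
    intro ι _ S h
    have h1 := ih (h.pre (fun q : ι ⊕ Option J => (match q with
      | .inl i => some (.inl i) | .inr none => none | .inr (some j) => some (.inr j) : Option (ι ⊕ J)))).proj
    convert h1 using 1
    ext a; constructor
    · rintro ⟨b, hb⟩
      refine ⟨b ∘ some, b none, ?_⟩
      show _ ∈ S
      convert hb using 1; ext (i | i | i) <;> rfl
    · rintro ⟨b, c, hb⟩
      change _ ∈ S at hb
      refine ⟨cns c b, ?_⟩
      convert hb using 1; ext (i | i | i) <;> rfl

theorem Con.ofp (p q) : Con C {z : ι → K | C.e z p = C.e z q} := by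
  have := Con.z (C := C) (p - q)
  simpa only [map_sub, sub_eq_zero] using this

theorem ev_X {S : Type} [CommRing S] {k : Type} [Field k] (φ : k →+* S) (D : S → S) (x : κ → S) (i : κ) :
    ev φ D x (X (i, 0)) = x i := by simp [ev, nab]

/-- the structure of constructible sets -/
def Cx.str (C : Cx K) : DStr K where
  Df s := Con C s
  univ := Con.univ
  inter := Con.inter
  compl := Con.compl
  pre f _ h := h.pre f
  img {ι κ} _ _ f s h := by
    have h2 : Con C {z : ι ⊕ κ → K | ∀ i, z (.inl i) = z (.inr (f i))} := by
      haveI := Fintype.ofFinite ι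
      have := Con.iInter (C := C) Finset.univ (fun i : ι => {z : ι ⊕ κ → K | z (.inl i) = z (.inr (f i))})
        fun i _ => by
          have := Con.ofp (C := C) (X (.inl i, 0) : MvPolynomial ((ι ⊕ κ) × ℕ) C.k) (X (.inr (f i), 0))
          simpa only [Cx.e, ev_X] using this
      convert this using 1
      ext z; simp
    convert ((h.pre Sum.inr).inter h2).projf using 1
    ext a; constructor
    · rintro ⟨b, hb, rfl⟩
      exact ⟨b, hb, fun i => rfl⟩
    · rintro ⟨b, hb, h⟩
      exact ⟨b, hb, funext fun i => (h i).symm⟩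
  eq := by simpa only [Cx.e, ev_X] using Con.ofp (C := C) (X (true, 0)) (X (false, 0))
  zero := by simpa only [Cx.e, ev_X, map_zero] using Con.ofp (C := C) (X ((), 0)) 0
  one := by simpa only [Cx.e, ev_X, map_one] using Con.ofp (C := C) (X ((), 0)) 1
  add := by
    have := Con.ofp (C := C) (X (0, 0) + X (1, 0) : MvPolynomial (Fin 3 × ℕ) C.k) (X (2, 0))
    have e : ∀ z, C.e z (X (0, 0) + X (1, 0) : MvPolynomial (Fin 3 × ℕ) C.k) = z 0 + z 1 := fun z => by
      rw [(C.e z).map_add, ev_X, ev_X]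
    simpa only [e, ev_X] using this
  mul := by
    have := Con.ofp (C := C) (X (0, 0) * X (1, 0) : MvPolynomial (Fin 3 × ℕ) C.k) (X (2, 0))
    have e : ∀ z, C.e z (X (0, 0) * X (1, 0) : MvPolynomial (Fin 3 × ℕ) C.k) = z 0 * z 1 := fun z => by
      rw [(C.e z).map_mul, ev_X, ev_X]
    simpa only [e, ev_X] using this

instance cstφ (c : C.k) : Cst C.str (C.φ c) where
  h := by
    have : Con C {z : Unit → K | z () = C.φ c} := by
      simpa [ev, nab] using Con.ofp (C := C) (X ((), 0)) (MvPolynomial.C c)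
    refine dpof (𝒟 := C.str) this fun z => ⟨?_, fun h => ⟨z (), ?_, rfl⟩⟩
    · rintro ⟨a, rfl, rfl⟩; rfl
    · exact h

theorem Cx.der (C : Cx K) : DF C.str C.D := by
  have : Con C {z : Unit ⊕ Unit → K | C.D (z (.inl ())) = z (.inr ())} := by
    simpa [ev, nab] using Con.ofp (C := C) (X (.inl (), 1)) (X ((.inr () : Unit ⊕ Unit), 0))
  refine dpof (𝒟 := C.str) this fun z => ⟨?_, fun h => ⟨(z (.inl ()), z (.inr ())), ?_, ?_⟩⟩
  · rintro ⟨⟨a, b⟩, h, rfl⟩; exact h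
  · exact h
  · ext (i | i) <;> rfl

variable {𝒟 : DStr K}

/-- evaluation of polynomials is definable -/
theorem DF.ev {α : Type} [Crd K α] [IsS 𝒟 α] (hc : ∀ c, Cst 𝒟 (C.φ c)) (hd : DF 𝒟 C.D) (p : MvPolynomial (ι × ℕ) C.k)
    {f : α → ι → K} (hf : ∀ i, DF 𝒟 (fun a => f a i)) : DF 𝒟 (fun a => C.e (f a) p) := by
  have hn : ∀ n : ℕ, DF 𝒟 (C.D^[n]) := fun n => by
    induction n with
    | zero => exact DF.id
    | succ n ih => rw [Function.iterate_succ']; exact hd.comp ih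
  induction p using MvPolynomial.induction_on with
  | C c =>
    have := hc c
    simp only [Cx.e, PG.ev, coe_eval₂Hom, eval₂_C]
    fun_prop
  | add p q h1 h2 => simp only [map_add]; fun_prop
  | mul_X p q h1 =>
    have := (hn q.2).comp (hf q.1)
    simp only [map_mul]
    refine DF.mul h1 ?_
    simpa [Cx.e, PG.ev, nab] using this

theorem Con.df [Finite ι] (hc : ∀ c, Cst 𝒟 (C.φ c)) (hd : DF 𝒟 C.D) {s : Set (ι → K)} (h : Con C s) : 𝒟.Df s := by
  induction h with
  | z p =>
    refine DP.of.mp (DF.iff_dp.mp ?_)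
    have := DF.ev (C := C) (α := ι → K) hc hd p (f := fun x => x) (fun i => by fun_prop)
    show DF 𝒟 (fun x => C.e x p = 0)
    fun_prop
  | inter _ _ h1 h2 => exact 𝒟.inter h1 h2
  | compl _ h1 => exact 𝒟.compl h1

theorem DF.mono' {𝒟' : DStr K} (h : ∀ {ι : Type} [Finite ι] (s : Set (ι → K)), 𝒟.Df s → 𝒟'.Df s)
    {α β : Type} [Crd K α] [Crd K β] {f : α → β} (hf : DF 𝒟 f) : DF 𝒟' f := h _ hf
end
end PG


namespace PG
open PaperGroups MvPolynomial Filter FirstOrder FirstOrder.Language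

section
variable {K : Type} [Field K] [DiffFieldStruct K] {𝒟 : DStr K} {A : Set K} {ι : Type}

theorem term_df [Finite ι] (hc : ∀ a ∈ A, Cst 𝒟 a) (hd : DF 𝒟 (DiffFieldStruct.der : K → K)) {n : ℕ}
    (t : LDrg.Term ((A ⊕ ι) ⊕ Fin n)) :
    DF 𝒟 (fun p : (ι → K) × (Fin n → K) => t.realize (Sum.elim (Sum.elim (fun a : A => (a : K)) p.1) p.2)) := by
  induction t with
  | var v =>
    rcases v with (a | i) | i
    · have := hc a a.2
      exact DF.const (a : K)
    · show DF 𝒟 (fun p : (ι → K) × (Fin n → K) => p.1 i)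
      fun_prop
    · show DF 𝒟 (fun p : (ι → K) × (Fin n → K) => p.2 i)
      fun_prop
  | func f ts ih =>
    rcases f with f | f
    · cases f with
      | add => exact DF.add (ih 0) (ih 1)
      | mul => exact DF.mul (ih 0) (ih 1)
      | neg =>
        have := DF.sub (DF.const (𝒟 := 𝒟) (0 : K)) (ih 0)
        simp only [zero_sub] at this
        exact this
      | zero => exact DF.const (0 : K)
      | one => exact DF.const (1 : K)
    · cases f with
      | D => exact hd.comp (ih 0)

theorem form_df [Finite ι] (hc : ∀ a ∈ A, Cst 𝒟 a) (hd : DF 𝒟 (DiffFieldStruct.der : K → K)) {n : ℕ}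
    (f : LDrg.BoundedFormula (A ⊕ ι) n) :
    DF 𝒟 (fun p : (ι → K) × (Fin n → K) => f.Realize (Sum.elim (fun a : A => (a : K)) p.1) p.2) := by
  induction f with
  | falsum => exact DF.const False
  | equal t1 t2 => exact DF.eq (term_df hc hd t1) (term_df hc hd t2)
  | rel R ts => rcases R with R | R <;> exact R.elim
  | imp f1 f2 h1 h2 => exact DF.imp h1 h2
  | @all n f h =>
    refine DF.all (P := fun (p : (ι → K) × (Fin n → K)) (x : K) =>
      f.Realize (Sum.elim (fun a : A => (a : K)) p.1) (Fin.snoc p.2 x)) ?_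
    have : DF 𝒟 (fun q : ((ι → K) × (Fin n → K)) × K => (q.1.1, (Fin.snoc q.1.2 q.2 : Fin (n + 1) → K))) := by
      refine DF.mk (by fun_prop) (DF.pi fun j => ?_)
      induction j using Fin.lastCases with
      | last => simp only [Fin.snoc_last]; fun_prop
      | cast i => simp only [Fin.snoc_castSucc]; fun_prop
    exact h.comp this

theorem def_df [Finite ι] (hc : ∀ a ∈ A, Cst 𝒟 a) (hd : DF 𝒟 (DiffFieldStruct.der : K → K)) {s : Set (ι → K)}
    (h : A.Definable LDrg s) : 𝒟.Df s := by
  obtain ⟨f, rfl⟩ := Set.definable_iff_exists_formula_sum.mp h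
  have h1 := form_df hc hd f
  have h2 : DF 𝒟 (fun x : ι → K => (x, (default : Fin 0 → K))) := DF.mk DF.id (DF.pi fun j => j.elim0)
  exact DP.of.mp (DF.iff_dp.mp (h1.comp h2))

/-- definable sets of a language expanding rings -/
def lstr (L : FirstOrder.Language.{0,0}) [L.Structure K] (A : Set K)
    (h : ∀ {ι : Type} {s : Set (ι → K)}, (∅ : Set K).Definable Language.ring s → A.Definable L s) : DStr K where
  Df s := A.Definable L s
  univ := Set.definable_univ
  inter h h' := h.inter h'
  compl h := h.compl
  pre f _ h := h.preimage_comp f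
  img f _ h := h.image_comp f
  eq := h (Set.empty_definable_iff.mpr ⟨Term.equal (Term.var true) (Term.var false), by ext z; simp⟩)
  zero := h (Set.empty_definable_iff.mpr ⟨Term.equal (Term.var ()) (0 : Language.ring.Term Unit), by ext z; simp⟩)
  one := h (Set.empty_definable_iff.mpr ⟨Term.equal (Term.var ()) (1 : Language.ring.Term Unit), by ext z; simp⟩)
  add := h (Set.empty_definable_iff.mpr ⟨Term.equal
    ((Term.var 0 : Language.ring.Term (Fin 3)) + Term.var 1) (Term.var 2), by ext z; simp⟩)
  mul := h (Set.empty_definable_iff.mpr ⟨Term.equal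
    ((Term.var 0 : Language.ring.Term (Fin 3)) * Term.var 1) (Term.var 2), by ext z; simp⟩)

def rD : Language.ring →ᴸ LDrg := LHom.sumInl

instance : LHom.IsExpansionOn rD K := ⟨fun _ _ => rfl, fun _ _ => rfl⟩

theorem ring_LDrg {A : Set K} {ι : Type} {s : Set (ι → K)} (h : A.Definable Language.ring s) : A.Definable LDrg s :=
  Set.Definable.map_expansion h rD

noncomputable def rstr (A : Set K) : DStr K := lstr Language.ring A fun h => h.mono (Set.empty_subset _)
noncomputable def dstr (A : Set K) : DStr K := lstr LDrg A fun h => ring_LDrg (h.mono (Set.empty_subset _))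

theorem cst_r {a : K} (h : a ∈ A) : Cst (rstr A) a where
  h := by
    have : A.Definable Language.ring {z : Unit → K | z () = a} := by
      refine Set.definable_iff_exists_formula_sum.mpr ⟨Term.equal (Term.var (.inr ())) (Term.var (.inl ⟨a, h⟩)), ?_⟩
      ext z; simp
    refine dpof (𝒟 := rstr A) this fun z => ⟨?_, fun h => ⟨z (), h, rfl⟩⟩
    rintro ⟨a, rfl, rfl⟩; rfl

theorem cst_d {a : K} (h : a ∈ A) : Cst (dstr A) a := ⟨ring_LDrg (cst_r h).h⟩

theorem der_d : DF (dstr A) (DiffFieldStruct.der : K → K) := by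
  have : A.Definable LDrg {z : Unit ⊕ Unit → K | DiffFieldStruct.der (z (.inl ())) = z (.inr ())} := by
    refine (Set.empty_definable_iff.mpr ⟨Term.equal (Term.func (L := LDrg) (Sum.inr DerFunc.D : LDrg.Functions 1)
      ![Term.var (.inl ())]) (Term.var (.inr ())), ?_⟩ : (∅ : Set K).Definable LDrg _).mono (Set.empty_subset _)
    ext z
    simp only [Set.mem_setOf_eq, Formula.realize_equal, Term.realize_var]
    rfl
  refine dpof (𝒟 := dstr A) this fun z => ⟨?_, fun h => ⟨(z (.inl ()), z (.inr ())), h, ?_⟩⟩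
  · rintro ⟨⟨a, b⟩, h, rfl⟩; exact h
  · ext (i | i) <;> rfl

end
end PG


namespace PG
open MvPolynomial Filter

/-- ambient data -/
structure Stg (K : Type) [Field K] where
  D : K → K
  hD : IsDer D
  bl : Blum D
  k : Subfield K
  hk : ∀ x ∈ k, D x ∈ k

section
variable {K : Type} [Field K] [CharZero K] (S : Stg K)

noncomputable def Stg.dk : Cx K := ⟨S.k, inferInstance, S.k.subtype, S.D, fun x => ⟨S.D x, S.hk x x.2⟩, S.hD, fun _ => rfl, .inl S.bl⟩
noncomputable def Stg.dK : Cx K := ⟨K, inferInstance, RingHom.id K, S.D, S.D, S.hD, fun _ => rfl, .inl S.bl⟩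
theorem der0 : IsDer (fun _ : K => (0 : K)) := ⟨by simp, by simp⟩
noncomputable def Stg.rk : Cx K :=
  ⟨S.k, inferInstance, S.k.subtype, fun _ => 0, fun _ => 0, der0, fun _ => rfl, .inr ⟨fun _ => rfl, S.bl.algClosed⟩⟩
noncomputable def Stg.rK : Cx K :=
  ⟨K, inferInstance, RingHom.id K, fun _ => 0, fun _ => 0, der0, fun _ => rfl, .inr ⟨fun _ => rfl, S.bl.algClosed⟩⟩

noncomputable abbrev Stg.st : DStr K := S.rK.str.inf S.dk.str

variable {S}
instance cdK (c : K) : Cst S.dK.str c := cstφ (C := S.dK) c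
instance crK (c : K) : Cst S.rK.str c := cstφ (C := S.rK) c

theorem dk_dK {ι : Type} [Finite ι] (s : Set (ι → K)) (h : S.dk.str.Df s) : S.dK.str.Df s :=
  Con.df (C := S.dk) (fun c => cdK (S.dk.φ c)) (Cx.der S.dK) h
theorem rK_dK {ι : Type} [Finite ι] (s : Set (ι → K)) (h : S.rK.str.Df s) : S.dK.str.Df s :=
  Con.df (C := S.rK) (fun c => cdK (S.rK.φ c)) (DF.const (0 : K)) h
theorem rk_st {ι : Type} [Finite ι] (s : Set (ι → K)) (h : S.rk.str.Df s) : S.st.Df s :=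
  ⟨Con.df (C := S.rk) (fun c => crK (S.rk.φ c)) (DF.const (0 : K)) h,
   Con.df (C := S.rk) (fun c => cstφ (C := S.dk) c) (DF.const (0 : K)) h⟩

variable {α β γ : Type} [Crd K α] [Crd K β] [Crd K γ] {𝒟 : DStr K} {C : Cx K}

instance upS [h : IsS S.dk.str α] : IsS S.dK.str α := ⟨dk_dK _ h.rng⟩
theorem DF.up {f : α → β} (h : DF S.dk.str f) : DF S.dK.str f := DF.mono' dk_dK h

/-- definable functions are piecewise rational -/
theorem DF.rat {f : α → K} (h : DF C.str f) :
    ∃ t : Finset (MvPolynomial (Crd.ι K α × ℕ) C.k × MvPolynomial (Crd.ι K α × ℕ) C.k),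
      ∀ a, ∃ q ∈ t, C.e (cc K a) q.2 ≠ 0 ∧ C.e (cc K a) q.2 * f a = C.e (cc K a) q.1 := by
  have h1 : Con C _ := Con.pre (Sum.elim some (fun _ => none) : Crd.ι K α ⊕ Unit → Option (Crd.ι K α)) h
  have h2 : ∀ (a : α) (c), cns c (cc K a) ∈ {z : Option (Crd.ι K α) → K | z ∘ (Sum.elim some (fun _ => none)) ∈
      {z : Crd.ι K α ⊕ Unit → K | ∃ p : α × K, f p.1 = p.2 ∧ cc K p = z}} ↔ f a = c := fun a c => by
    constructor
    · rintro ⟨⟨b, c'⟩, hb, he⟩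
      have : b = a := cinj.mp (funext fun i => congrFun he (.inl i))
      rw [← this]; exact hb.trans (congrFun he (.inr ()))
    · intro h; exact ⟨(a, c), h, by ext (i | i) <;> rfl⟩
  obtain ⟨t, ht⟩ := Con.rat h1 (fun z c c' hc hc' => by
    have hc0 := hc
    obtain ⟨⟨b, d⟩, hb, he⟩ := hc0
    have : cc K b = z := funext fun i => congrFun he (.inl i)
    rw [← this] at hc hc'
    exact ((h2 b c).mp hc).symm.trans ((h2 b c').mp hc'))
  exact ⟨t, fun a => ht _ _ ((h2 a _).mpr rfl)⟩

/-- definable description -/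
noncomputable def dd [Zero β] (R : β → Prop) : β := open Classical in if h : ∃! b, R b then h.choose else 0

theorem dd_eq [Zero β] {R : β → Prop} {b : β} (h : R b) (hu : ∀ b', R b' → b' = b) : dd R = b := by
  have h' : ∃! b, R b := ⟨b, h, hu⟩
  rw [dd, dif_pos h']; exact hu _ h'.choose_spec.1

theorem dd_spec [Zero β] {R : β → Prop} (h : ∃ b, R b) (hu : ∀ b b', R b → R b' → b = b') : R (dd R) := by
  obtain ⟨b, hb⟩ := h
  rwa [dd_eq hb fun b' hb' => hu _ _ hb' hb]

@[fun_prop] theorem DF.dd [Zero β] [Cst 𝒟 (0 : β)] [IsS 𝒟 α] [IsS 𝒟 β] {R : α → β → Prop}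
    (h : DF 𝒟 (fun p : α × β => R p.1 p.2)) : DF 𝒟 (fun a => PG.dd (R a)) := by
  refine DF.uniq (R := fun a b => (R a b ∧ ∀ b', R a b' → b' = b) ∨
    ((¬ ∃ b, R a b ∧ ∀ b', R a b' → b' = b) ∧ b = 0)) (fun a b => ?_) ?_
  · by_cases hu : ∃! b, R a b
    · obtain ⟨c, hc, hc'⟩ := hu
      have hc' : ∀ b', R a b' → b' = c := hc'
      rw [dd_eq hc hc']
      constructor
      · rintro (⟨h, -⟩ | ⟨h, -⟩)
        · exact (hc' _ h).symm
        · exact absurd ⟨c, hc, hc'⟩ h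
      · rintro rfl; exact .inl ⟨hc, hc'⟩
    · rw [PG.dd, dif_neg hu]
      constructor
      · rintro (h | ⟨-, h⟩)
        · exact absurd ⟨b, h⟩ hu
        · exact h.symm
      · rintro rfl; exact .inr ⟨hu, rfl⟩
  · have h3 : DF 𝒟 (fun p : (α × β) × β => R p.1.1 p.2) := DF.comp (f := fun p : α × β => R p.1 p.2) h
      (g := fun p : (α × β) × β => (p.1.1, p.2)) (by fun_prop)
    have h4 : DF 𝒟 (fun p : ((α × β) × β) × β => R p.1.1.1 p.2) := DF.comp (f := fun p : α × β => R p.1 p.2) h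
      (g := fun p : ((α × β) × β) × β => (p.1.1.1, p.2)) (by fun_prop)
    fun_prop

instance {J : Type} [Finite J] [IsS 𝒟 α] (f : J → α) [h : ∀ j, Cst 𝒟 (f j)] : Cst 𝒟 f where
  h := by
    have : DF 𝒟 (fun x : J → α => ∀ j, x j = f j) := by fun_prop
    simpa [funext_iff] using DF.iff_dp.mp this
instance {J : Type} [Finite J] : Cst 𝒟 (0 : J → K) := inferInstanceAs (Cst 𝒟 (fun _ : J => (0 : K)))
instance {J : Type} [Finite J] (x : J → K) : Cst S.dK.str x := inferInstanceAs (Cst S.dK.str (fun j => x j))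

section code
variable {J : Type} [Finite J]

noncomputable def rnk (J : Type) [Finite J] : J → ℕ := fun j => Finite.equivFin J j

theorem rnk_inj {i j : J} (h : rnk J i = rnk J j) : i = j :=
  (Finite.equivFin J).injective (Fin.ext h)

def Piv (W : (J → K) → Prop) (j : J) : Prop := ∃ w, W w ∧ w j = 1 ∧ ∀ i, rnk J j < rnk J i → w i = 0

open Classical in
/-- canonical code of a subspace -/
noncomputable def code (W : (J → K) → Prop) (j : J) : J → K :=
  dd fun u => W (fun i => (if i = j then 1 else 0) - u i) ∧ ∀ i, Piv W i → u i = 0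

@[fun_prop] theorem DF.code [IsS 𝒟 α] {W : α → (J → K) → Prop} (h : DF 𝒟 (fun p : α × (J → K) => W p.1 p.2)) :
    DF 𝒟 (fun a => code (W a)) := by
  classical
  refine DF.pi fun j => ?_
  unfold PG.code Piv
  have h3 : DF 𝒟 (fun p : (α × (J → K)) × (J → K) => W p.1.1 p.2) :=
    DF.comp (f := fun p : α × (J → K) => W p.1 p.2) h (g := fun p : (α × (J → K)) × (J → K) => (p.1.1, p.2)) (by fun_prop)
  have h4 : DF 𝒟 (fun p : (α × (J → K)) => W p.1 (fun i => (if i = j then 1 else 0) - p.2 i)) := by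
    refine DF.comp (f := fun p : α × (J → K) => W p.1 p.2) h
      (g := fun p : α × (J → K) => (p.1, (fun i => (if i = j then 1 else 0) - p.2 i))) ?_
    refine DF.mk (by fun_prop) (DF.pi fun i => DF.sub ?_ (by fun_prop))
    split_ifs <;> fun_prop
  fun_prop

theorem piv_zero (W : Submodule K (J → K)) (n : ℕ) : ∀ w ∈ W, (∀ i, Piv (· ∈ W) i → w i = 0) →
    (∀ i, n ≤ rnk J i → w i = 0) → w = 0 := by
  induction n with
  | zero => intro w _ _ h; ext i; exact h i (Nat.zero_le _)
  | succ n ih =>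
    intro w hw hp h
    refine ih w hw hp fun i hi => ?_
    by_contra h0
    have hr : rnk J i = n := by
      by_contra h2
      exact h0 (h i (by omega))
    refine h0 (hp i ⟨(w i)⁻¹ • w, W.smul_mem _ hw, by simp [h0], fun j hj => by simp [h j (by omega)]⟩)

theorem piv_red (W : Submodule K (J → K)) (n : ℕ) : ∀ v : J → K, (∀ i, n ≤ rnk J i → v i = 0) →
    ∃ u, v - u ∈ W ∧ ∀ i, Piv (· ∈ W) i → u i = 0 := by
  classical
  induction n with
  | zero => intro v h; exact ⟨0, by rw [show v = 0 from funext fun i => h i (Nat.zero_le _)]; simp, by simp⟩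
  | succ n ih =>
    intro v h
    by_cases hj : ∃ j, rnk J j = n
    · obtain ⟨j, hj⟩ := hj
      by_cases hp : Piv (· ∈ W) j
      · obtain ⟨w, hw, h1, h2⟩ := hp
        obtain ⟨u, hu, hu'⟩ := ih (v - v j • w) fun i hi => by
          rcases hi.eq_or_lt with h3 | h3
          · rw [rnk_inj (h3.symm.trans hj.symm)]; simp [h1]
          · simp [h i h3, h2 i (by omega)]
        exact ⟨u, by convert W.add_mem hu (W.smul_mem (v j) hw) using 1; abel, hu'⟩
      · obtain ⟨u, hu, hu'⟩ := ih (v - v j • Pi.single j 1) fun i hi => by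
          rcases hi.eq_or_lt with h3 | h3
          · rw [rnk_inj (h3.symm.trans hj.symm)]; simp
          · have : i ≠ j := fun e => by rw [e] at h3; omega
            simp [h i h3, this]
        refine ⟨u + v j • Pi.single j 1, by convert hu using 1; abel, fun i hi => ?_⟩
        have : i ≠ j := fun e => hp (e ▸ hi)
        simp [hu' i hi, this]
    · exact ih v fun i hi => h i (by rcases hi.eq_or_lt with h3 | h3; exacts [absurd ⟨i, h3.symm⟩ hj, h3])

theorem code_spec [Fintype J] (W : Submodule K (J → K)) (v : J → K) :
    v ∈ W ↔ ∀ i, ∑ j, v j * code (· ∈ W) j i = 0 := by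
  classical
  have hc : ∀ j, (fun i => (if i = j then 1 else 0) - code (· ∈ W) j i) ∈ W ∧
      ∀ i, Piv (· ∈ W) i → code (· ∈ W) j i = 0 := fun j => by
    refine dd_spec (R := fun u : J → K => (fun i => (if i = j then 1 else 0) - u i) ∈ W ∧ ∀ i, Piv (· ∈ W) i → u i = 0) ?_ ?_
    · obtain ⟨u, hu⟩ := piv_red W (Nat.card J) (fun i => if i = j then 1 else 0) fun i hi =>
        absurd (Finite.equivFin J i).2 (not_lt.mpr hi)
      exact ⟨u, hu⟩
    · intro u u' h h'
      refine sub_eq_zero.mp (piv_zero W (Nat.card J) (u - u') ?_ (fun i hi => by simp [h.2 i hi, h'.2 i hi])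
        fun i hi => absurd (Finite.equivFin J i).2 (not_lt.mpr hi))
      convert W.sub_mem h'.1 h.1 using 1
      ext i; simp
  have e : v - (fun i => ∑ j, v j * code (· ∈ W) j i) ∈ W := by
    have := W.sum_mem fun j (_ : j ∈ Finset.univ) => W.smul_mem (v j) (hc j).1
    convert this using 1
    ext i; simp [Finset.sum_apply, mul_sub]
  constructor
  · intro hv
    have h1 := W.sub_mem hv e
    rw [sub_sub_cancel] at h1
    have := piv_zero W (Nat.card J) _ h1 (fun i hi => by simp [(hc _).2 i hi])
        fun i hi => absurd (Finite.equivFin J i).2 (not_lt.mpr hi)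
    exact fun i => congrFun this i
  · intro h
    rw [show (fun i => ∑ j, v j * code (· ∈ W) j i) = 0 from funext h, sub_zero] at e
    exact e
end code
end
end PG


namespace PG
open MvPolynomial Filter

section
variable {K : Type} [Field K] [CharZero K] {ι κ : Type}

noncomputable def monB (D : K → K) (x : ι → K) (m : ι × ℕ →₀ ℕ) : K := m.prod fun q n => nab D x q ^ n

theorem monB_add (D : K → K) (x : ι → K) (m n) : monB D x (m + n) = monB D x m * monB D x n :=
  Finsupp.prod_add_index' (fun _ => pow_zero _) (fun _ _ _ => pow_add _ _ _)

theorem monB_e {C : Cx K} (x : ι → K) (p) : C.e x p = ∑ m ∈ p.support, C.φ (p.coeff m) * monB C.D x m := by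
  show eval₂ C.φ (nab C.D x) p = _
  rw [eval₂_eq]; rfl

theorem split (D : K → K) (m : (ι ⊕ κ) × ℕ →₀ ℕ) : ∃ m1 m2, ∀ x v, monB D (Sum.elim x v) m = monB D x m1 * monB D v m2 := by
  induction m using Finsupp.induction_linear with
  | zero => exact ⟨0, 0, fun x v => by simp [monB]⟩
  | add f g hf hg =>
    obtain ⟨a, b, h⟩ := hf
    obtain ⟨a', b', h'⟩ := hg
    exact ⟨a + a', b + b', fun x v => by simp only [monB_add, h, h']; ring⟩
  | single q n =>
    obtain ⟨i | i, j⟩ := q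
    · exact ⟨Finsupp.single (i, j) n, 0, fun x v => by simp [monB, nab]⟩
    · exact ⟨0, Finsupp.single (i, j) n, fun x v => by simp [monB, nab]⟩

theorem bil {C : Cx K} (P : MvPolynomial ((ι ⊕ κ) × ℕ) C.k) : ∃ (A : P.support → ι × ℕ →₀ ℕ) (B : P.support → κ × ℕ →₀ ℕ),
    ∀ x v, C.e (Sum.elim x v) P = ∑ s : P.support, (C.φ (P.coeff s) * monB C.D x (A s)) * monB C.D v (B s) := by
  choose A B h using fun s : P.support => split (ι := ι) (κ := κ) C.D s.1
  refine ⟨A, B, fun x v => ?_⟩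
  rw [monB_e, ← Finset.sum_coe_sort]
  exact Finset.sum_congr rfl fun s _ => by rw [h, mul_assoc]

variable {α β γ : Type} [Crd K α] [Crd K β] [Crd K γ] {𝒟 : DStr K} {C : Cx K}

@[fun_prop] theorem DF.iter [IsS 𝒟 α] {D : K → K} (hd : DF 𝒟 D) (n : ℕ) {f : α → K} (hf : DF 𝒟 f) : DF 𝒟 (fun a => D^[n] (f a)) := by
  induction n with
  | zero => exact hf
  | succ n ih => simp only [Function.iterate_succ_apply']; fun_prop

@[fun_prop] theorem DF.mon [IsS 𝒟 α] {D : K → K} (hd : DF 𝒟 D) {f : α → ι → K} (hf : ∀ i, DF 𝒟 (fun a => f a i)) (m) :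
    DF 𝒟 (fun a => monB D (f a) m) := by
  unfold monB Finsupp.prod nab
  refine DF.prodf _ fun q => DF.pow _ ?_
  have := hf q.1
  fun_prop

@[fun_prop] theorem DF.cc [IsS 𝒟 α] [IsS 𝒟 β] {f : β → α} (hf : DF 𝒟 f) : DF 𝒟 (fun b => cc K (f b)) := 
  DF.comp (f := fun a => PG.cc K a) (Rx.df ⟨fun q => q.1, fun _ => rfl⟩) hf

/-- almost all of a bounded-degree family -/
def relS {M S : Type} [Fintype M] (𝓖 : Filter S) (b : S → M → K) : Submodule K (M → K) where
  carrier := {c | ∀ᶠ s in 𝓖, ∑ m, c m * b s m = 0}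
  zero_mem' := by simp
  add_mem' := fun {a c} ha hc => by
    filter_upwards [ha, hc] with s h h'
    simp only [Pi.add_apply, add_mul, Finset.sum_add_distrib, h, h', add_zero]
  smul_mem' := fun r c hc => by
    filter_upwards [hc] with s h
    simp only [Pi.smul_apply, smul_eq_mul, mul_assoc, ← Finset.mul_sum, h, mul_zero]

theorem ann {M S : Type} [Fintype M] (q : Filter S) (b : S → M → K) :
    ∀ᶠ s in q, ∀ c : M → K, (∀ᶠ s in q, ∑ m, c m * b s m = 0) → ∑ m, c m * b s m = 0 := by
  let U := relS q b
  obtain ⟨t, ht⟩ := (IsNoetherian.noetherian U : U.FG)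
  have h1 : ∀ᶠ s in q, ∀ c ∈ t, ∑ m, c m * b s m = 0 :=
    (Filter.eventually_all_finset t).mpr fun c hc => by
      have : c ∈ U := ht ▸ Submodule.subset_span hc
      exact this
  filter_upwards [h1] with s hs c hc
  have hc : c ∈ U := hc
  have h2 : U ≤ relS (pure s) b := by
    rw [← ht, Submodule.span_le]
    exact fun c h => hs c h
  exact h2 hc

theorem commC {X Y : Type} {S : Set (ι ⊕ κ → K)} (h : Con C S) (p : Ultrafilter X) (q : Ultrafilter Y) (f : X → ι → K) (g : Y → κ → K) :
    (∀ᶠ a in p, ∀ᶠ b in q, Sum.elim (f a) (g b) ∈ S) ↔ ∀ᶠ b in q, ∀ᶠ a in p, Sum.elim (f a) (g b) ∈ S := by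
  induction h with
  | z P =>
    obtain ⟨A, B, h⟩ := bil P
    simp only [Set.mem_setOf_eq, h]
    constructor
    · intro H
      filter_upwards [ann q fun b s => monB C.D (g b) (B s)] with b hb
      filter_upwards [H] with a ha
      exact hb _ ha
    · intro H
      filter_upwards [ann p fun a (s : P.support) => (C.φ (P.coeff s) * monB C.D (f a) (A s))] with a ha
      filter_upwards [H] with b hb
      simp only [mul_comm _ (monB C.D (g b) _)] at hb ⊢
      exact ha _ hb
  | inter _ _ h1 h2 => simp only [Set.mem_inter_iff, eventually_and, h1, h2]
  | compl _ h1 => simp only [Set.mem_compl_iff, Ultrafilter.eventually_not, h1]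

theorem commC' {X Y : Type} {S : Set (ι ⊕ κ → K)} (h : Con C S) (p : Ultrafilter X) (q : Ultrafilter Y) {f : X → ι → K} {g : Y → κ → K}
    {W : X → Y → Prop} (hW : ∀ a b, Sum.elim (f a) (g b) ∈ S ↔ W a b) :
    (∀ᶠ a in p, ∀ᶠ b in q, W a b) ↔ ∀ᶠ b in q, ∀ᶠ a in p, W a b := by
  simpa only [hW] using commC h p q f g

theorem memc {W : α → β → Prop} (a : α) (b : β) :
    Sum.elim (cc K a) (cc K b) ∈ {z | ∃ p : α × β, W p.1 p.2 ∧ cc K p = z} ↔ W a b := by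
  constructor
  · rintro ⟨p, hp, h⟩
    have : p = (a, b) := cinj.mp (h : cc K p = cc K (a, b))
    subst this; exact hp
  · exact fun h => ⟨(a, b), h, rfl⟩

theorem comm {X Y : Type} [IsS C.str α] [IsS C.str β] {W : α → β → Prop} (h : DF C.str (fun p : α × β => W p.1 p.2)) (p : Ultrafilter X) (q : Ultrafilter Y)
    (f : X → α) (g : Y → β) :
    (∀ᶠ a in p, ∀ᶠ b in q, W (f a) (g b)) ↔ ∀ᶠ b in q, ∀ᶠ a in p, W (f a) (g b) := by
  exact commC' (DF.iff_dp.mp h : Con C _) p q fun a b => memc (f a) (g b)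

theorem hit [IsS C.str α] [IsS C.str β] {W : α → β → Prop} (h : DF C.str (fun p : α × β => W p.1 p.2)) (p : Ultrafilter α) :
    ∃ s : Finset α, ∀ b, (∀ᶠ a in p, W a b) → ∃ c ∈ s, W c b := by
  classical
  obtain ⟨t, ht, ht'⟩ := cpt (S := {b | ∀ᶠ a in p, W a b}) (Set.range fun c => {b | W c b}) fun q hq => by
    obtain ⟨a, ha⟩ := ((comm h p q (fun a => a) (fun b => b)).mpr hq).exists
    exact ⟨_, ⟨a, rfl⟩, ha⟩
  choose g hg using fun B : t => ht B.2
  refine ⟨Finset.univ.image g, fun b hb => ?_⟩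
  obtain ⟨B, hB, hb'⟩ := Set.mem_iUnion₂.mp (ht' hb)
  have hg' : {b | W (g ⟨B, hB⟩) b} = B := hg ⟨B, hB⟩
  exact ⟨g ⟨B, hB⟩, by simp, by rw [← hg'] at hb'; exact hb'⟩

theorem u4C {S : Set (ι ⊕ κ → K)} (h : Con C S) [Finite κ] : ∃ (M : Type) (_ : Finite M) (W : (M → K) → (κ → K) → Prop),
    DF C.str (fun p : (M → K) × (κ → K) => W p.1 p.2) ∧ ∀ {X : Type} (p : Ultrafilter X) (f : X → ι → K), ∃ c, ∀ v,
      (∀ᶠ s in p, Sum.elim (f s) v ∈ S) ↔ W c v := by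
  induction h with
  | z P =>
    obtain ⟨A, B, h⟩ := bil P
    refine ⟨P.support × P.support, inferInstance, fun c v => ∀ i, ∑ j, monB C.D v (B j) * c (j, i) = 0, ?_, fun p f => ?_⟩
    · have := Cx.der C
      refine DF.alf fun i => DF.eq (DF.sumf _ fun j => DF.mul (DF.mon this (fun i => ?_) _) ?_) ?_ <;> fun_prop
    · let U := relS p fun s (m : P.support) => C.φ (P.coeff m) * monB C.D (f s) (A m)
      refine ⟨fun q => code (· ∈ U) q.1 q.2, fun v => ?_⟩
      refine Iff.trans ?_ (code_spec U fun j => monB C.D v (B j))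
      simp only [Set.mem_setOf_eq, h, mul_comm _ (monB C.D v _)]; rfl
  | inter _ _ h1 h2 =>
    obtain ⟨M, _, W, h, h'⟩ := h1
    obtain ⟨N, _, W2, h2, h2'⟩ := h2
    refine ⟨M ⊕ N, inferInstance, fun c v => W (fun i => c (.inl i)) v ∧ W2 (fun i => c (.inr i)) v, ?_, fun p f => ?_⟩
    · have e1 : DF C.str (fun p : (M ⊕ N → K) × (κ → K) => W (fun i => p.1 (.inl i)) p.2) :=
        DF.comp (f := fun p : (M → K) × (κ → K) => W p.1 p.2) h
          (g := fun p : (M ⊕ N → K) × (κ → K) => (fun i => p.1 (.inl i), p.2)) (by fun_prop)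
      have e2 : DF C.str (fun p : (M ⊕ N → K) × (κ → K) => W2 (fun i => p.1 (.inr i)) p.2) :=
        DF.comp (f := fun p : (N → K) × (κ → K) => W2 p.1 p.2) h2
          (g := fun p : (M ⊕ N → K) × (κ → K) => (fun i => p.1 (.inr i), p.2)) (by fun_prop)
      exact DF.and e1 e2
    · obtain ⟨c, hc⟩ := h' p f
      obtain ⟨d, hd⟩ := h2' p f
      exact ⟨Sum.elim c d, fun v => by simp only [Set.mem_inter_iff, eventually_and, hc, hd]; rfl⟩
  | compl _ h1 =>
    obtain ⟨M, _, W, h, h'⟩ := h1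
    refine ⟨M, inferInstance, fun c v => ¬ W c v, h.not, fun p f => ?_⟩
    obtain ⟨c, hc⟩ := h' p f
    exact ⟨c, fun v => by simp only [Set.mem_compl_iff, Ultrafilter.eventually_not, hc]⟩

theorem u4 [IsS C.str α] [IsS C.str β] {I : Type} [Finite I] {R : β → α → Prop} (h : DF C.str (fun p : β × α => R p.1 p.2)) : ∃ (M : Type) (_ : Finite M) (W : (M → K) → α → Prop),
    DF C.str (fun p : (M → K) × α => W p.1 p.2) ∧ ∀ {X : Type} (p : I → Ultrafilter X) (f : X → β), ∃ c, ∀ v,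
      (∀ᶠ s in (⨆ i, (p i : Filter X)), R (f s) v) ↔ W c v := by
  obtain ⟨M, _, W, h1, h2⟩ := u4C (DF.iff_dp.mp h : Con C _)
  refine ⟨I × M, inferInstance, fun c v => ∀ i, W (fun m => c (i, m)) (cc K v), DF.alf fun i => ?_, fun p f => ?_⟩
  · exact DF.comp (f := fun p : (M → K) × (Crd.ι K α → K) => W p.1 p.2) h1
          (g := fun p : (I × M → K) × α => (fun m => p.1 (i, m), cc K p.2)) (by fun_prop)
  · choose c hc using fun i => h2 (p i) fun x => cc K (f x)
    refine ⟨fun q => c q.1 q.2, fun v => ?_⟩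
    simp only [eventually_iSup]
    exact forall_congr' fun i => Iff.trans (eventually_congr (.of_forall fun s => (memc (W := R) (f s) v).symm)) (hc i (cc K v))

end
end PG


namespace PG
open MvPolynomial Filter

class GO {K : Type} [Field K] (𝒟 : DStr K) (Γ : Type) [Group Γ] [Crd K Γ] : Prop extends IsS 𝒟 Γ where
  dmul : DF 𝒟 (fun p : Γ × Γ => p.1 * p.2)
  dinv : DF 𝒟 (fun p : Γ => p⁻¹)

section
variable {K : Type} [Field K] {𝒟 : DStr K} {α Γ : Type} [Group Γ] [Crd K Γ] [Crd K α]

@[fun_prop] theorem DF.gmul [IsS 𝒟 α] [h : GO 𝒟 Γ] {f g : α → Γ} (hf : DF 𝒟 f) (hg : DF 𝒟 g) : DF 𝒟 (fun a => f a * g a) :=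
  h.dmul.comp (hf.mk hg)
@[fun_prop] theorem DF.ginv [IsS 𝒟 α] [h : GO 𝒟 Γ] {f : α → Γ} (hf : DF 𝒟 f) : DF 𝒟 (fun a => (f a)⁻¹) :=
  h.dinv.comp hf

variable [CharZero K] {S : Stg K}
instance upG [h : GO S.dk.str Γ] : GO S.dK.str Γ := ⟨DF.up h.dmul, DF.up h.dinv⟩
instance cAll (a : α) : Cst S.dK.str a where
  h := by
    refine dpof (s := {z | ∀ i, z i = cc K a i}) ?_ fun z => ?_
    · have : DF S.dK.str (fun z : Crd.ι K α → K => ∀ i, z i = cc K a i) := by fun_prop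
      exact DP.of.mp (DF.iff_dp.mp this)
    · constructor
      · rintro ⟨_, rfl, rfl⟩ i; rfl
      · exact fun h => ⟨a, rfl, (funext h).symm⟩

def gen (X : Γ → Prop) : Prop := ∃ s : Finset (Γ × Γ), ∀ x, ∃ q ∈ s, X (q.1 * x * q.2)

theorem gen.mono {X Y : Γ → Prop} (h : ∀ x, X x → Y x) : gen X → gen Y :=
  fun ⟨s, hs⟩ => ⟨s, fun x => (hs x).imp fun _ hq => ⟨hq.1, h _ hq.2⟩⟩

theorem gen.tr {X : Γ → Prop} (c e : Γ) (h : gen fun x => X (c * x * e)) : gen X := by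
  classical
  obtain ⟨s, hs⟩ := h
  refine ⟨s.image fun q => (c * q.1, q.2 * e), fun x => ?_⟩
  obtain ⟨q, hq, h⟩ := hs x
  exact ⟨_, Finset.mem_image_of_mem _ hq, by simpa [mul_assoc] using h⟩

theorem not_gen {X : Γ → Prop} (h : ¬ gen X) : ∃ p : Ultrafilter Γ, ∀ c e, ∀ᶠ x in p, ¬ X (c * x * e) := by
  classical
  by_contra hn
  push Not at hn
  obtain ⟨t, ht, ht'⟩ := cpt (S := (Set.univ : Set Γ)) (Set.range fun q : Γ × Γ => {x | X (q.1 * x * q.2)}) fun p _ => by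
    obtain ⟨c, e, h⟩ := hn p
    exact ⟨_, ⟨(c, e), rfl⟩, h⟩
  choose g hg using fun B : t => ht B.2
  refine h ⟨Finset.univ.image g, fun x => ?_⟩
  obtain ⟨B, hB, hb'⟩ := Set.mem_iUnion₂.mp (ht' (Set.mem_univ x))
  have hg' : {x | X ((g ⟨B, hB⟩).1 * x * (g ⟨B, hB⟩).2)} = B := hg ⟨B, hB⟩
  exact ⟨g ⟨B, hB⟩, by simp, by rw [← hg'] at hb'; exact hb'⟩

variable (S) in
theorem gen_or [GO S.dK.str Γ] {X Y : Γ → Prop} (hX : DF S.dK.str X) (h : gen fun x => X x ∨ Y x) :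
    gen X ∨ gen Y := by
  by_contra hn
  push Not at hn
  obtain ⟨p, hp⟩ := not_gen hn.1
  obtain ⟨q, hq⟩ := not_gen hn.2
  obtain ⟨s, hs⟩ := h
  have h1 : ∀ᶠ x in p, ∀ᶠ z in q, ∀ r ∈ s, ¬ X (r.1 * (x * z) * r.2) := by
    refine (comm (C := S.dK) (W := fun x z : Γ => ∀ r ∈ s, ¬ X (r.1 * (x * z) * r.2)) ?_ p q (fun a => a) (fun b => b)).mpr ?_
    · have : DF S.dK.str (fun p : Γ × Γ => ∀ r : s, ¬ X (r.1.1 * (p.1 * p.2) * r.1.2)) := DF.alf fun r => by fun_prop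
      simpa using this
    · refine .of_forall fun z => (Filter.eventually_all_finset s).mpr fun r _ => ?_
      filter_upwards [hp r.1 (z * r.2)] with x hx
      simpa [mul_assoc] using hx
  obtain ⟨x, hx⟩ := h1.exists
  have h2 : ∀ᶠ z in q, ∀ r ∈ s, ¬ Y (r.1 * (x * z) * r.2) := (Filter.eventually_all_finset s).mpr fun r _ => by
    filter_upwards [hq (r.1 * x) r.2] with z hz
    simpa [mul_assoc] using hz
  obtain ⟨z, h3, h4⟩ := (hx.and h2).exists
  obtain ⟨r, hr, h5⟩ := hs (x * z)
  exact h5.elim (h3 r hr) (h4 r hr)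

theorem nogen [GO S.dK.str Γ] (t : Finset (Set Γ)) (h : ∀ B ∈ t, DF S.dK.str (· ∈ B) ∧ ¬ gen (· ∈ B)) :
    ¬ gen (· ∈ ⋃ B ∈ t, B) := by
  classical
  induction t using Finset.induction_on with
  | empty => rintro ⟨s, hs⟩; simpa using hs 1
  | insert a t _ ih =>
    intro hg
    rw [Finset.set_biUnion_insert] at hg
    rcases gen_or S (h a (by simp)).1 hg with h1 | h1
    · exact (h a (by simp)).2 h1
    · exact ih (fun B hB => h B (by simp [hB])) h1

variable (S) in
def TT (p : Ultrafilter Γ) : Prop := ∀ X : Γ → Prop, DF S.dK.str X → (∀ᶠ x in p, X x) → gen X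

variable (S) in
def eqv (p q : Ultrafilter Γ) : Prop := ∀ X : Γ → Prop, DF S.dK.str X → ((∀ᶠ x in p, X x) ↔ ∀ᶠ x in q, X x)

variable (S) in
def ZZ (p : Ultrafilter Γ) : Set (MvPolynomial (Crd.ι K Γ × ℕ) S.dK.k) := {f | ∀ᶠ x in p, S.dK.e (cc K x) f = 0}

theorem eqv_of [IsS S.dK.str Γ] {p q : Ultrafilter Γ} (h : ZZ S p = ZZ S q) : eqv S p q := fun X hX => by
  have e : ∀ x, cc K x ∈ {z | ∃ a, X a ∧ cc K a = z} ↔ X x := fun x =>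
    ⟨fun ⟨a, ha, h⟩ => cinj.mp h ▸ ha, fun h => ⟨x, h, rfl⟩⟩
  have := Con.agree (DF.iff_dp.mp hX : Con S.dK _) p q (fun x => cc K x) (fun x => cc K x) fun f => Set.ext_iff.mp h f
  simpa only [e] using this

theorem dfz [IsS S.dK.str Γ] (f) : DF S.dK.str (fun x : Γ => S.dK.e (cc K x) f = 0) :=
  DF.eq (DF.ev (C := S.dK) (fun c => inferInstance) (Cx.der S.dK) f fun i => by fun_prop) (by fun_prop)

theorem eqv.Z [IsS S.dK.str Γ] {p q : Ultrafilter Γ} (h : eqv S p q) : ZZ S p = ZZ S q :=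
  Set.ext fun f => h _ (dfz f)

theorem exT [GO S.dK.str Γ] {X : Γ → Prop} (hg : gen X) : ∃ p : Ultrafilter Γ, TT S p ∧ ∀ᶠ x in p, X x := by
  by_contra hn
  push Not at hn
  obtain ⟨t, ht, ht'⟩ := cpt (S := {x | X x}) {B | DF S.dK.str (· ∈ B) ∧ ¬ gen (· ∈ B)} fun p hp => by
    have : ¬ TT S p := fun h => by
      obtain ⟨x, h1, h2⟩ := ((hn p h).and hp).exists
      exact h1 h2
    unfold TT at this
    push Not at this
    obtain ⟨Y, h1, h2, h3⟩ := this
    exact ⟨{x | Y x}, ⟨h1, h3⟩, h2⟩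
  exact nogen t (fun B hB => ht hB) (hg.mono ht')

theorem maxT [GO S.dK.str Γ] : ∃ p, TT (Γ := Γ) S p ∧ ∀ q, TT S q → ZZ S p ⊆ ZZ S q → ZZ S q = ZZ S p := by
  classical
  obtain ⟨m, ⟨p, hp, rfl⟩, hm⟩ := zorn_subset {Z | ∃ p, TT (Γ := Γ) S p ∧ ZZ S p = Z} fun c hc hch => by
    rcases c.eq_empty_or_nonempty with rfl | hne
    · obtain ⟨p, hp, -⟩ := exT (S := S) (X := fun _ : Γ => True) ⟨{1}, by simp⟩
      exact ⟨_, ⟨p, hp, rfl⟩, by simp⟩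
    by_contra hn
    push Not at hn
    obtain ⟨t, ht, ht'⟩ := cpt (S := (Set.univ : Set Γ)) ({B | DF S.dK.str (· ∈ B) ∧ ¬ gen (· ∈ B)} ∪
        (fun f => {x | ¬ S.dK.e (cc K x) f = 0}) '' ⋃₀ c) fun p _ => by
      by_cases h : TT S p
      · obtain ⟨Z, hZ, h2⟩ := hn _ ⟨p, h, rfl⟩
        obtain ⟨f, hf, hf'⟩ := Set.not_subset.mp h2
        exact ⟨_, .inr ⟨f, ⟨Z, hZ, hf⟩, rfl⟩, Ultrafilter.eventually_not.mpr hf'⟩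
      · unfold TT at h
        push Not at h
        obtain ⟨Y, h1, h2, h3⟩ := h
        exact ⟨{x | Y x}, .inl ⟨h1, h3⟩, h2⟩
    have : ∀ B : t, ∃ f ∈ ⋃₀ c, (DF S.dK.str (· ∈ B.1) ∧ ¬ gen (· ∈ B.1)) ∨ {x | ¬ S.dK.e (cc K x) f = 0} = B := fun B => by
      rcases ht B.2 with h | ⟨f, hf, h⟩
      · obtain ⟨Z, hZ⟩ := hne
        obtain ⟨p, hp, rfl⟩ := hc hZ
        exact ⟨0, ⟨_, hZ, by simp [ZZ]⟩, .inl h⟩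
      · exact ⟨f, hf, .inr h⟩
    choose g hg hg' using this
    obtain ⟨Z, hZ, hs⟩ := hch.directedOn.exists_mem_subset_of_finite_of_subset_sUnion hne (Set.finite_range g)
      (by rintro _ ⟨B, rfl⟩; exact hg B)
    obtain ⟨p, hp, rfl⟩ := hc hZ
    have h1 : ∀ᶠ x in p, ∃ B : t, x ∈ B.1 := .of_forall fun x => by
      obtain ⟨B, hB, h⟩ := Set.mem_iUnion₂.mp (ht' (Set.mem_univ x))
      exact ⟨⟨B, hB⟩, h⟩
    rw [Ultrafilter.eventually_exists_iff] at h1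
    obtain ⟨B, hB⟩ := h1
    rcases hg' B with h | h
    · exact h.2 (hp _ h.1 hB)
    · have h2 : ∀ᶠ x in p, S.dK.e (cc K x) (g B) = 0 := hs ⟨B, rfl⟩
      rw [← h] at hB
      obtain ⟨x, h3, h4⟩ := (hB.and h2).exists
      exact h3 h4
  exact ⟨p, hp, fun q hq h => (hm ⟨q, hq, rfl⟩ h).antisymm h⟩

def tr (c e : Γ) (p : Ultrafilter Γ) : Ultrafilter Γ := p.map fun x => c * x * e

theorem tr_ev (c e : Γ) (p : Ultrafilter Γ) (X : Γ → Prop) : (∀ᶠ x in tr c e p, X x) ↔ ∀ᶠ x in p, X (c * x * e) := Iff.rfl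

theorem TT.tr [GO S.dK.str Γ] {p : Ultrafilter Γ} (h : TT S p) (c e : Γ) : TT S (tr c e p) := fun X hX hx =>
  gen.tr c e (h _ (by fun_prop) hx)

theorem eqv.tr [GO S.dK.str Γ] {p q : Ultrafilter Γ} (h : eqv S p q) (c e : Γ) : eqv S (tr c e p) (tr c e q) := fun X hX =>
  h (fun x => X (c * x * e)) (by fun_prop)

theorem tr_tr (c e c' e' : Γ) (p : Ultrafilter Γ) : tr c e (tr c' e' p) = tr (c * c') (e' * e) p :=
  Ultrafilter.coe_injective (Filter.ext fun s => by simp [tr, mul_assoc, Function.comp_def])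

variable (S Γ) in
structure Gn where
  I : Type
  fin : Finite I
  ne : Nonempty I
  P : I → Ultrafilter Γ
  a : Γ → Γ → I → I
  ha : ∀ c e i X, DF S.dK.str X → ((∀ᶠ x in P i, X (c * x * e)) ↔ ∀ᶠ x in P (a c e i), X x)
  orb : ∀ i j, ∃ c e, a c e i = j
  sep : ∀ i j, eqv S (P i) (P j) → i = j
  d3 : ∀ {V : Type} [Crd K V] [IsS S.dk.str V] {Y : V → Γ → Prop}, DF S.dk.str (fun p : V × Γ => Y p.1 p.2) →
    DF S.dk.str (fun v => ∀ᶠ x in ⨆ i, (P i : Filter Γ), Y v x)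

attribute [instance] Gn.fin Gn.ne

variable (S Γ) in
theorem exGn [GO S.dk.str Γ] : Nonempty (Gn Γ S) := by
  classical
  obtain ⟨p0, hp0, hmax⟩ := maxT (S := S) (Γ := Γ)
  obtain ⟨P, Q, hU, hU'⟩ := b8 (C := S.dK) p0 fun x => cc K x
  have dU : DF S.dK.str (fun x : Γ => cc K x ∈ bas S.dK P Q) := 
    (DF.iff_dp.mpr (DP.of.mpr (Con.bass P Q))).comp (g := fun x : Γ => cc K x) (by fun_prop)
  obtain ⟨s, hs⟩ := hp0 _ dU hU
  have key : ∀ p, TT S p → ∃ q ∈ s, eqv S p (tr q.1⁻¹ q.2⁻¹ p0) := fun p hp => by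
    have h1 : ∀ᶠ x in p, ∃ q ∈ (s : Set (Γ × Γ)), cc K (q.1 * x * q.2) ∈ bas S.dK P Q := .of_forall hs
    rw [Ultrafilter.eventually_exists_mem_iff s.finite_toSet] at h1
    obtain ⟨q, hq, h2⟩ := h1
    refine ⟨q, hq, ?_⟩
    have h3 : ZZ S p0 ⊆ ZZ S (tr q.1 q.2 p) := fun f hf => by
      filter_upwards [(tr_ev q.1 q.2 p fun x => cc K x ∈ bas S.dK P Q).mpr h2] with x hx
      exact hU' _ hx f hf
    have h4 := (eqv_of (hmax _ (hp.tr _ _) h3)).tr q.1⁻¹ q.2⁻¹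
    rw [tr_tr] at h4
    convert h4 using 1
    simp [tr]
  have kg : ∀ X : Γ → Prop, DF S.dK.str X → (gen X ↔ ∃ p, TT S p ∧ ∀ᶠ x in p, X x) := fun X hX =>
    ⟨exT, fun ⟨p, hp, h⟩ => hp X hX h⟩
  let I := {Z : Set (MvPolynomial (Crd.ι K Γ × ℕ) S.dK.k) // ∃ p, TT (Γ := Γ) S p ∧ ZZ S p = Z}
  have hfin : Finite I := by
    have : Function.Surjective (fun q : s => (⟨ZZ S (tr q.1.1⁻¹ q.1.2⁻¹ p0), _, hp0.tr _ _, rfl⟩ : I)) := by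
      rintro ⟨_, p, hp, rfl⟩
      obtain ⟨q, hq, h⟩ := key p hp
      exact ⟨⟨q, hq⟩, Subtype.ext h.Z.symm⟩
    exact Finite.of_surjective _ this
  let PP : I → Ultrafilter Γ := fun i => i.2.choose
  have hT : ∀ i, TT S (PP i) := fun i => i.2.choose_spec.1
  have hZ : ∀ i, ZZ S (PP i) = i.1 := fun i => i.2.choose_spec.2
  let ix : ∀ p, TT (Γ := Γ) S p → I := fun p hp => ⟨ZZ S p, p, hp, rfl⟩
  have hix : ∀ p hp, eqv S p (PP (ix p hp)) := fun p hp => eqv_of (hZ (ix p hp)).symm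
  have hsup : ∀ X : Γ → Prop, DF S.dK.str X → ((∀ᶠ x in ⨆ i, (PP i : Filter Γ), X x) ↔ ¬ gen fun x => ¬ X x) := fun X hX => by
    rw [eventually_iSup, kg _ hX.not]
    constructor
    · rintro h ⟨p, hp, h'⟩
      obtain ⟨x, h1, h2⟩ := (((hix p hp X hX).mpr (h _)).and h').exists
      exact h2 h1
    · intro h i
      by_contra h'
      exact h ⟨PP i, hT i, Ultrafilter.eventually_not.mpr h'⟩
  have orb : ∀ i : I, ∃ c e, eqv S (PP i) (tr c e p0) := fun i => by
    obtain ⟨q, -, h⟩ := key _ (hT i)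
    exact ⟨_, _, h⟩
  refine ⟨⟨I, hfin, ⟨ix p0 hp0⟩, PP, fun c e i => ix _ ((hT i).tr c e), fun c e i X hX => hix _ ((hT i).tr c e) X hX, fun i j => ?_,
    fun i j h => Subtype.ext (by rw [← hZ i, ← hZ j, h.Z]), fun {V} _ _ Y hY => ?_⟩⟩
  · obtain ⟨c, e, h⟩ := orb i
    obtain ⟨c', e', h'⟩ := orb j
    refine ⟨c' * c⁻¹, e⁻¹ * e', Subtype.ext ?_⟩
    show ZZ S (tr _ _ (PP i)) = _
    rw [← hZ j, h'.Z, (h.tr _ _).Z, tr_tr]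
    simp
  · have hYv : ∀ v, DF S.dK.str (fun x => ¬ Y v x) := fun v =>
      (DF.comp (f := fun p : V × Γ => Y p.1 p.2) hY.up (g := fun x => (v, x)) (by fun_prop)).not
    have hh : ∀ i : I, ∃ t : Finset Γ, ∀ b : Γ × V, (∀ᶠ e in PP i, ¬ Y b.2 (b.1 * e)) → ∃ e ∈ t, ¬ Y b.2 (b.1 * e) := fun i => by
      refine hit (C := S.dK) (W := fun (e : Γ) (b : Γ × V) => ¬ Y b.2 (b.1 * e)) ?_ (PP i)
      exact (DF.comp (f := fun p : V × Γ => Y p.1 p.2) hY.up (g := fun p : Γ × (Γ × V) => (p.2.2, p.2.1 * p.1)) (by fun_prop)).not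
    choose t ht using hh
    haveI := Fintype.ofFinite I
    let T := Finset.univ.biUnion t
    have hd : ∀ v, (∀ᶠ x in ⨆ i, (PP i : Filter Γ), Y v x) ↔ ¬ ∃ e : Fin T.card → Γ, ∀ x, ∃ i, ¬ Y v (x * e i) := fun v => by
      rw [hsup _ (by simpa using (hYv v).not), not_iff_not]
      constructor
      · intro hg
        refine ⟨fun i => T.equivFin.symm i, fun x => ?_⟩
        obtain ⟨p, hp, h⟩ := (kg _ (hYv v)).mp hg
        have h1 : ∀ᶠ e in tr x⁻¹ 1 p, ¬ Y v (x * e) := by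
          rw [tr_ev]; simpa using h
        rw [hix _ (hp.tr _ _) _ ((hYv v).comp (g := fun e => x * e) (by fun_prop))] at h1
        obtain ⟨e, he, h2⟩ := ht _ (x, v) h1
        exact ⟨T.equivFin ⟨e, Finset.mem_biUnion.mpr ⟨_, Finset.mem_univ _, he⟩⟩, by simpa using h2⟩
      · rintro ⟨e, he⟩
        refine ⟨Finset.univ.image fun i => (1, e i), fun x => ?_⟩
        obtain ⟨i, hi⟩ := he x
        exact ⟨(1, e i), by simp, by simpa using hi⟩
    simp only [hd]
    refine DF.not (DF.ex (DF.all (DF.exf fun i => DF.not ?_)))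
    exact DF.comp (f := fun p : V × Γ => Y p.1 p.2) hY (g := fun p : (V × (Fin T.card → Γ)) × Γ => (p.1.1, p.2 * p.1.2 i)) (by fun_prop)

end
end PG


namespace PG
open MvPolynomial Filter

section
variable {K : Type} [Field K] [CharZero K] {Γ : Type} [Group Γ] [Crd K Γ] {S : Stg K}

def Gn.F (g : Gn Γ S) : Filter Γ := ⨆ i, (g.P i : Filter Γ)

theorem Gn.evF (g : Gn Γ S) {X : Γ → Prop} : (∀ᶠ x in g.F, X x) ↔ ∀ i, ∀ᶠ x in g.P i, X x := eventually_iSup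

theorem Gn.hl (g : Gn Γ S) (c i) (X : Γ → Prop) (hX : DF S.dK.str X) :
    (∀ᶠ x in g.P i, X (c * x)) ↔ ∀ᶠ x in g.P (g.a c 1 i), X x := by simpa using g.ha c 1 i X hX
theorem Gn.hr (g : Gn Γ S) (c i) (X : Γ → Prop) (hX : DF S.dK.str X) :
    (∀ᶠ x in g.P i, X (x * c)) ↔ ∀ᶠ x in g.P (g.a 1 c i), X x := by simpa using g.ha 1 c i X hX

theorem uiff {X : Type} (p : Ultrafilter X) (A B : X → Prop) : (∀ᶠ x in p, (A x ↔ B x)) ↔ ((∀ᶠ x in p, A x) ↔ ∀ᶠ x in p, B x) := by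
  simp only [iff_iff_implies_and_implies, eventually_and, Ultrafilter.eventually_imp]

theorem exEc [GO S.dk.str Γ] (g : Gn Γ S) : ∃ (J : Type) (_ : Finite J) (ec : Γ → J → K), DF S.dk.str ec ∧ Function.Injective ec ∧
    ∀ l l', l ≠ l' → ∃ i r r', r ≠ r' ∧ (∀ᶠ x in g.P l, ec x i = r) ∧ ∀ᶠ x in g.P l', ec x i = r' := by
  classical
  haveI := Fintype.ofFinite g.I
  have lmul : ∀ x y i, g.a (x * y) 1 i = g.a x 1 (g.a y 1 i) := fun x y i => g.sep _ _ fun X hX => by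
    rw [← g.hl _ _ _ hX, ← g.hl _ _ _ hX, ← g.hl y _ (fun z => X (x * z)) (by fun_prop)]
    simp only [mul_assoc]
  have rinj : ∀ x i j, g.a 1 x i = g.a 1 x j → i = j := fun x i j h => g.sep _ _ fun X hX => by
    have h1 := g.hr x i (fun z => X (z * x⁻¹)) (by fun_prop)
    rw [h, ← g.hr x j (fun z => X (z * x⁻¹)) (by fun_prop)] at h1
    simpa using h1
  have hla : ∀ l, ∃ f, ∀ᶠ z in g.P l, g.a z 1 = f := fun l =>
    Ultrafilter.eventually_exists_iff.mp (.of_forall fun z => ⟨_, rfl⟩)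
  have hra : ∀ l, ∃ f, ∀ᶠ z in g.P l, g.a 1 z = f := fun l =>
    Ultrafilter.eventually_exists_iff.mp (.of_forall fun z => ⟨_, rfl⟩)
  choose la hla using hla
  choose ra hra using hra
  have lr : ∀ l m, la l m = ra m l := fun l m => g.sep _ _ fun X hX => by
    have h1 := comm (C := S.dK) (W := fun z w : Γ => X (z * w)) (by fun_prop) (g.P l) (g.P m) (fun a => a) (fun b => b)
    have h2 : (∀ᶠ z in g.P l, ∀ᶠ w in g.P m, X (z * w)) ↔ ∀ᶠ x in g.P (la l m), X x := by
      rw [← eventually_const (f := (g.P l : Filter Γ)) (p := ∀ᶠ x in g.P (la l m), X x)]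
      refine eventually_congr ((hla l).mono fun z hz => ?_)
      rw [g.hl _ _ _ hX, hz]
    have h3 : (∀ᶠ w in g.P m, ∀ᶠ z in g.P l, X (z * w)) ↔ ∀ᶠ x in g.P (ra m l), X x := by
      rw [← eventually_const (f := (g.P m : Filter Γ)) (p := ∀ᶠ x in g.P (ra m l), X x)]
      refine eventually_congr ((hra m).mono fun z hz => ?_)
      rw [g.hr _ _ _ hX, hz]
    exact h2.symm.trans (h1.trans h3)
  have lainj : ∀ l l', la l = la l' → l = l' := fun l l' h => by
    obtain ⟨z, hz⟩ := (hra l).exists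
    refine rinj z _ _ ?_
    rw [hz, ← lr, ← lr, h]
  have hx : ∀ x, ∃ l, la l = g.a x 1 := fun x => by
    obtain ⟨i⟩ := g.ne
    obtain ⟨z, hz⟩ := (hla i).exists
    refine ⟨g.a (x * z⁻¹) 1 i, ?_⟩
    by_contra hn
    have h1 : ∀ᶠ w in g.P i, g.a ((x * z⁻¹) * w) 1 = g.a x 1 := (hla i).mono fun w hw => by
      ext j; rw [lmul, hw, ← hz, ← lmul]; simp
    -- compare using comm
    have h2 : ∀ m, g.a x 1 m = la (g.a (x * z⁻¹) 1 i) m := fun m => g.sep _ _ fun X hX => by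
      have h1 := comm (C := S.dK) (W := fun u w : Γ => X ((x * z⁻¹) * u * w)) (by fun_prop) (g.P i) (g.P m) (fun a => a) (fun b => b)
      have h2 : (∀ᶠ u in g.P i, ∀ᶠ w in g.P m, X ((x * z⁻¹) * u * w)) ↔ ∀ᶠ v in g.P (g.a x 1 m), X v := by
        rw [← eventually_const (f := (g.P i : Filter Γ)) (p := ∀ᶠ v in g.P (g.a x 1 m), X v)]
        refine eventually_congr (‹∀ᶠ w in g.P i, g.a ((x * z⁻¹) * w) 1 = g.a x 1›.mono fun z hz => ?_)
        rw [g.hl _ _ _ hX, hz]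
      have h3 : (∀ᶠ w in g.P m, ∀ᶠ u in g.P i, X ((x * z⁻¹) * u * w)) ↔ ∀ᶠ v in g.P (la (g.a (x * z⁻¹) 1 i) m), X v := by
        rw [lr, ← eventually_const (f := (g.P m : Filter Γ)) (p := ∀ᶠ x in g.P (ra m _), X x)]
        refine eventually_congr ((hra m).mono fun w hw => ?_)
        rw [g.hl _ _ (fun v => X (v * w)) (by fun_prop), g.hr _ _ _ hX, hw]
      exact h2.symm.trans (h1.trans h3)
    exact hn (funext fun m => (h2 m).symm)
  -- separating polynomials
  have hs : ∀ q : g.I × g.I, ∃ f, q.1 ≠ q.2 → ¬ (f ∈ ZZ S (g.P q.1) ↔ f ∈ ZZ S (g.P q.2)) := fun q => by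
    by_contra hn
    simp only [not_exists, Classical.not_imp, not_not] at hn
    exact (hn 0).1 (g.sep q.1 q.2 (eqv_of (Set.ext fun f => (hn f).2)))
  choose f hf using hs
  obtain ⟨M, hM⟩ : ∃ M : Finset (Crd.ι K Γ × ℕ →₀ ℕ), ∀ q, (f q).support ⊆ M :=
    ⟨Finset.univ.biUnion fun q => (f q).support, fun q => Finset.subset_biUnion_of_mem (fun q => (f q).support) (Finset.mem_univ q)⟩
  let Ψ : (M → K) → Γ → Prop := fun β x => ∑ m : M, β m * monB S.D (cc K x) m = 0
  have dS : DF S.dk.str S.D := Cx.der S.dk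
  have dΨ : ∀ {α : Type} [Crd K α] [IsS S.dk.str α] {u : α → M → K} {v : α → Γ}, DF S.dk.str u → DF S.dk.str v →
      DF S.dk.str (fun a => Ψ (u a) (v a)) := fun {α} _ _ u v hu hv =>
    DF.eq (DF.sumf _ fun m => DF.mul (by fun_prop) (DF.mon dS (fun i => by fun_prop) _)) (by fun_prop)
  have dΨK : ∀ β, DF S.dK.str (Ψ β) := fun β => (dΨ (α := (M → K) × Γ) DF.fst DF.snd).up.comp (g := fun x => (β, x)) (by fun_prop)
  have hΨ : ∀ l l', (∀ β, (∀ᶠ x in g.P l, Ψ β x) ↔ ∀ᶠ x in g.P l', Ψ β x) → l = l' := fun l l' h => by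
    by_contra hne
    refine hf (l, l') hne ?_
    have e : ∀ x, S.dK.e (cc K x) (f (l, l')) = 0 ↔ Ψ (fun m => S.dK.φ ((f (l, l')).coeff m.1)) x := fun x => by
      show _ ↔ ∑ m : M, _ = 0
      rw [monB_e, Finset.sum_coe_sort M (fun m => S.dK.φ ((f (l, l')).coeff m) * monB S.D (cc K x) m)]
      rw [Finset.sum_subset (hM (l, l')) fun m _ h => by rw [notMem_support_iff.mp h]; simp]
      rfl
    simp only [ZZ, Set.mem_setOf_eq, e]
    exact h _
  let E : Γ → Γ → Prop := fun x x' => ∀ β, ∀ᶠ z in g.F, (Ψ β (x * z) ↔ Ψ β (x' * z))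
  have hE : ∀ x x', E x x' ↔ g.a x 1 = g.a x' 1 := fun x x' => by
    have : E x x' ↔ ∀ i β, ((∀ᶠ z in g.P (g.a x 1 i), Ψ β z) ↔ ∀ᶠ z in g.P (g.a x' 1 i), Ψ β z) := by
      show (∀ β, ∀ᶠ z in g.F, (Ψ β (x * z) ↔ Ψ β (x' * z))) ↔ _
      simp only [g.evF, uiff, fun x i β => g.hl x i (Ψ β) (dΨK β)]
      exact forall_comm
    rw [this]
    exact ⟨fun h => funext fun i => hΨ _ _ (h i), fun h i β => by rw [h]⟩
  have dE : DF S.dk.str (fun p : Γ × Γ => E p.1 p.2) := by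
    refine DF.all (g.d3 (V := (Γ × Γ) × (M → K)) (Y := fun v z => (Ψ v.2 (v.1.1 * z) ↔ Ψ v.2 (v.1.2 * z))) (DF.iff (dΨ ?_ ?_) (dΨ ?_ ?_))) <;> fun_prop
  let W : Γ → (M → K) → Prop := fun x β => ∀ᶠ z in g.F, (E z x → Ψ β z)
  have dW : DF S.dk.str (fun p : Γ × (M → K) => W p.1 p.2) := by
    refine g.d3 (V := Γ × (M → K)) (Y := fun v z => (E z v.1 → Ψ v.2 z)) (DF.imp ?_ (dΨ ?_ ?_))
    · exact dE.comp (g := fun p : (Γ × (M → K)) × Γ => (p.2, p.1.1)) (by fun_prop)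
    · fun_prop
    · fun_prop
  have hW : ∀ x l, la l = g.a x 1 → W x = (· ∈ relS (g.P l : Filter Γ) fun x (m : M) => monB S.D (cc K x) m) := fun x l hl => by
    ext β
    show (∀ᶠ z in g.F, _) ↔ ∀ᶠ z in g.P l, Ψ β z
    rw [g.evF]
    constructor
    · intro h
      filter_upwards [h l, hla l] with z h1 h2
      exact h1 ((hE _ _).mpr (h2.trans hl))
    · intro h i
      by_cases hi : i = l
      · subst hi; exact h.mono fun z hz _ => hz
      · filter_upwards [hla i] with z hz h2
        exact absurd (lainj _ _ (by rw [hl, ← (hE _ _).mp h2, hz])) hi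
  refine ⟨Crd.ι K Γ ⊕ (M × M), inferInstance, fun x => Sum.elim (cc K x) fun q => code (W x) q.1 q.2, ?_, ?_, ?_⟩
  · refine DF.pi fun j => ?_
    rcases j with j | j
    · show DF _ (fun x : Γ => cc K x j); fun_prop
    · have : DF S.dk.str (fun x => code (W x)) := DF.code dW
      show DF _ (fun x : Γ => code (W x) j.1 j.2); fun_prop
  · exact fun x y h => cinj.mp (funext fun i => congrFun h (.inl i))
  · intro l l' hne
    let η : g.I → M → M → K := fun l => code (· ∈ relS (g.P l : Filter Γ) fun x (m : M) => monB S.D (cc K x) m)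
    have hη : ∀ l, ∀ᶠ x in g.P l, code (W x) = η l := fun l => (hla l).mono fun x hx => by rw [hW x l hx.symm]
    have : ∃ q : M × M, η l q.1 q.2 ≠ η l' q.1 q.2 := by
      by_contra hn
      push Not at hn
      refine hne (hΨ _ _ fun β => ?_)
      have h1 := code_spec (relS (g.P l : Filter Γ) fun x (m : M) => monB S.D (cc K x) m) β
      have h2 := code_spec (relS (g.P l' : Filter Γ) fun x (m : M) => monB S.D (cc K x) m) β
      rw [show code _ = η l' from (funext₂ fun a b => hn (a, b) : η l = η l')] at h1
      exact h1.trans h2.symm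
    obtain ⟨q, hq⟩ := this
    exact ⟨.inr q, _, _, hq, (hη l).mono fun x hx => congrFun₂ hx _ _, (hη l').mono fun x hx => congrFun₂ hx _ _⟩

end
end PG


namespace PG
open MvPolynomial Filter

section
variable {K : Type} [Field K] [CharZero K] {T M J : Type} [Fintype M]

def bb (b : M → K) (t : K) : M ⊕ M → K := Sum.elim (fun m => b m * t) (fun m => - b m)

theorem bb_sum (c : M ⊕ M → K) (b : M → K) (t : K) :
    ∑ j, c j * bb b t j = (∑ m, c (.inl m) * b m) * t - ∑ m, c (.inr m) * b m := by
  simp [bb, Fintype.sum_sum_type, Finset.sum_mul, mul_assoc, sub_eq_add_neg]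

abbrev Cd (K M J : Type) := J → M ⊕ M → M ⊕ M → K

/-- codes of functions -/
noncomputable def cd (𝓖 : Filter T) (B : T → M → K) (φ : T → J → K) : Cd K M J :=
  fun j => code (· ∈ relS 𝓖 fun s => bb (B s) (φ s j))

noncomputable def evc (κ : Cd K M J) (b : M → K) : J → K := fun j =>
  dd fun t : K => ∃ c : M ⊕ M → K, (∀ i, ∑ l, c l * κ j l i = 0) ∧ ∑ m, c (.inl m) * b m ≠ 0 ∧ ∑ l, c l * bb b t l = 0

def good (𝓖 : Filter T) (B : T → M → K) (φ : T → J → K) : Prop :=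
  ∀ j, ∀ᶠ s in 𝓖, ∃ c ∈ relS 𝓖 (fun s => bb (B s) (φ s j)), ∑ m, c (.inl m) * B s m ≠ 0

variable {𝓖 : Filter T} {B : T → M → K} {φ ψ : T → J → K}

theorem rel_congr (h : ∀ᶠ s in 𝓖, φ s = ψ s) (j : J) :
    relS 𝓖 (fun s => bb (B s) (φ s j)) = relS 𝓖 (fun s => bb (B s) (ψ s j)) :=
  Submodule.ext fun c => eventually_congr (h.mono fun s hs => by simp only [hs])

theorem cd_congr (h : ∀ᶠ s in 𝓖, φ s = ψ s) : cd 𝓖 B φ = cd 𝓖 B ψ :=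
  funext fun j => by unfold cd; rw [rel_congr h]

theorem good.congr (h : ∀ᶠ s in 𝓖, φ s = ψ s) (hg : good 𝓖 B φ) : good 𝓖 B ψ := fun j => by
  rw [← rel_congr h]; exact hg j

theorem good.ev [Finite J] (hg : good 𝓖 B φ) : ∀ᶠ s in 𝓖, evc (cd 𝓖 B φ) (B s) = φ s := by
  have : ∀ j, ∀ᶠ s in 𝓖, evc (cd 𝓖 B φ) (B s) j = φ s j := fun j => by
    filter_upwards [hg j, ann 𝓖 fun s => bb (B s) (φ s j)] with s ⟨c, hc, h⟩ h2
    refine dd_eq ⟨c, (code_spec _ c).mp hc, h, h2 c hc⟩ ?_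
    rintro t ⟨c', h3, h4, h5⟩
    have h6 := h2 c' ((code_spec _ c').mpr h3)
    rw [bb_sum] at h5 h6
    exact mul_left_cancel₀ h4 ((sub_eq_zero.mp h5).trans (sub_eq_zero.mp h6).symm)
  filter_upwards [eventually_all.mpr this] with s hs
  exact funext hs

variable {𝒟 : DStr K} {α V X L : Type} [Crd K α] [Crd K V] [Crd K X] {C : Cx K}

@[fun_prop] theorem DF.bb [IsS 𝒟 α] {f : α → M → K} {g : α → K} (hf : DF 𝒟 f) (hg : DF 𝒟 g) : DF 𝒟 (fun a => bb (f a) (g a)) := by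
  refine DF.pi fun j => ?_
  rcases j with j | j
  · show DF 𝒟 (fun a => f a j * g a); fun_prop
  · show DF 𝒟 (fun a => - f a j)
    simp only [← zero_sub]; fun_prop

@[fun_prop] theorem DF.evc [IsS 𝒟 α] [Finite J] {f : α → Cd K M J} {g : α → M → K} (hf : DF 𝒟 f) (hg : DF 𝒟 g) :
    DF 𝒟 (fun a => evc (f a) (g a)) := by
  unfold PG.evc
  fun_prop

theorem lin {ι κ : Type} (P : MvPolynomial ((ι ⊕ κ) × ℕ) C.k) : ∃ F0 : Finset (κ × ℕ →₀ ℕ), ∀ F, F0 ⊆ F → ∀ x, ∃ c : F → K, ∀ v,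
    C.e (Sum.elim x v) P = ∑ m : F, c m * monB C.D v m := by
  classical
  obtain ⟨A, B, h⟩ := bil P
  refine ⟨Finset.univ.image B, fun F hF x => ⟨fun m => ∑ s : P.support, if B s = m then C.φ (P.coeff s) * monB C.D x (A s) else 0, fun v => ?_⟩⟩
  simp only [h, Finset.sum_mul]
  rw [Finset.sum_comm]
  refine Finset.sum_congr rfl fun s _ => ?_
  rw [Finset.sum_eq_single ⟨B s, hF (by simp)⟩]
  · simp
  · intro m _ hm
    rw [if_neg (fun e => hm (Subtype.ext e.symm)), zero_mul]
  · simp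

/-- the monomial basis vector -/
noncomputable def bs (C : Cx K) {ι : Type} (F : Finset (ι × ℕ →₀ ℕ)) (x : ι → K) : F → K := fun m => monB C.D x m

theorem goodlem [Finite L] [Finite J] {F : X → V → J → K} (hF : DF C.str (fun p : X × V => F p.1 p.2)) [IsS C.str X] [IsS C.str V] (p : L → Ultrafilter T) (v : T → V)
    (hs : ∀ l l', l ≠ l' → ∃ R, (∀ᶠ s in p l, C.e (cc K (v s)) R = 0) ∧ ∀ᶠ s in p l', C.e (cc K (v s)) R ≠ 0) :
    ∃ F0 : Finset (Crd.ι K V × ℕ →₀ ℕ), ∀ x, good (⨆ l, (p l : Filter T)) (fun s => bs C F0 (cc K (v s))) (fun s => F x (v s)) := by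
  classical
  haveI := Fintype.ofFinite L
  haveI := Fintype.ofFinite J
  choose! R hR hR' using hs
  let σ : L → MvPolynomial ((Crd.ι K X ⊕ Crd.ι K V) × ℕ) C.k := fun l => ∏ l' ∈ Finset.univ.erase l, rename (fun q => (Sum.inr q.1, q.2)) (R l' l)
  have hσ : ∀ l x v, C.e (Sum.elim x v) (σ l) = ∏ l' ∈ Finset.univ.erase l, C.e v (R l' l) := fun l x v => by
    simp only [σ, map_prod]
    exact Finset.prod_congr rfl fun l' _ => ev_ren _ _ _ _ _
  have h1 : ∀ l l', l ≠ l' → ∀ᶠ s in p l, ∀ x, C.e (Sum.elim x (cc K (v s))) (σ l') = 0 := fun l l' h => by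
    filter_upwards [hR l l' h] with s hs x
    rw [hσ]; exact Finset.prod_eq_zero (Finset.mem_erase.mpr ⟨h, Finset.mem_univ _⟩) hs
  have h2 : ∀ l, ∀ᶠ s in p l, ∀ x, C.e (Sum.elim x (cc K (v s))) (σ l) ≠ 0 := fun l => by
    filter_upwards [(Filter.eventually_all_finset (Finset.univ.erase l)).mpr fun l' hl' => hR' l' l (Finset.ne_of_mem_erase hl')] with s hs x
    rw [hσ]; exact Finset.prod_ne_zero_iff.mpr hs
  have hj : ∀ j, DF C.str (fun p : X × V => F p.1 p.2 j) := fun j => by fun_prop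
  choose t ht using fun j => (hj j).rat
  choose G hG using fun P : MvPolynomial ((Crd.ι K X ⊕ Crd.ι K V) × ℕ) C.k => lin P
  refine ⟨Finset.univ.biUnion fun l => Finset.univ.biUnion fun j => (t j).biUnion fun q => G (σ l * q.2) ∪ G (σ l * q.1), fun x j => ?_⟩
  have hsub : ∀ l, ∀ q ∈ t j, G (σ l * q.2) ∪ G (σ l * q.1) ⊆ Finset.univ.biUnion fun l => Finset.univ.biUnion fun j => (t j).biUnion fun q => G (σ l * q.2) ∪ G (σ l * q.1) :=
    fun l q hq m hm => by
      simp only [Finset.mem_biUnion, Finset.mem_univ, true_and]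
      exact ⟨l, j, q, hq, hm⟩
  generalize (Finset.univ.biUnion fun l => Finset.univ.biUnion fun j => (t j).biUnion fun q => G (σ l * q.2) ∪ G (σ l * q.1)) = F0 at hsub
  have hq : ∀ l, ∃ q : MvPolynomial (Crd.ι K (X × V) × ℕ) C.k × MvPolynomial (Crd.ι K (X × V) × ℕ) C.k, q ∈ (t j : Set _) ∧ ∀ᶠ s in p l, C.e (cc K (x, v s)) q.2 ≠ 0 ∧ C.e (cc K (x, v s)) q.2 * F x (v s) j = C.e (cc K (x, v s)) q.1 := fun l => by
    rw [← Ultrafilter.eventually_exists_mem_iff (t j).finite_toSet]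
    exact .of_forall fun s => ht j (x, v s)
  choose q hq hq' using hq
  choose c hc using fun l => hG (σ l * (q l).2) F0 (Finset.union_subset_left (hsub l _ (hq l))) (cc K x)
  choose d hd using fun l => hG (σ l * (q l).1) F0 (Finset.union_subset_right (hsub l _ (hq l))) (cc K x)
  have e1 : ∀ s, ∑ m : F0, (∑ l, c l m) * bs C F0 (cc K (v s)) m = ∑ l, C.e (Sum.elim (cc K x) (cc K (v s))) (σ l) * C.e (cc K (x, v s)) (q l).2 := fun s => by
    simp only [Finset.sum_mul]
    rw [Finset.sum_comm]
    exact Finset.sum_congr rfl fun l _ => by rw [cprod, ← map_mul, hc]; rfl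
  have e2 : ∀ s, ∑ m : F0, (∑ l, d l m) * bs C F0 (cc K (v s)) m = ∑ l, C.e (Sum.elim (cc K x) (cc K (v s))) (σ l) * C.e (cc K (x, v s)) (q l).1 := fun s => by
    simp only [Finset.sum_mul]
    rw [Finset.sum_comm]
    exact Finset.sum_congr rfl fun l _ => by rw [cprod, ← map_mul, hd]; rfl
  have key : ∀ l, ∀ᶠ s in p l, ∑ m : F0, (∑ l, c l m) * bs C F0 (cc K (v s)) m ≠ 0 ∧
      (∑ m : F0, (∑ l, c l m) * bs C F0 (cc K (v s)) m) * F x (v s) j = ∑ m : F0, (∑ l, d l m) * bs C F0 (cc K (v s)) m := fun l => by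
    filter_upwards [h2 l, hq' l, (Filter.eventually_all_finset (Finset.univ.erase l)).mpr fun l' hl' => h1 l l' (Finset.ne_of_mem_erase hl').symm] with s h2 h3 h4
    have h4 : ∀ l' ∈ Finset.univ, l' ≠ l → C.e (Sum.elim (cc K x) (cc K (v s))) (σ l') = 0 := fun l' _ h => h4 l' (Finset.mem_erase.mpr ⟨h, Finset.mem_univ _⟩) _
    rw [e1, e2, Finset.sum_eq_single_of_mem l (Finset.mem_univ _) fun l' h h' => by rw [h4 l' h h', zero_mul],
      Finset.sum_eq_single_of_mem l (Finset.mem_univ _) fun l' h h' => by rw [h4 l' h h', zero_mul]]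
    exact ⟨mul_ne_zero (h2 _) h3.1, by rw [mul_assoc, h3.2]⟩
  refine eventually_iSup.mpr fun l => (key l).mono fun s hs => ⟨Sum.elim (fun m => ∑ l, c l m) (fun m => ∑ l, d l m), ?_, hs.1⟩
  refine eventually_iSup.mpr fun l => (key l).mono fun s hs => ?_
  rw [bb_sum]
  exact sub_eq_zero.mpr hs.2

end
end PG


namespace PG
open MvPolynomial Filter
open IntermediateField in
theorem td_mono {K L σ τ : Type} [Field K] [Field L] [Algebra K L] {u : σ → L} {v : τ → L} (h : ∀ j, v j ∈ adjoin K (Set.range u)) :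
    Algebra.trdeg K (adjoin K (Set.range v)) ≤ Algebra.trdeg K (adjoin K (Set.range u)) :=
  _root_.trdeg_le_of_injective (IntermediateField.inclusion (adjoin_le_iff.mpr (Set.range_subset_iff.mpr h))) (RingHom.injective _)

open IntermediateField in
theorem td_inj {K L L' σ : Type} [Field K] [Field L] [Algebra K L] [Field L'] [Algebra K L'] {f : σ → L} {h : σ → L'} (hfin : (Set.range h).Finite)
    (h1 : ∀ p, aeval (R := K) f p = 0 → aeval h p = 0)
    : Algebra.trdeg K (adjoin K (Set.range h)) ≤ Algebra.trdeg K (adjoin K (Set.range f)) ∧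
      (Algebra.trdeg K (adjoin K (Set.range f)) ≤ Algebra.trdeg K (adjoin K (Set.range h)) → ∀ p, aeval (R := K) h p = 0 → aeval f p = 0) := by
  classical
  let h' : σ → adjoin K (Set.range h) := fun i => ⟨h i, subset_adjoin _ _ ⟨i, rfl⟩⟩
  let f' : σ → adjoin K (Set.range f) := fun i => ⟨f i, subset_adjoin _ _ ⟨i, rfl⟩⟩
  have eh : ∀ p, ((aeval (R := K) h' p : adjoin K (Set.range h)) : L') = aeval h p := fun p => by
    have := MvPolynomial.aeval_algebraMap_apply (R := K) L' h' p
    exact this.symm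
  have ef : ∀ p, ((aeval (R := K) f' p : adjoin K (Set.range f)) : L) = aeval f p := fun p => by
    have := MvPolynomial.aeval_algebraMap_apply (R := K) L f' p
    exact this.symm
  have hs : adjoin K (Set.range h') = ⊤ := by
    apply IntermediateField.lift_injective
    rw [lift_adjoin, IntermediateField.lift_top]
    congr 1
    rw [← Set.range_comp]; rfl
  haveI : Algebra.IsAlgebraic (Algebra.adjoin K (Set.range h')) (adjoin K (Set.range h)) := by
    rw [← isAlgebraic_adjoin_iff_top, hs, Algebra.isAlgebraic_iff_isIntegral]
    exact Algebra.isIntegral_of_surjective topEquiv.surjective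
  obtain ⟨t, ht, hb⟩ := exists_isTranscendenceBasis_subset (R := K) (Set.range h')
  have hfin' : (Set.range h').Finite := by
    refine Set.Finite.of_finite_image (f := Subtype.val) (hfin.subset ?_) Subtype.val_injective.injOn
    rintro _ ⟨_, ⟨i, rfl⟩, rfl⟩; exact ⟨i, rfl⟩
  haveI : Finite t := (hfin'.subset ht).to_subtype
  choose g hg using fun x : t => ht x.2
  have hg' : h' ∘ g = Subtype.val := funext hg
  have key : ∀ a : MvPolynomial t K, aeval f (rename g a) = 0 → a = 0 := fun a ha => by
    have := h1 _ ha
    rw [← eh, aeval_rename, hg', ZeroMemClass.coe_eq_zero] at this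
    exact (algebraicIndependent_iff.mp hb.1) a this
  have hi : AlgebraicIndependent K (f' ∘ g) := algebraicIndependent_iff.mpr fun a ha => by
    rw [← aeval_rename] at ha
    exact key a (by rw [← ef, ha]; rfl)
  refine ⟨hb.cardinalMk_eq_trdeg ▸ hi.cardinalMk_le_trdeg, fun h2 p hp => ?_⟩
  have hb2 := hi.isTranscendenceBasis_of_trdeg_le_of_finite (by rw [hb.cardinalMk_eq_trdeg]; exact h2)
  have alg := hb2.isAlgebraic
  by_contra hne
  have hw : aeval (R := K) f' p ≠ 0 := fun h => hne (by rw [← ef, h]; rfl)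
  obtain ⟨q, hq0, hq⟩ := (alg.isAlgebraic (aeval f' p)).exists_nonzero_coeff_and_aeval_eq_zero (mem_nonZeroDivisors_of_ne_zero hw)
  have hc : ∀ i, ∃ c : MvPolynomial t K, aeval (f' ∘ g) c = (q.coeff i : adjoin K (Set.range f)) := fun i => by
    exact (Algebra.adjoin_range_eq_range_aeval K (f' ∘ g) ▸ (q.coeff i).2 : ((q.coeff i) : adjoin K (Set.range f)) ∈ (aeval (R := K) (f' ∘ g)).range)
  choose c hc using hc
  have e1 : aeval f (∑ i ∈ Finset.range (q.natDegree + 1), rename g (c i) * p ^ i) = 0 := by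
    rw [← ef, ← show (0 : adjoin K (Set.range f)).1 = 0 from rfl, ← hq, Polynomial.aeval_eq_sum_range]
    congr 1
    simp only [map_sum, map_mul, map_pow, aeval_rename, hc]
    rfl
  have e2 := h1 _ e1
  simp only [map_sum, map_mul, map_pow, hp] at e2
  rw [Finset.sum_eq_single_of_mem 0 (by simp) (fun i _ hi => by rw [zero_pow hi, mul_zero]), pow_zero, mul_one, ← eh, aeval_rename, hg', ZeroMemClass.coe_eq_zero] at e2
  have e3 : c 0 = 0 := (algebraicIndependent_iff.mp hb.1) _ e2
  have := hc 0
  rw [e3, map_zero] at this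
  exact hq0 (Subtype.ext this.symm)

section
variable {K : Type} [Field K] [CharZero K] (S : Stg K) {T T' ι κ : Type}

noncomputable def td (U : Ultrafilter T) (f : T → ι → K) : Cardinal :=
  letI : Algebra K (Germ (U : Filter T) K) := (gφ S.rK U).toAlgebra
  Algebra.trdeg K (IntermediateField.adjoin K (Set.range (nab (gD U S.rK.D) (gb U f))))

variable {S}

theorem nab0 (U : Ultrafilter T) (f : T → ι → K) (q : ι × ℕ) : nab (gD U S.rK.D) (gb U f) q = gb U f q.1 ∨ nab (gD U S.rK.D) (gb U f) q = 0 := by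
  obtain ⟨i, n⟩ := q
  cases n with
  | zero => exact .inl rfl
  | succ n =>
    right
    show (gD U S.rK.D)^[n+1] _ = 0
    rw [Function.iterate_succ_apply']
    generalize (gD U S.rK.D)^[n] _ = z
    induction z using Germ.inductionOn with | h z => rfl

theorem T2 [Finite ι] {U : Ultrafilter T} {f : T → ι → K} {V : Ultrafilter T'} {g : T' → ι → K} (h : ∀ p, (∀ᶠ s in U, S.rK.e (f s) p = 0) → ∀ᶠ s in V, S.rK.e (g s) p = 0)
    : td S V g ≤ td S U f ∧ (td S U f ≤ td S V g → ∀ p, (∀ᶠ s in V, S.rK.e (g s) p = 0) → ∀ᶠ s in U, S.rK.e (f s) p = 0) := by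
  letI : Algebra K (Germ (U : Filter T) K) := (gφ S.rK U).toAlgebra
  letI : Algebra K (Germ (V : Filter T') K) := (gφ S.rK V).toAlgebra
  simp only [← losz S.rK]
  refine td_inj (K := K) (h := nab (gD V S.rK.D) (gb V g)) ?_ (fun p hp => ?_)
  · refine ((Set.finite_range (gb V g)).union (Set.finite_singleton 0)).subset ?_
    rintro _ ⟨q, rfl⟩
    rcases nab0 V g q with h | h
    · exact .inl ⟨_, h.symm⟩
    · exact .inr h
  · exact (losz S.rK _ _ _).mpr (h p ((losz S.rK _ _ _).mp hp))

variable {α β : Type} [Crd K α] [Crd K β] [IsS S.rK.str α] [IsS S.rK.str β]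

theorem T1 {σ : α → β} (h : DF S.rK.str σ) (U : Ultrafilter T) (u : T → α) :
    td S U (fun s => cc K (σ (u s))) ≤ td S U (fun s => cc K (u s)) := by
  letI : Algebra K (Germ (U : Filter T) K) := (gφ S.rK U).toAlgebra
  refine td_mono fun q => ?_
  rcases nab0 U (fun s => cc K (σ (u s))) q with h0 | h0
  swap
  · rw [h0]; exact IntermediateField.zero_mem _
  rw [h0]
  obtain ⟨t, ht⟩ := DF.rat (C := S.rK) (f := fun a => cc K (σ a) q.1) (by fun_prop)
  obtain ⟨r, -, hr⟩ : ∃ r : MvPolynomial (Crd.ι K α × ℕ) S.rK.k × MvPolynomial (Crd.ι K α × ℕ) S.rK.k, r ∈ (t : Set _) ∧ ∀ᶠ s in U, S.rK.e (cc K (u s)) r.2 ≠ 0 ∧ S.rK.e (cc K (u s)) r.2 * cc K (σ (u s)) q.1 = S.rK.e (cc K (u s)) r.1 := by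
    rw [← Ultrafilter.eventually_exists_mem_iff t.finite_toSet]
    exact .of_forall fun s => ht (u s)
  have hm : ∀ p, ev (gφ S.rK U) (gD U S.rK.D) (gb U fun s => cc K (u s)) p ∈ IntermediateField.adjoin K (Set.range (nab (gD U S.rK.D) (gb U fun s => cc K (u s)))) := fun p =>
    IntermediateField.algebra_adjoin_le_adjoin _ _ (by rw [Algebra.adjoin_range_eq_range_aeval]; exact ⟨p, rfl⟩)
  have e1 : ev (gφ S.rK U) (gD U S.rK.D) (gb U fun s => cc K (u s)) r.2 ≠ 0 := fun h => by
    obtain ⟨s, hs, hs'⟩ := (((losz S.rK _ _ _).mp h).and hr).exists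
    exact hs'.1 hs
  have e2 := (losz S.rK U (fun s => Sum.elim (cc K (u s)) (fun _ : Unit => cc K (σ (u s)) q.1))
    (rename (fun q => (.inl q.1, q.2)) r.2 * X (.inr (), 0) - rename (fun q => (.inl q.1, q.2)) r.1)).mpr (hr.mono fun s hs => by
      simp only [Cx.e] at hs ⊢
      rw [map_sub, map_mul, ev_ren, ev_ren, ev_X]
      exact sub_eq_zero.mpr hs.2)
  rw [map_sub, map_mul, ev_ren, ev_ren, ev_X, sub_eq_zero] at e2
  have e3 : gb U (fun s => cc K (σ (u s))) q.1 = ev (gφ S.rK U) (gD U S.rK.D) (gb U fun s => cc K (u s)) r.1 / ev (gφ S.rK U) (gD U S.rK.D) (gb U fun s => cc K (u s)) r.2 :=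
    eq_div_of_mul_eq e1 ((mul_comm _ _).trans e2)
  rw [e3]
  exact IntermediateField.div_mem _ (hm _) (hm _)

theorem td_congr {U : Ultrafilter T} {f g : T → ι → K} (h : ∀ᶠ s in U, f s = g s) : td S U f = td S U g := by
  have : gb U f = gb U g := funext fun i => Germ.coe_eq.mpr (h.mono fun s hs => congrFun hs i)
  unfold td; rw [this]
end
end PG


namespace PG
open MvPolynomial Filter

section
variable {K : Type} [Field K] [CharZero K] {Γ : Type} [Group Γ] [Crd K Γ] {S : Stg K} {𝒟 : DStr K} {C : Cx K}
  {T V W α β : Type} [Crd K V] [Crd K α] [Crd K β]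

/-- filters definable over a structure -/
def FR (𝒟 : DStr K) (𝓕 : Filter T) (v : T → V) : Prop := ∀ {α : Type} [Crd K α] [IsS 𝒟 α] {ψ : α → V → Prop},
  DF 𝒟 (fun p : α × V => ψ p.1 p.2) → DF 𝒟 (fun a => ∀ᶠ s in 𝓕, ψ a (v s))

theorem FR.u4 [IsS C.str V] (hc : ∀ c : K, Cst C.str c) {I : Type} [Finite I] (p : I → Ultrafilter T) (v : T → V) : FR C.str (⨆ i, (p i : Filter T)) v := by
  intro α _ _ ψ h
  obtain ⟨M, _, W, h1, h2⟩ := PG.u4 (C := C) (I := I) (R := fun b a => ψ a b) (by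
    exact DF.comp (f := fun p : α × V => ψ p.1 p.2) h (g := fun p : V × α => (p.2, p.1)) (by fun_prop))
  obtain ⟨c, hc'⟩ := h2 p v
  simp only [hc']
  exact DF.comp (f := fun p : (M → K) × α => W p.1 p.2) h1 (g := fun a => (c, a)) (by fun_prop)

theorem FR.inf {𝒟' : DStr K} [IsS (𝒟.inf 𝒟') V] {𝓕 : Filter T} {v : T → V} (h : FR 𝒟 𝓕 v) (h' : FR 𝒟' 𝓕 v) : FR (𝒟.inf 𝒟') 𝓕 v := by
  intro α _ i ψ hψ
  haveI : IsS 𝒟 α := ⟨i.rng.1⟩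
  haveI : IsS 𝒟' α := ⟨i.rng.2⟩
  exact DF.inf.mpr ⟨h (DF.inf.mp hψ).1, h' (DF.inf.mp hψ).2⟩

theorem DF.cd {M J : Type} [Fintype M] [Finite J] [IsS 𝒟 V] [IsS 𝒟 α] {𝓕 : Filter T} {v : T → V} (hr : FR 𝒟 𝓕 v) {B : V → M → K} (hB : DF 𝒟 B)
    {φ : α → V → J → K} (h : DF 𝒟 (fun p : α × V => φ p.1 p.2)) : DF 𝒟 (fun a => cd 𝓕 (fun s => B (v s)) (fun s => φ a (v s))) := by
  refine DF.pi fun j => DF.code ?_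
  refine hr (ψ := fun (p : α × (M ⊕ M → K)) w => ∑ l, p.2 l * PG.bb (B w) (φ p.1 w j) l = 0) ?_
  have h1 : DF 𝒟 (fun p : (α × (M ⊕ M → K)) × V => φ p.1.1 p.2) :=
    DF.comp (f := fun p : α × V => φ p.1 p.2) h (g := fun p : (α × (M ⊕ M → K)) × V => (p.1.1, p.2)) (by fun_prop)
  fun_prop

theorem DF.agree [IsS C.str α] {X : α → Prop} (hX : DF C.str X) {T' : Type} (U : Ultrafilter T) (U' : Ultrafilter T') (f : T → α) (g : T' → α)
    (h : ∀ p, (∀ᶠ x in U, C.e (PG.cc K (f x)) p = 0) ↔ ∀ᶠ x in U', C.e (PG.cc K (g x)) p = 0) :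
    (∀ᶠ x in U, X (f x)) ↔ ∀ᶠ x in U', X (g x) := by
  have h1 := Con.agree (DF.iff_dp.mp hX : Con C _) U U' _ _ h
  have h2 : ∀ a, PG.cc K a ∈ {z | ∃ a, X a ∧ PG.cc K a = z} ↔ X a := fun a =>
    ⟨by rintro ⟨b, hb, h⟩; rwa [← cinj.mp h], fun h => ⟨a, h, rfl⟩⟩
  simpa only [h2] using h1

theorem sepv {ι : Type} (i : ι) (r : C.k) : ∃ R, ∀ v : ι → K, C.e v R = v i - C.φ r :=
  ⟨X (i, 0) - MvPolynomial.C r, fun v => by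
  simp only [Cx.e, map_sub, ev_X]
  simp [ev]⟩

theorem DF.flat {J M N : Type} [Finite J] [Finite M] [Finite N] [IsS 𝒟 α] {f : α → J → M → N → K} (h : DF 𝒟 f) :
    DF 𝒟 (fun a (q : J × (M × N)) => f a q.1 q.2.1 q.2.2) := by fun_prop

variable (g : Gn Γ S)

theorem Gn.inv [GO S.dk.str Γ] {X : Γ → Prop} (hX : DF S.dK.str X) (c e) (h : ∀ᶠ x in g.F, X x) : ∀ᶠ x in g.F, X (c * x * e) := by
  rw [g.evF] at h ⊢
  exact fun i => (g.ha c e i X hX).mpr (h _)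

theorem Gn.frK [GO S.dk.str Γ] : FR S.dK.str g.F (fun x => x) := FR.u4 (fun c => cdK c) g.P _

def Gn.pp (q : g.I × g.I) : Ultrafilter (Γ × Γ) := (g.P q.1).bind fun a => (g.P q.2).map fun b => (a, b)

theorem Gn.evP {q} {X : Γ × Γ → Prop} : (∀ᶠ s in g.pp q, X s) ↔ ∀ᶠ a in g.P q.1, ∀ᶠ b in g.P q.2, X (a, b) := Iff.rfl

def Gn.G : Filter (Γ × Γ) := ⨆ q, (g.pp q : Filter (Γ × Γ))

theorem Gn.evG {X : Γ × Γ → Prop} : (∀ᶠ s in g.G, X s) ↔ ∀ᶠ a in g.F, ∀ᶠ b in g.F, X (a, b) := by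
  unfold Gn.G
  simp only [eventually_iSup, g.evF, g.evP, eventually_all, Prod.forall]

theorem Gn.frG [GO S.dk.str Γ] : FR S.dk.str g.G (fun x => x) := by
  intro α _ _ ψ h
  simp only [g.evG]
  refine g.d3 (Y := fun v a => ∀ᶠ b in g.F, ψ v (a, b)) (g.d3 (Y := fun (v : α × Γ) b => ψ v.1 (v.2, b)) ?_)
  exact DF.comp (f := fun p : α × (Γ × Γ) => ψ p.1 p.2) h (g := fun p : (α × Γ) × Γ => (p.1.1, (p.1.2, p.2))) (by fun_prop)

theorem Gn.invG [GO S.dk.str Γ] {X : Γ × Γ → Prop} (hX : DF S.dK.str X) (c e) (h : ∀ᶠ x in g.G, X x) : ∀ᶠ x in g.G, X (x.1 * c, e * x.2) := by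
  rw [g.evG] at h ⊢
  have h1 := g.inv (X := fun a => ∀ᶠ b in g.F, X (a, b)) (g.frK (ψ := fun a b => X (a, b)) (by fun_prop)) 1 c h
  refine h1.mono fun a ha => ?_
  have := g.inv (X := fun b => X (1 * a * c, b)) (by fun_prop) e 1 ha
  simpa using this

instance [Nonempty Γ] : NeBot g.F := by
  obtain ⟨i⟩ := g.ne
  exact NeBot.mono (g.P i).neBot (le_iSup (fun i => (g.P i : Filter Γ)) i)

theorem Gn.ainj [GO S.dk.str Γ] (c e i j) (h : g.a c e i = g.a c e j) : i = j := g.sep _ _ fun X hX => by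
  have h1 := g.ha c e i (fun z => X (c⁻¹ * z * e⁻¹)) (by fun_prop)
  rw [h, ← g.ha c e j (fun z => X (c⁻¹ * z * e⁻¹)) (by fun_prop)] at h1
  simpa [mul_assoc] using h1

/-- generic data in affine space -/
structure Yd where
  N : Type
  fN : Finite N
  y : Γ → N → K
  L : Γ → Γ → (N → K) → N → K
  Q : Type
  fQ : Finite Q
  H : (Q → K) → (N → K) → N → K
  dy : DF S.dk.str y
  dL : DF S.dk.str (fun p : (Γ × Γ) × (N → K) => L p.1.1 p.1.2 p.2)
  dH : DF S.rK.str (fun p : (Q → K) × (N → K) => H p.1 p.2)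
  hH : ∀ c e, ∃ κ, ∀ v, L c e v = H κ v
  ly : ∀ c e x, L c e (y x) = y (c * x * e)
  inj : Function.Injective y
  dis : ∀ l l', (∀ R, (∀ᶠ x in g.P l, S.rK.e (cc K (y x)) R = 0) ↔ ∀ᶠ x in g.P l', S.rK.e (cc K (y x)) R = 0) → l = l'

attribute [instance] Yd.fN Yd.fQ

theorem exYd [GO S.dk.str Γ] : Nonempty (Yd g) := by
  classical
  obtain ⟨J, _, ec, hec, ei, es⟩ := exEc g
  have hecK := hec.up
  have hS : DF S.dk.str S.D := Cx.der S.dk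
  obtain ⟨F0, hF0⟩ := goodlem (C := S.dK) (X := Γ) (V := (J → K) × (J → K)) (J := J)
    (F := fun x v => dd fun t : J → K => ∃ a b, ec a = v.1 ∧ ec b = v.2 ∧ t = ec (a * x * b)) (by fun_prop) g.pp
    (fun s => (ec s.1, ec s.2)) (fun l l' h => by
      have h : l.1 ≠ l'.1 ∨ l.2 ≠ l'.2 := by
        by_contra hn; push Not at hn; exact h (Prod.ext hn.1 hn.2)
      rcases h with h | h
      · obtain ⟨i, r, r', hr, h1, h2⟩ := es _ _ h
        obtain ⟨R, hR⟩ := sepv (C := S.dK) (Sum.inl (i, ()) : Crd.ι K ((J → K) × (J → K))) r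
        refine ⟨R, g.evP.mpr ?_, g.evP.mpr ?_⟩
        · filter_upwards [h1] with a ha
          refine .of_forall fun b => ?_
          rw [hR]; exact sub_eq_zero.mpr ha
        · filter_upwards [h2] with a ha
          refine .of_forall fun b => ?_
          rw [hR]; exact fun h => hr ((sub_eq_zero.mp h).symm.trans ha)
      · obtain ⟨i, r, r', hr, h1, h2⟩ := es _ _ h
        obtain ⟨R, hR⟩ := sepv (C := S.dK) (Sum.inr (i, ()) : Crd.ι K ((J → K) × (J → K))) r
        refine ⟨R, g.evP.mpr ?_, g.evP.mpr ?_⟩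
        · refine .of_forall fun b => ?_
          filter_upwards [h1] with a ha
          rw [hR]; exact sub_eq_zero.mpr ha
        · refine .of_forall fun b => ?_
          filter_upwards [h2] with a ha
          rw [hR]; exact fun h => hr ((sub_eq_zero.mp h).symm.trans ha))
  have hdd : ∀ x (s : Γ × Γ), (dd fun t : J → K => ∃ a b, ec a = ec s.1 ∧ ec b = ec s.2 ∧ t = ec (a * x * b)) = ec (s.1 * x * s.2) := fun x s =>
    dd_eq ⟨_, _, rfl, rfl, rfl⟩ (by rintro t ⟨a, b, ha, hb, rfl⟩; rw [ei ha, ei hb])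
  simp only [hdd] at hF0
  obtain ⟨Bp, hBp⟩ : ∃ Bp : Γ × Γ → F0 → K, Bp = fun s => bs S.dK F0 (cc K (ec s.1, ec s.2)) := ⟨_, rfl⟩
  have dB : DF S.dk.str Bp := by
    rw [hBp]
    refine DF.pi fun m => DF.mon hS (fun i => ?_) _
    have : DF S.dk.str (fun s : Γ × Γ => (ec s.1, ec s.2)) := by fun_prop
    fun_prop
  have dBK := dB.up
  rw [← hBp] at hF0
  have EV := fun x => (hF0 x).ev
  clear hF0 hBp hdd
  let y : Γ → Cd K F0 J := fun x => cd g.G Bp fun s => ec (s.1 * x * s.2)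
  let Λ : Γ → Γ → Cd K F0 J → Cd K F0 J := fun c e v => cd g.G Bp fun s => evc v (Bp (s.1 * c, e * s.2))
  have dy : DF S.dk.str y := DF.cd (φ := fun x (s : Γ × Γ) => ec (s.1 * x * s.2)) g.frG dB (by fun_prop)
  have dΛ : DF S.dk.str (fun p : (Γ × Γ) × Cd K F0 J => Λ p.1.1 p.1.2 p.2) :=
    DF.cd (φ := fun (p : (Γ × Γ) × Cd K F0 J) (s : Γ × Γ) => evc p.2 (Bp (s.1 * p.1.1, p.1.2 * s.2))) g.frG dB (by fun_prop)
  have ly : ∀ c e x, Λ c e (y x) = y (c * x * e) := fun c e x => by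
    refine cd_congr ?_
    refine (g.invG (X := fun s => evc (y x) (Bp s) = ec (s.1 * x * s.2)) (by fun_prop) c e (EV x)).mono fun s hs => ?_
    rw [hs]; simp only [mul_assoc]
  choose M hM W hW hW' using fun j => u4 (C := S.rK) (I := g.I × g.I) (β := (F0 → K) × (F0 → K)) (α := Cd K F0 J × (F0 ⊕ F0 → K))
    (R := fun b v => ∑ l, v.2 l * bb b.1 (evc v.1 b.2 j) l = 0) (by fun_prop)
  let H : ((Σ j, M j) → K) → Cd K F0 J → Cd K F0 J := fun κ v j => code fun c => W j (fun m => κ ⟨j, m⟩) (v, c)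
  have dH : DF S.rK.str (fun p : ((Σ j, M j) → K) × Cd K F0 J => H p.1 p.2) := by
    refine DF.pi fun j => DF.code ?_
    exact DF.comp (f := fun p : (M j → K) × (Cd K F0 J × (F0 ⊕ F0 → K)) => W j p.1 p.2) (hW j)
      (g := fun p : (((Σ j, M j) → K) × Cd K F0 J) × (F0 ⊕ F0 → K) => ((fun m => p.1.1 ⟨j, m⟩), (p.1.2, p.2))) (by fun_prop)
  have hH : ∀ c e, ∃ κ, ∀ v, Λ c e v = H κ v := fun c e => by
    choose κ hκ using fun j => hW' j g.pp (fun s => (Bp s, Bp (s.1 * c, e * s.2)))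
    refine ⟨fun q => κ q.1 q.2, fun v => funext fun j => ?_⟩
    simp only [H, ← hκ]
    rfl
  obtain ⟨i0⟩ := g.ne
  refine ⟨⟨J × ((F0 ⊕ F0) × (F0 ⊕ F0)), inferInstance, fun x q => y x q.1 q.2.1 q.2.2, fun c e v q => Λ c e (fun j m n => v (j, (m, n))) q.1 q.2.1 q.2.2,
    Σ j, M j, inferInstance, fun κ v q => H κ (fun j m n => v (j, (m, n))) q.1 q.2.1 q.2.2, by fun_prop, ?_, ?_, fun c e => ?_, fun c e x => ?_, fun x x' h => ?_, fun l l' h => ?_⟩⟩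
  · refine DF.flat (DF.comp (f := fun p : (Γ × Γ) × Cd K F0 J => Λ p.1.1 p.1.2 p.2) dΛ
      (g := fun p : (Γ × Γ) × (J × ((F0 ⊕ F0) × (F0 ⊕ F0)) → K) => (p.1, fun j m n => p.2 (j, (m, n)))) (by fun_prop))
  · refine DF.flat (DF.comp (f := fun p : ((Σ j, M j) → K) × Cd K F0 J => H p.1 p.2) dH
      (g := fun p : ((Σ j, M j) → K) × (J × ((F0 ⊕ F0) × (F0 ⊕ F0)) → K) => (p.1, fun j m n => p.2 (j, (m, n)))) (by fun_prop))
  · obtain ⟨κ, hκ⟩ := hH c e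
    exact ⟨κ, fun v => by simp only [hκ]⟩
  · simp only [← ly]
  · have h : y x = y x' := by ext j m n; exact congrFun h (j, (m, n))
    have h1 := eventually_iSup.mp ((EV x).and (EV x')) (i0, i0)
    obtain ⟨s, hs, hs'⟩ := h1.exists
    have := hs.symm.trans ((congrArg (fun v => evc v (Bp s)) h).trans hs')
    exact mul_left_cancel (mul_right_cancel (ei this))
  · by_contra hne
    have hc : ∀ l, ∀ᶠ s in g.pp (i0, i0), ∀ᶠ x in g.P l, evc (y x) (Bp s) = ec (s.1 * x * s.2) := fun l => by
      have dyK := dy.up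
      have := comm (C := S.dK) (W := fun (x : Γ) (s : Γ × Γ) => evc (y x) (Bp s) = ec (s.1 * x * s.2)) (by fun_prop) (g.P l) (g.pp (i0, i0)) (fun a => a) (fun b => b)
      exact this.mp (.of_forall fun x => eventually_iSup.mp (EV x) _)
    obtain ⟨s, h1, h2⟩ := ((hc l).and (hc l')).exists
    obtain ⟨i, r, r', hr, h3, h4⟩ := es _ _ (fun e => hne (g.ainj s.1 s.2 l l' e))
    have h3 := (g.ha s.1 s.2 l (fun x => ec x i = r) (by fun_prop)).mpr h3
    have h4 := (g.ha s.1 s.2 l' (fun x => ec x i = r') (by fun_prop)).mpr h4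
    have hA := DF.agree (C := S.rK) (α := J × ((F0 ⊕ F0) × (F0 ⊕ F0)) → K) (X := fun v => evc (fun j m n => v (j, (m, n))) (Bp s) i = r) (by
      haveI : Cst S.rK.str (Bp s) := inferInstanceAs (Cst S.rK.str fun m => Bp s m)
      fun_prop) (g.P l) (g.P l') _ _ h
    have h5 := hA.mp ((h1.and h3).mono fun x hx => by rw [← hx.2, ← hx.1])
    obtain ⟨x, hx⟩ := (h5.and (h2.and h4)).exists
    exact hr (hx.1.symm.trans ((congrFun hx.2.1 i).trans hx.2.2))

end
end PG


namespace PG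
open MvPolynomial Filter

section
variable {K : Type} [Field K] [CharZero K] {Γ : Type} [Group Γ] [Crd K Γ] {S : Stg K} {𝒟 : DStr K} {g : Gn Γ S} (Y : Yd g)
  {α : Type} [Crd K α]

theorem DF.bsr [IsS 𝒟 α] {ι : Type} {F : Finset (ι × ℕ →₀ ℕ)} {f : α → ι → K} (h : ∀ i, DF 𝒟 (fun a => f a i)) : DF 𝒟 (fun a => bs S.rK F (f a)) :=
  DF.pi fun m => DF.mon (D := S.rK.D) (DF.const (0 : K)) h _

theorem DF.rup {β : Type} [Crd K β] {f : α → β} (h : DF S.rK.str f) : DF S.dK.str f := DF.mono' rK_dK h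

theorem red {ι : Type} (p : MvPolynomial (ι × ℕ) S.rK.k) : ∃ p0 : MvPolynomial ι K, ∀ x, S.rK.e x p = eval x p0 := by
  induction p using MvPolynomial.induction_on with
  | C a => exact ⟨MvPolynomial.C a, fun x => by
      simp only [ev, coe_eval₂Hom, eval₂_C]
      exact (eval_C (σ := ι) (f := x) (a : K)).symm⟩
  | add p q hp hq =>
    obtain ⟨p0, hp⟩ := hp
    obtain ⟨q0, hq⟩ := hq
    exact ⟨p0 + q0, fun x => by simp only [map_add, hp, hq]⟩
  | mul_X p i hp =>
    obtain ⟨p0, hp⟩ := hp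
    obtain ⟨i, n⟩ := i
    cases n with
    | zero => exact ⟨p0 * X i, fun x => by simp only [map_mul, hp, eval_X, Cx.e, ev_X]⟩
    | succ n =>
      refine ⟨0, fun x => ?_⟩
      rw [map_mul, map_zero]
      have : S.rK.e x (X (i, n + 1)) = 0 := by
        simp only [ev, nab, coe_eval₂Hom, eval₂_X, Function.iterate_succ_apply']
        rfl
      rw [this, mul_zero]

theorem red' {ι : Type} (p : MvPolynomial ι K) : ∃ p1 : MvPolynomial (ι × ℕ) S.rK.k, ∀ x, S.rK.e x p1 = eval x p :=
  ⟨(rename (fun i => (i, 0)) p : MvPolynomial (ι × ℕ) K), fun x => (eval₂_rename (RingHom.id K) (fun i => (i, 0)) (nab S.rK.D x) p).trans (eval₂_id p)⟩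

variable [GO S.dk.str Γ]

theorem Yd.dl (c e) : DF S.rK.str (Y.L c e) := by
  obtain ⟨κ, hκ⟩ := Y.hH c e
  haveI : Cst S.rK.str κ := inferInstanceAs (Cst S.rK.str fun m => κ m)
  rw [funext hκ]
  exact DF.comp (f := fun p : (Y.Q → K) × (Y.N → K) => Y.H p.1 p.2) Y.dH (g := fun w => (κ, w)) (by fun_prop)

theorem Yd.tle (l l') : td S (g.P l) (fun z => cc K (Y.y z)) ≤ td S (g.P l') (fun z => cc K (Y.y z)) := by
  obtain ⟨c, e, hce⟩ := g.orb l' l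
  have h1 := T1 (Y.dl c e) (g.P l') Y.y
  refine le_trans (T2 fun p hp => ?_).1 h1
  simp only [Y.ly] at hp
  rw [g.ha c e l' (fun z => S.rK.e (cc K (Y.y z)) p = 0), hce] at hp
  · exact hp
  · have h2 : DF S.dK.str (fun w : Y.N → K => S.rK.e (cc K w) p = 0) := by
      have : DF S.rK.str (fun w : Y.N → K => S.rK.e (cc K w) p) := by
        refine DF.ev (C := S.rK) inferInstance (Cx.der S.rK) p ?_
        fun_prop
      exact DF.rup (by fun_prop)
    exact DF.comp (f := fun w : Y.N → K => S.rK.e (cc K w) p = 0) h2 Y.dy.up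

theorem Yd.sep (l l') (h : l ≠ l') : ∃ R, (∀ᶠ x in g.P l, S.rK.e (cc K (Y.y x)) R = 0) ∧ ∀ᶠ x in g.P l', S.rK.e (cc K (Y.y x)) R ≠ 0 := by
  by_contra hn
  push Not at hn
  have h1 : ∀ R, (∀ᶠ x in g.P l, S.rK.e (cc K (Y.y x)) R = 0) → ∀ᶠ x in g.P l', S.rK.e (cc K (Y.y x)) R = 0 := fun R hR => hn R hR
  exact h (Y.dis l l' fun R => ⟨h1 R, (T2 h1).2 (Y.tle l l') R⟩)

def Yd.Cm (σ : (Y.N → K) → Y.N → K) : Prop := ∀ᶠ e in g.F, ∀ᶠ z in g.F, σ (Y.y (z * e)) = Y.L 1 e (σ (Y.y z))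

structure Yd.A (σ : (Y.N → K) → Y.N → K) : Prop where
  d : DF S.rK.str σ
  l : ∀ X, DF S.rK.str X → (∀ᶠ z in g.F, X (Y.y z)) → ∀ᶠ z in g.F, X (σ (Y.y z))
  c : Y.Cm σ

variable {Y} {σ τ : (Y.N → K) → Y.N → K}

theorem Yd.A.comp (h : Y.A σ) (h' : Y.A τ) : Y.A (fun w => σ (τ w)) := by
  have hd := h.d
  have hd' := h'.d
  refine ⟨by fun_prop, fun X hX hz => h'.l (fun w => X (σ w)) (by fun_prop) (h.l X hX hz), ?_⟩
  filter_upwards [h.c, h'.c] with e h1 h2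
  have hl := Y.dl 1 e
  have h3 := h'.l (fun w => σ (Y.L 1 e w) = Y.L 1 e (σ w)) (by fun_prop) (h1.mono fun z hz => by rw [Y.ly, one_mul, hz])
  filter_upwards [h2, h3] with z h4 h5
  rw [h4, h5]

theorem Yd.A.congr (h : Y.A σ) (hd : DF S.rK.str τ) (he : ∀ᶠ z in g.F, σ (Y.y z) = τ (Y.y z)) : Y.A τ := by
  refine ⟨hd, fun X hX hz => ((h.l X hX hz).and he).mono fun z hz => hz.2 ▸ hz.1, ?_⟩
  filter_upwards [h.c] with e h1
  have d1 := hd.rup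
  have d2 := h.d.rup
  have d3 := Y.dy.up
  have h2 := g.inv (X := fun z => σ (Y.y z) = τ (Y.y z)) (by fun_prop) 1 e he
  filter_upwards [h1, h2, he] with z h3 h4 h5
  rw [one_mul] at h4
  rw [← h4, h3, h5]

theorem Yd.ax (x) : Y.A (Y.L x 1) := by
  refine ⟨Y.dl x 1, fun X hX hz => ?_, .of_forall fun e => .of_forall fun z => by simp [Y.ly, mul_assoc]⟩
  have d3 := Y.dy.up
  have d4 := hX.rup
  simp only [Y.ly]
  exact g.inv (X := fun z => X (Y.y z)) (by fun_prop) x 1 hz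

theorem Yd.deg : ∃ F3 : Finset (Crd.ι K (Y.N → K) × ℕ →₀ ℕ), ∀ σ, Y.A σ → good g.F (fun z => bs S.rK F3 (cc K (Y.y z))) (fun z => σ (Y.y z)) := by
  obtain ⟨F2, h2⟩ := goodlem (C := S.rK) Y.dH g.P Y.y Y.sep
  have dH := Y.dH
  obtain ⟨F3, h3⟩ := goodlem (C := S.rK) (X := Cd K F2 Y.N × (Y.Q → K)) (V := Y.N → K) (J := Y.N) (F := fun q w => evc q.1 (bs S.rK F2 (cc K (Y.H q.2 w)))) (by
    have h1 : DF S.rK.str (fun p : (Cd K F2 Y.N × (Y.Q → K)) × (Y.N → K) => Y.H p.1.2 p.2) :=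
      DF.comp (f := fun p : (Y.Q → K) × (Y.N → K) => Y.H p.1 p.2) Y.dH (g := fun p : (Cd K F2 Y.N × (Y.Q → K)) × (Y.N → K) => (p.1.2, p.2)) (by fun_prop)
    have h2 : DF S.rK.str (fun p : (Cd K F2 Y.N × (Y.Q → K)) × (Y.N → K) => bs S.rK F2 (cc K (Y.H p.1.2 p.2))) := DF.bsr (S := S) fun i => by fun_prop
    fun_prop) g.P Y.y Y.sep
  refine ⟨F3, fun σ h => ?_⟩
  choose κ hκ using Y.hH
  have dG : DF S.rK.str (fun u => good g.F (fun z => bs S.rK F2 (cc K (Y.y z))) (fun e => Y.L 1 e u)) := by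
    have fr : FR S.rK.str g.F (fun e => (Y.y e, κ 1 e)) := FR.u4 (C := S.rK) (V := (Y.N → K) × (Y.Q → K)) (fun c => crK c) g.P _
    refine DF.alf fun j => ?_
    simp only [hκ]
    have hb : ∀ {β : Type} [Crd K β] [IsS S.rK.str β] {f : β → (Y.N → K)}, DF S.rK.str f → DF S.rK.str (fun p => bs S.rK F2 (cc K (f p))) := fun hf => DF.bsr (S := S) fun i => by fun_prop
    have hh : ∀ {β : Type} [Crd K β] [IsS S.rK.str β] {f : β → (Y.N → K)} {q : β → (Y.Q → K)}, DF S.rK.str f → DF S.rK.str q → DF S.rK.str (fun p => Y.H (q p) (f p)) :=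
      fun hf hq => DF.comp (f := fun p : (Y.Q → K) × (Y.N → K) => Y.H p.1 p.2) Y.dH (hq.mk hf)
    refine fr (ψ := fun u v => ∃ c ∈ relS g.F (fun s => bb (bs S.rK F2 (cc K (Y.y s))) (Y.H (κ 1 s) u j)), ∑ m, c (.inl m) * bs S.rK F2 (cc K v.1) m ≠ 0) ?_
    refine DF.ex (P := fun (p : (Y.N → K) × ((Y.N → K) × (Y.Q → K))) c => c ∈ relS g.F (fun s => bb (bs S.rK F2 (cc K (Y.y s))) (Y.H (κ 1 s) p.1 j)) ∧ ∑ m, c (.inl m) * bs S.rK F2 (cc K p.2.1) m ≠ 0) ?_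
    refine DF.and ?_ ?_
    · refine fr (ψ := fun (p : ((Y.N → K) × ((Y.N → K) × (Y.Q → K))) × (F2 ⊕ F2 → K)) v => ∑ m, p.2 m * bb (bs S.rK F2 (cc K v.1)) (Y.H v.2 p.1.1 j) m = 0) ?_
      have h1 : DF S.rK.str fun p : (((Y.N → K) × ((Y.N → K) × (Y.Q → K))) × (F2 ⊕ F2 → K)) × ((Y.N → K) × (Y.Q → K)) => bs S.rK F2 (cc K p.2.1) := hb (by fun_prop)
      have h2 : DF S.rK.str fun p : (((Y.N → K) × ((Y.N → K) × (Y.Q → K))) × (F2 ⊕ F2 → K)) × ((Y.N → K) × (Y.Q → K)) => Y.H p.2.2 p.1.1.1 := hh (by fun_prop) (by fun_prop)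
      fun_prop
    · have h1 : DF S.rK.str fun p : ((Y.N → K) × ((Y.N → K) × (Y.Q → K))) × (F2 ⊕ F2 → K) => bs S.rK F2 (cc K p.1.2.1) := hb (by fun_prop)
      fun_prop
  have hG := h.l _ dG (.of_forall fun x => by
    simp only [Y.ly, one_mul]
    refine (h2 (κ x 1)).congr (.of_forall fun e => ?_)
    rw [← hκ, Y.ly, mul_one])
  obtain ⟨i0⟩ := g.ne
  have d1 := h.d.rup
  have d2 := Y.dy.up
  have d3 := Y.dL.up
  have hc : ∀ᶠ x in g.P i0, ∀ j, ∀ᶠ e in g.P j, σ (Y.y (x * e)) = Y.L 1 e (σ (Y.y x)) := eventually_all.mpr fun j => by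
    refine (comm (C := S.dK) (W := fun x e : Γ => σ (Y.y (x * e)) = Y.L 1 e (σ (Y.y x))) ?_ (g.P i0) (g.P j) (fun a => a) (fun b => b)).mpr ?_
    · have := DF.comp (f := fun p : (Γ × Γ) × (Y.N → K) => Y.L p.1.1 p.1.2 p.2) d3 (g := fun p : Γ × Γ => ((1, p.2), σ (Y.y p.1))) (by fun_prop)
      fun_prop
    · exact (g.evF.mp h.c j).mono fun e he => g.evF.mp he i0
  obtain ⟨x, hx, hx'⟩ := (hc.and (g.evF.mp hG i0)).exists
  have hx := g.evF.mpr hx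
  have h5 := (hx'.congr (hx.mono fun z hz => hz.symm)).ev
  obtain ⟨κ1, hκ1⟩ : ∃ κ1 : Cd K F2 Y.N, ∀ᶠ s in g.F, evc κ1 (bs S.rK F2 (cc K (Y.y s))) = σ (Y.y (x * s)) := ⟨_, h5⟩
  have h6 := g.inv (X := fun s => evc κ1 (bs S.rK F2 (cc K (Y.y s))) = σ (Y.y (x * s))) (by
    have : DF S.dK.str (fun s : Γ => bs S.rK F2 (cc K (Y.y s))) := DF.bsr (S := S) fun i => by fun_prop
    fun_prop) x⁻¹ 1 hκ1
  refine (h3 (κ1, κ x⁻¹ 1)).congr (h6.mono fun z hz => ?_)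
  rw [← hκ, Y.ly, hz, mul_one, mul_inv_cancel_left]

end
end PG


namespace PG
open MvPolynomial Filter

section
variable {K : Type} [Field K] [CharZero K] {Γ : Type} [Group Γ] [Crd K Γ] {S : Stg K} {𝒟 : DStr K} {g : Gn Γ S} (Y : Yd g)
  {α T T' ι : Type} [Crd K α]

def vI (𝓕 : Filter T) (f : T → ι → K) : Ideal (MvPolynomial ι K) where
  carrier := {p | ∀ᶠ z in 𝓕, eval (f z) p = 0}
  add_mem' h h' := (h.and h').mono fun z hz => by simp [hz.1, hz.2]
  zero_mem' := .of_forall fun z => map_zero _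
  smul_mem' c p h := h.mono fun z hz => by simp [hz]

theorem vfin [Finite ι] (S : Stg K) (𝓕 : Filter T) (f : T → ι → K) : ∃ F : Finset (ι × ℕ →₀ ℕ), ∀ {T' : Type} (𝓕' : Filter T') (f' : T' → ι → K),
    (∀ R : F → K, (∀ᶠ z in 𝓕, ∑ m, R m * bs S.rK F (f z) m = 0) → ∀ᶠ z in 𝓕', ∑ m, R m * bs S.rK F (f' z) m = 0) → vI 𝓕 f ≤ vI 𝓕' f' := by
  classical
  obtain ⟨t, ht⟩ := (isNoetherianRing_iff_ideal_fg (MvPolynomial ι K)).mp inferInstance (vI 𝓕 f)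
  choose p1 hp1 using fun p : MvPolynomial ι K => red' (S := S) p
  refine ⟨t.biUnion fun p => (p1 p).support, fun 𝓕' f' h => ?_⟩
  have key : ∀ p ∈ t, ∀ x, eval x p = ∑ m : (t.biUnion fun p => (p1 p).support), S.rK.φ ((p1 p).coeff m) * bs S.rK _ x m := fun p hp x => by
    rw [← hp1, monB_e]
    refine Eq.trans ?_ (Finset.sum_coe_sort (t.biUnion fun p => (p1 p).support) (fun m => S.rK.φ ((p1 p).coeff m) * monB S.rK.D x m)).symm
    refine Finset.sum_subset (fun m hm => Finset.mem_biUnion.mpr ⟨p, hp, hm⟩) fun m _ hm => ?_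
    rw [notMem_support_iff.mp hm, map_zero, zero_mul]
  rw [← ht, Ideal.span_le]
  intro p hp
  have h1 : p ∈ vI 𝓕 f := ht ▸ Ideal.subset_span hp
  refine (h (fun m => S.rK.φ ((p1 p).coeff m)) (h1.mono fun z hz => ?_)).mono fun z hz => ?_
  · rw [← hz]; exact (key p hp _).symm
  · exact (key p hp _).trans hz

variable [GO S.dk.str Γ]

theorem Yd.wl {σ σ' : (Y.N → K) → Y.N → K} (hd : DF S.rK.str σ) (hd' : DF S.rK.str σ') (hi : ∀ᶠ z in g.F, σ' (σ (Y.y z)) = Y.y z)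
    (hw : vI g.F (fun z => cc K (Y.y z)) ≤ vI g.F (fun z => cc K (σ (Y.y z)))) X (hX : DF S.rK.str X) (h : ∀ᶠ z in g.F, X (Y.y z)) : ∀ᶠ z in g.F, X (σ (Y.y z)) := by
  classical
  rw [g.evF] at h hi ⊢
  intro l
  haveI := Fintype.ofFinite g.I
  obtain ⟨m, hm⟩ : ∃ m, ∀ p, (∀ᶠ z in g.P m, S.rK.e (cc K (Y.y z)) p = 0) → ∀ᶠ z in g.P l, S.rK.e (cc K (σ (Y.y z))) p = 0 := by
    by_contra hn
    push Not at hn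
    choose p h1 h2 using hn
    choose p0 hp0 using fun m => red (p m)
    have h3 : (∏ m, p0 m) ∈ vI g.F (fun z => cc K (Y.y z)) := by
      refine g.evF.mpr fun m => (h1 m).mono fun z hz => ?_
      rw [hp0] at hz
      rw [map_prod]; exact Finset.prod_eq_zero (Finset.mem_univ m) hz
    obtain ⟨z, hz, hz'⟩ := ((g.evF.mp (hw h3) l).and (eventually_all.mpr h2)).exists
    rw [map_prod, Finset.prod_eq_zero_iff] at hz
    obtain ⟨m, -, hm⟩ := hz
    exact hz' m ((hp0 m _).trans hm)
  refine (DF.agree hX (g.P m) (g.P l) Y.y (fun z => σ (Y.y z)) fun p => ⟨hm p, (T2 hm).2 ?_ p⟩).mp (h m)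
  refine (Y.tle m l).trans (le_trans (le_of_eq ?_) (T1 hd' (g.P l) fun z => σ (Y.y z)))
  exact td_congr ((hi l).mono fun z hz => by simp only [hz])

variable {Y} {F : Finset (Crd.ι K (Y.N → K) × ℕ →₀ ℕ)} {σ τ : (Y.N → K) → Y.N → K}

variable (Y) in
noncomputable def Yd.sg (κ : Cd K F Y.N) (w : Y.N → K) : Y.N → K := evc κ (bs S.rK F (cc K w))

variable (F) in
noncomputable def Yd.cds (σ : (Y.N → K) → Y.N → K) : Cd K F Y.N := cd g.F (fun z => bs S.rK F (cc K (Y.y z))) (fun z => σ (Y.y z))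

@[fun_prop] theorem DF.sg [IsS 𝒟 α] {f : α → Cd K F Y.N} {w : α → Y.N → K} (hf : DF 𝒟 f) (hw : DF 𝒟 w) : DF 𝒟 (fun a => Y.sg (f a) (w a)) := by
  have : DF 𝒟 fun a => bs S.rK F (PG.cc K (w a)) := DF.bsr (S := S) fun i => by fun_prop
  unfold Yd.sg; fun_prop

theorem dsg (κ : Cd K F Y.N) : DF S.rK.str (Y.sg κ) := by
  haveI : Cst S.rK.str κ := inferInstanceAs (Cst S.rK.str fun a b c => κ a b c)
  exact DF.sg (Y := Y) (DF.const κ) DF.id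

theorem cds_congr (h : ∀ᶠ z in g.F, σ (Y.y z) = τ (Y.y z)) : Yd.cds F σ = Yd.cds F τ := cd_congr h

theorem frk : FR S.dk.str g.F (fun z => z) := fun h => g.d3 h

theorem fry : FR S.st g.F Y.y := FR.inf (FR.u4 (C := S.rK) (fun c => crK c) g.P Y.y) fun {α _ _ ψ} h => by
  have := Y.dy
  exact g.d3 (Y := fun a z => ψ a (Y.y z)) (DF.comp (f := fun p : α × (Y.N → K) => ψ p.1 p.2) h (g := fun p : α × Γ => (p.1, Y.y p.2)) (by fun_prop))

theorem DF.cds [IsS S.st α] {φ : α → (Y.N → K) → Y.N → K} (h : DF S.st (fun p : α × (Y.N → K) => φ p.1 p.2)) : DF S.st (fun a => Yd.cds F (φ a)) :=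
  DF.cd (B := fun w => bs S.rK F (PG.cc K w)) fry (DF.bsr (S := S) fun i => by fun_prop) h

theorem dCm : DF S.st (fun κ : Cd K F Y.N => Y.Cm (Y.sg κ)) := by
  have dH := Y.dH
  have dL := Y.dL
  have dy := Y.dy
  refine DF.inf.mpr ⟨?_, ?_⟩
  · choose κ hκ using Y.hH
    have h1 : ∀ κ' : Cd K F Y.N, Y.Cm (Y.sg κ') ↔ ∀ᶠ e in g.F, ∀ᶠ z in g.F, Y.sg κ' (Y.H (κ 1 e) (Y.y z)) = Y.H (κ 1 e) (Y.sg κ' (Y.y z)) := fun κ' => by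
      simp only [Yd.Cm, ← hκ, Y.ly, one_mul]
    simp only [h1]
    refine FR.u4 (C := S.rK) (fun c => crK c) g.P (fun e => κ 1 e) (ψ := fun κ' q => ∀ᶠ z in g.F, Y.sg κ' (Y.H q (Y.y z)) = Y.H q (Y.sg κ' (Y.y z))) ?_
    refine FR.u4 (C := S.rK) (fun c => crK c) g.P Y.y (ψ := fun (p : Cd K F Y.N × (Y.Q → K)) w => Y.sg p.1 (Y.H p.2 w) = Y.H p.2 (Y.sg p.1 w)) ?_
    have a1 := DF.comp dH (g := fun p : (Cd K F Y.N × (Y.Q → K)) × (Y.N → K) => (p.1.2, p.2)) (by fun_prop)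
    have a2 := DF.comp dH (g := fun p : (Cd K F Y.N × (Y.Q → K)) × (Y.N → K) => (p.1.2, Y.sg p.1.1 p.2)) (by fun_prop)
    dsimp only at a1 a2
    fun_prop
  · refine frk (ψ := fun κ' e => ∀ᶠ z in g.F, Y.sg κ' (Y.y (z * e)) = Y.L 1 e (Y.sg κ' (Y.y z))) ?_
    refine frk (ψ := fun (p : Cd K F Y.N × Γ) z => Y.sg p.1 (Y.y (z * p.2)) = Y.L 1 p.2 (Y.sg p.1 (Y.y z))) ?_
    have a2 := DF.comp dL (g := fun p : (Cd K F Y.N × Γ) × Γ => ((p.2 * p.2⁻¹, p.1.2), Y.sg p.1.1 (Y.y p.2))) (by fun_prop)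
    simp only [mul_inv_cancel] at a2
    fun_prop

/-- the resulting algebraic group -/
structure Hd (Z : Type) [Crd K Z] (S : Stg K) (Γ : Type) [Group Γ] [Crd K Γ] where
  Car : Z → Prop
  mul : Z → Z → Z
  one : Z
  inv : Z → Z
  h : Γ → Z
  dC : DF S.st Car
  dm : DF S.st (fun p : Z × Z => mul p.1 p.2)
  di : DF S.st inv
  dh : DF S.dk.str h
  hC : ∀ x, Car (h x)
  hi : Function.Injective h
  hm : ∀ x x', h (x * x') = mul (h x) (h x')
  c1 : Car one
  cm : ∀ a b, Car a → Car b → Car (mul a b)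
  ci : ∀ a, Car a → Car (inv a)
  as : ∀ a b c, Car a → Car b → Car c → mul (mul a b) c = mul a (mul b c)
  om : ∀ a, Car a → mul one a = a
  mo : ∀ a, Car a → mul a one = a
  im : ∀ a, Car a → mul (inv a) a = one

theorem dmul : DF S.st (fun p : Cd K F Y.N × Cd K F Y.N => Yd.cds F fun w => Y.sg p.1 (Y.sg p.2 w)) :=
  DF.cds (α := Cd K F Y.N × Cd K F Y.N) (φ := fun p w => Y.sg p.1 (Y.sg p.2 w)) (by fun_prop)

set_option maxHeartbeats 400000 in
theorem exHd (S : Stg K) (Γ : Type) [Group Γ] [Crd K Γ] [GO S.dk.str Γ] : ∃ (M J : Type) (_ : Fintype M) (_ : Finite J), Nonempty (Hd (Cd K M J) S Γ) := by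
  obtain ⟨g⟩ := exGn Γ S
  obtain ⟨Y⟩ := exYd g
  obtain ⟨F, hF⟩ := Y.deg
  have ev : ∀ {σ}, Y.A σ → ∀ᶠ z in g.F, Y.sg (Yd.cds F σ) (Y.y z) = σ (Y.y z) := fun h => (hF _ h).ev
  have Av : ∀ {σ}, Y.A σ → Y.A (Y.sg (Yd.cds F σ)) := fun h => h.congr (dsg _) ((ev h).mono fun _ h => h.symm)
  have cv : ∀ {σ}, Y.A σ → Yd.cds F (Y.sg (Yd.cds F σ)) = Yd.cds F σ := fun h => cds_congr (ev h)
  have ds := fun κ => dsg (Y := Y) (F := F) κ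
  let E : Cd K F Y.N → Cd K F Y.N → Prop := fun κ κ' => ∀ᶠ z in g.F, Y.sg κ (Y.sg κ' (Y.y z)) = Y.y z
  let Car : Cd K F Y.N → Prop := fun κ => Yd.cds F (Y.sg κ) = κ ∧ Y.A (Y.sg κ) ∧ ∃ κ', Y.A (Y.sg κ') ∧ E κ κ' ∧ E κ' κ
  let mul : Cd K F Y.N → Cd K F Y.N → Cd K F Y.N := fun a b => Yd.cds F fun w => Y.sg a (Y.sg b w)
  let one : Cd K F Y.N := Yd.cds F fun w => w
  let inv : Cd K F Y.N → Cd K F Y.N := fun a => dd fun b => Car b ∧ mul b a = one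
  let h : Γ → Cd K F Y.N := fun x => Yd.cds F (Y.L x 1)
  have dC : DF S.st Car := by
    obtain ⟨F4, h4⟩ := vfin S g.F fun z => cc K (Y.y z)
    let WL : Cd K F Y.N → Prop := fun κ => ∀ R : F4 → K, (∀ᶠ z in g.F, ∑ m, R m * bs S.rK F4 (cc K (Y.y z)) m = 0) →
      ∀ᶠ z in g.F, ∑ m, R m * bs S.rK F4 (cc K (Y.sg κ (Y.y z))) m = 0
    have w1 : ∀ κ κ', E κ' κ → WL κ → Y.Cm (Y.sg κ) → Y.A (Y.sg κ) := fun κ κ' h1 h2 h3 => ⟨ds κ, Y.wl (ds κ) (ds κ') h1 (h4 _ _ h2), h3⟩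
    have w2 : ∀ κ, Y.A (Y.sg κ) → WL κ := fun κ h1 R hR => h1.l (fun w => ∑ m, R m * bs S.rK F4 (cc K w) m = 0) (by
      have : DF S.rK.str (fun w : Y.N → K => bs S.rK F4 (cc K w)) := DF.bsr (S := S) fun i => by fun_prop
      fun_prop) hR
    have w3 : Car = fun κ => Yd.cds F (Y.sg κ) = κ ∧ (WL κ ∧ Y.Cm (Y.sg κ)) ∧ ∃ κ', (WL κ' ∧ Y.Cm (Y.sg κ')) ∧ E κ κ' ∧ E κ' κ := by
      ext κ
      refine and_congr_right fun _ => ⟨?_, ?_⟩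
      · rintro ⟨h1, κ', h2, h3⟩
        exact ⟨⟨w2 _ h1, h1.c⟩, κ', ⟨w2 _ h2, h2.c⟩, h3⟩
      · rintro ⟨h1, κ', h2, h3⟩
        exact ⟨w1 _ _ h3.2 h1.1 h1.2, κ', w1 _ _ h3.1 h2.1 h2.2, h3⟩
    have d1 : DF S.st (fun κ : Cd K F Y.N => Yd.cds F (Y.sg κ)) := DF.cds (φ := fun κ w => Y.sg κ w) (by fun_prop)
    have d2 : DF S.st WL := by
      refine DF.all (P := fun κ R => _ → _) (DF.imp ?_ ?_)
      · refine fry (ψ := fun (p : Cd K F Y.N × (F4 → K)) w => ∑ m, p.2 m * bs S.rK F4 (cc K w) m = 0) ?_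
        have : DF S.st (fun p : (Cd K F Y.N × (F4 → K)) × (Y.N → K) => bs S.rK F4 (cc K p.2)) := DF.bsr (S := S) fun i => by fun_prop
        fun_prop
      · refine fry (ψ := fun (p : Cd K F Y.N × (F4 → K)) w => ∑ m, p.2 m * bs S.rK F4 (cc K (Y.sg p.1 w)) m = 0) ?_
        have : DF S.st (fun p : (Cd K F Y.N × (F4 → K)) × (Y.N → K) => bs S.rK F4 (cc K (Y.sg p.1.1 p.2))) := DF.bsr (S := S) fun i => by fun_prop
        fun_prop
    have d3 := dCm (Y := Y) (F := F)
    have d4 : DF S.st (fun p : Cd K F Y.N × Cd K F Y.N => E p.1 p.2) := fry (Y := Y) (ψ := fun (p : Cd K F Y.N × Cd K F Y.N) w => Y.sg p.1 (Y.sg p.2 w) = w) (by fun_prop)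
    have d5 : DF S.st (fun p : Cd K F Y.N × Cd K F Y.N => E p.2 p.1) := fry (Y := Y) (ψ := fun (p : Cd K F Y.N × Cd K F Y.N) w => Y.sg p.2 (Y.sg p.1 w) = w) (by fun_prop)
    rw [w3]
    have d6 : DF S.st fun κ => WL κ ∧ Y.Cm (Y.sg κ) := d2.and d3
    have d7 : DF S.st fun p : Cd K F Y.N × Cd K F Y.N => WL p.2 ∧ Y.Cm (Y.sg p.2) := d6.comp DF.snd
    exact DF.and (by fun_prop) (d6.and (DF.ex (P := fun κ κ' => (WL κ' ∧ Y.Cm (Y.sg κ')) ∧ E κ κ' ∧ E κ' κ) (d7.and (d4.and d5))))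
  have dm : DF S.st (fun p : Cd K F Y.N × Cd K F Y.N => mul p.1 p.2) := dmul
  have di : DF S.st inv := by
    haveI : Cst S.st (0 : Cd K F Y.N) := inferInstanceAs (Cst _ (fun _ _ _ => (0 : K)))
    have d1 : DF S.st (fun _ : Cd K F Y.N × Cd K F Y.N => one) := DF.cds (φ := fun _ w => w) (by fun_prop)
    have d2 : DF S.st (fun p : Cd K F Y.N × Cd K F Y.N => mul p.2 p.1) := DF.comp dm (g := fun p : Cd K F Y.N × Cd K F Y.N => (p.2, p.1)) (by fun_prop)
    refine DF.dd (R := fun a b => Car b ∧ mul b a = one) ?_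
    fun_prop
  have dy := Y.dy
  have dh : DF S.dk.str h := by
    refine DF.cd (B := fun z => bs S.rK F (cc K (Y.y z))) (φ := fun x z => Y.L x 1 (Y.y z)) frk (DF.bsr (S := S) fun i => by fun_prop) ?_
    simp only [Y.ly, mul_one]
    fun_prop
  have ms : ∀ {a b}, Y.A (Y.sg a) → Y.A (Y.sg b) → ∀ᶠ z in g.F, Y.sg (mul a b) (Y.y z) = Y.sg a (Y.sg b (Y.y z)) := fun ha hb => ev (ha.comp hb)
  have ma : ∀ {a b}, Y.A (Y.sg a) → Y.A (Y.sg b) → Y.A (Y.sg (mul a b)) := fun ha hb => Av (ha.comp hb)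
  have Ai : Y.A fun w => w := (Y.ax 1).congr DF.id (.of_forall fun z => by simp [Y.ly])
  have tr : ∀ {a : Cd K F Y.N} (_ : Y.A (Y.sg a)) {σ τ : (Y.N → K) → Y.N → K}, DF S.rK.str σ → DF S.rK.str τ → (∀ᶠ z in g.F, σ (Y.y z) = τ (Y.y z)) →
      ∀ᶠ z in g.F, σ (Y.sg a (Y.y z)) = τ (Y.sg a (Y.y z)) := fun {a} ha {σ τ} h1 h2 h3 => ha.l (fun w => σ w = τ w) (by fun_prop) h3
  have d2 : ∀ a b, DF S.rK.str fun w => Y.sg a (Y.sg b w) := fun a b => (ds a).comp (ds b)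
  have EM : ∀ {a a' b b'}, Y.A (Y.sg a) → Y.A (Y.sg a') → Y.A (Y.sg b) → Y.A (Y.sg b') → E a a' → E b b' → E (mul a b) (mul b' a') := fun {a a' b b'} ha ha' hb hb' h1 h2 => by
    filter_upwards [h1, ms hb' ha', tr (ma hb' ha') (ds _) (d2 a b) (ms ha hb), tr ha' (d2 b b') DF.id h2] with z e1 e2 e3 e4
    rw [e3, e2, e4, e1]
  have as : ∀ a b c, Car a → Car b → Car c → mul (mul a b) c = mul a (mul b c) := fun a b c ha hb hc => cds_congr (by
    filter_upwards [tr hc.2.1 (ds _) (d2 a b) (ms ha.2.1 hb.2.1), ms hb.2.1 hc.2.1] with z e1 e2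
    rw [e1, e2])
  have om : ∀ a, Car a → mul one a = a := fun a ha => (cds_congr (tr ha.2.1 (ds one) DF.id (ev Ai))).trans ha.1
  have mo : ∀ a, Car a → mul a one = a := fun a ha => (cds_congr ((ev Ai).mono fun z hz => by rw [hz])).trans ha.1
  have c1 : Car one := by
    have e : E one one := by
      filter_upwards [ev Ai] with z hz
      rw [hz, hz]
    exact ⟨cv Ai, Av Ai, one, Av Ai, e, e⟩
  have cm : ∀ a b, Car a → Car b → Car (mul a b) := by
    rintro a b ⟨-, ha, a', ha', e1, e2⟩ ⟨-, hb, b', hb', e3, e4⟩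
    exact ⟨cv (ha.comp hb), ma ha hb, mul b' a', ma hb' ha', EM ha ha' hb hb' e1 e3, EM hb' hb ha' ha e4 e2⟩
  have ex : ∀ a, Car a → Car (inv a) ∧ mul (inv a) a = one := by
    rintro a ⟨ha0, ha, a', ha', e1, e2⟩
    have f1 : E a (Yd.cds F (Y.sg a')) := by
      filter_upwards [ev ha', e1] with z h1 h2
      rw [h1, h2]
    have f2 : E (Yd.cds F (Y.sg a')) a := by
      filter_upwards [tr ha (ds _) (ds a') (ev ha'), e2] with z h1 h2
      rw [h1, h2]
    have hc : Car (Yd.cds F (Y.sg a')) := ⟨cv ha', Av ha', a, ha, f2, f1⟩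
    have hca : Car a := ⟨ha0, ha, a', ha', e1, e2⟩
    have u : ∀ b, Car b ∧ mul b a = one → b = Yd.cds F (Y.sg a') := by
      rintro b ⟨hb, hb'⟩
      rw [← om _ hc, ← hb', as _ _ _ hb hca hc, show mul a (Yd.cds F (Y.sg a')) = one from cds_congr f1, mo _ hb]
    exact dd_spec (R := fun b => Car b ∧ mul b a = one) ⟨_, hc, cds_congr f2⟩ fun b b' hb hb' => (u b hb).trans (u b' hb').symm
  have hc : ∀ x x', ∀ᶠ z in g.F, Y.sg (h x) (Y.sg (h x') (Y.y z)) = Y.L (x * x') 1 (Y.y z) := fun x x' => by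
    filter_upwards [tr (Av (Y.ax x')) (ds _) (Y.dl x 1) (ev (Y.ax x)), ev (Y.ax x')] with z h1 h2
    rw [h1, h2]
    simp [Y.ly, mul_assoc]
  have he : ∀ x x', x * x' = 1 → E (h x) (h x') := fun x x' e => (hc x x').mono fun z hz => by
    rw [hz, e]; simp [Y.ly]
  exact ⟨F, Y.N, inferInstance, inferInstance, ⟨Car, mul, one, inv, h, dC, dm, di, dh,
    fun x => ⟨cv (Y.ax x), Av (Y.ax x), h x⁻¹, Av (Y.ax _), he _ _ (mul_inv_cancel x), he _ _ (inv_mul_cancel x)⟩,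
    fun x x' e => by
      obtain ⟨z, h1, h2⟩ := ((ev (Y.ax x)).and (ev (Y.ax x'))).exists
      have h3 : Y.L x 1 (Y.y z) = Y.L x' 1 (Y.y z) := h1.symm.trans ((congrArg (fun k => Y.sg k (Y.y z)) e).trans h2)
      rw [Y.ly, Y.ly] at h3
      exact mul_right_cancel (mul_right_cancel (Y.inj h3)),
    fun x x' => (cds_congr (hc x x')).symm, c1, cm, fun a ha => (ex a ha).1, as, om, mo, fun a ha => (ex a ha).2⟩⟩

end
end PG


namespace PG
open MvPolynomial Filter

section
variable {K : Type} [Field K] [CharZero K] {S : Stg K} {ι : Type}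

theorem exU (X : Set (ι → K)) (𝔭 : Ideal (MvPolynomial ι K)) (hp : 𝔭.IsPrime) (g : MvPolynomial ι K)
    (hg : ∀ R, R ∈ 𝔭 ↔ R * g ∈ vI (𝓟 X) id) :
    ∃ U : Ultrafilter (ι → K), X ∈ U ∧ ∀ R, (∀ᶠ z in U, eval z R = 0) ↔ R ∈ 𝔭 := by
  classical
  by_contra hn
  obtain ⟨t, ht, ht'⟩ := cpt (S := X) {B | ∃ R, R ∉ 𝔭 ∧ B = {z | eval z (R * g) = 0}} fun U hU => by
    by_contra h
    refine hn ⟨U, hU, fun R => ⟨fun h1 => ?_, fun h1 => ?_⟩⟩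
    · by_contra h2
      exact h ⟨_, ⟨R, h2, rfl⟩, h1.mono fun z hz => by rw [map_mul, hz, zero_mul]⟩
    · have h3 : ∀ᶠ z in U, ¬ eval z (1 * g) = 0 := Ultrafilter.eventually_not.mpr fun h3 =>
        h ⟨_, ⟨1, fun h4 => hp.ne_top ((Ideal.eq_top_iff_one _).mpr h4), rfl⟩, h3⟩
      have h4 : ∀ᶠ z in U, eval z (R * g) = 0 := mem_of_superset hU ((hg R).mp h1)
      filter_upwards [h3, h4] with z h5 h6
      rw [one_mul] at h5
      rw [map_mul] at h6
      exact (mul_eq_zero.mp h6).resolve_right h5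
  choose! R hR hB using fun B (h : B ∈ t) => ht h
  have h1 : ∏ B ∈ t, R B ∈ 𝔭 := (hg _).mpr (Filter.eventually_principal.mpr fun z hz => by
    obtain ⟨B, hBt, hz⟩ := Set.mem_iUnion₂.mp (ht' hz)
    rw [hB B hBt, Set.mem_setOf_eq, map_mul] at hz
    rw [id, map_mul, map_prod]
    rcases mul_eq_zero.mp hz with hz | hz
    · rw [Finset.prod_eq_zero hBt hz, zero_mul]
    · rw [hz, mul_zero])
  obtain ⟨B, hBt, h2⟩ := hp.prod_mem_iff.mp h1
  exact hR B hBt h2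

theorem cst_k {c : K} (h : DF S.dk.str (fun _ : Fin 0 → K => c)) : c ∈ S.k := by
  obtain ⟨t, ht⟩ := DF.rat h
  obtain ⟨q, -, h1, h2⟩ := ht 0
  haveI : IsEmpty (Crd.ι K (Fin 0 → K) × ℕ) := ⟨fun x => Fin.elim0 x.1.1⟩
  have h3 : ∀ p x, S.dk.e x p ∈ S.k := fun (p : MvPolynomial (Crd.ι K (Fin 0 → K) × ℕ) S.dk.k) x => by
    rw [eq_C_of_isEmpty p]
    refine (congrArg (· ∈ S.k) (eval₂_C _ _ _)).mpr ?_
    exact (p.coeff 0).2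
  rw [eq_div_of_mul_eq h1 ((mul_comm _ _).trans h2)]
  exact S.k.div_mem (h3 _ _) (h3 _ _)

theorem prP [Finite ι] : ∀ (I : Ideal (MvPolynomial ι K)) (X : Set (ι → K)), vI (𝓟 X) id = I → S.st.Df X → S.rk.str.Df X := by
  intro I
  induction I using WellFoundedGT.induction with
  | ind I ih =>
  rintro X rfl hX
  obtain ⟨F, hF⟩ := vfin S (𝓟 X) id
  let W := relS (𝓟 X) (fun z => bs S.rK F z)
  have hd : DF S.dk.str (fun z : ι → K => z ∈ X) := DF.iff_dp.mpr (DP.of.mpr hX.2)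
  have hκ : ∀ j i, code (· ∈ W) j i ∈ S.k := fun j i => by
    refine cst_k ?_
    have h1 : DF S.dk.str (fun _ : Fin 0 → K => code (· ∈ W)) := by
      refine DF.code (W := fun _ c => c ∈ W) ?_
      have h2 : ∀ c, c ∈ W ↔ ∀ z : ι → K, z ∈ X → ∑ m, c m * bs S.rK F z m = 0 := fun c => eventually_principal
      simp only [h2]
      refine DF.all (P := fun (p : (Fin 0 → K) × (F → K)) (z : ι → K) => z ∈ X → ∑ m, p.2 m * bs S.rK F z m = 0) ?_
      have h3 : DF S.dk.str (fun p : ((Fin 0 → K) × (F → K)) × (ι → K) => bs S.rK F p.2) := DF.bsr (S := S) fun i => by fun_prop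
      fun_prop
    fun_prop
  haveI hκc : ∀ j i, Cst S.rk.str (code (· ∈ W) j i) := fun j i => cstφ (C := S.rk) ⟨_, hκ j i⟩
  let A : Set (ι → K) := {v | ∀ c : F → K, (∀ i, ∑ j, c j * code (· ∈ W) j i = 0) → ∑ m, c m * bs S.rK F v m = 0}
  have hA : S.rk.str.Df A := by
    refine DP.of.mp (DF.iff_dp.mp ?_)
    refine DF.all (P := fun (v : ι → K) (c : F → K) => (∀ i, ∑ j, c j * code (· ∈ W) j i = 0) → ∑ m, c m * bs S.rK F v m = 0) ?_
    have h3 : DF S.rk.str (fun p : (ι → K) × (F → K) => bs S.rK F p.1) := DF.bsr (S := S) fun i => by fun_prop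
    refine DF.imp (DF.alf fun i => DF.eq (DF.sumf _ fun j => DF.mul (by fun_prop) (DF.const _)) (by fun_prop)) (by fun_prop)
  have hA' : ∀ v, v ∈ A ↔ ∀ c ∈ W, ∑ m, c m * bs S.rK F v m = 0 := fun v => forall_congr' fun c => imp_congr_left (code_spec W c).symm
  have hXA : X ⊆ A := fun v hv => (hA' v).mpr fun c hc => eventually_principal.mp hc v hv
  have hIA : vI (𝓟 X) id ≤ vI (𝓟 A) id := hF _ _ fun R hR => eventually_principal.mpr fun v hv => (hA' v).mp hv R hR
  let B := A ∩ Xᶜ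
  have hB : S.st.Df B := S.st.inter (rk_st _ hA) (S.st.compl hX)
  have hIB : vI (𝓟 X) id ≤ vI (𝓟 B) id := fun p hp => eventually_principal.mpr fun z hz => eventually_principal.mp (hIA hp) z hz.1
  rcases hIB.lt_or_eq with h | h
  · have h1 := ih _ h B rfl hB
    have : X = A ∩ Bᶜ := by
      ext z; constructor
      · exact fun hz => ⟨hXA hz, fun h => h.2 hz⟩
      · rintro ⟨h1, h2⟩; by_contra h3; exact h2 ⟨h1, h3⟩
    rw [this]
    exact S.rk.str.inter hA (S.rk.str.compl h1)
  · by_cases hI : vI (𝓟 X) id = ⊤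
    · have : X = Set.univᶜ := by
        rw [Set.compl_univ, Set.eq_empty_iff_forall_notMem]
        intro z hz
        have h1 : (1 : MvPolynomial ι K) ∈ vI (𝓟 X) id := hI ▸ trivial
        have := eventually_principal.mp h1 z hz
        rw [map_one] at this
        exact one_ne_zero this
      rw [this]
      exact S.rk.str.compl S.rk.str.univ
    · exfalso
      obtain ⟨𝔭, h𝔭⟩ := Ideal.nonempty_minimalPrimes hI
      obtain ⟨g, hg⟩ := Submodule.exists_eq_colon_of_mem_minimalPrimes (N := vI (𝓟 X) id) (x := 1) (I := 𝔭) (by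
        convert h𝔭 using 2
        ext r
        rw [Submodule.mem_colon_singleton, smul_eq_mul, mul_one])
      have hg' : ∀ R, R ∈ 𝔭 ↔ R * g ∈ vI (𝓟 X) id := fun R => by rw [hg, Submodule.mem_colon_singleton, smul_eq_mul]
      obtain ⟨U, hU, hU'⟩ := exU X 𝔭 h𝔭.1.1 g hg'
      obtain ⟨V, hV, hV'⟩ := exU B 𝔭 h𝔭.1.1 g (h ▸ hg')
      have := (Con.agree (C := S.rK) hX.1 U V id id fun p => by
        obtain ⟨p0, hp0⟩ := red p
        simp only [id, hp0]
        exact (hU' p0).trans (hV' p0).symm).mp hU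
      obtain ⟨z, h1, h2⟩ := (this.and hV).exists
      exact h2.2 h1

end
end PG


namespace PG
open MvPolynomial Filter PaperGroups FirstOrder FirstOrder.Language

section
variable {K : Type} [Field K] [DiffFieldStruct K] {k : Subfield K} {n : ℕ} (G : DefGroupOn LDrg K (↑k : Set K) n)

abbrev GG := {x // x ∈ G.carrier}

instance : Group (GG G) where
  mul x y := ⟨G.mul x y, G.mul_mem _ x.2 _ y.2⟩
  one := ⟨G.one, G.one_mem⟩
  inv x := ⟨G.inv x, G.inv_mem _ x.2⟩
  mul_assoc x y z := Subtype.ext (G.mul_assoc _ x.2 _ y.2 _ z.2)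
  one_mul x := Subtype.ext (G.one_mul _ x.2)
  mul_one x := Subtype.ext (G.mul_one _ x.2)
  inv_mul_cancel x := Subtype.ext (G.inv_mul _ x.2)
instance : Crd K (GG G) := ⟨Fin n, inferInstance, Subtype.val, Subtype.val_injective⟩

variable {𝒟 : DStr K} {G}
theorem isSG (hd : ∀ {ι : Type} [Finite ι] {s : Set (ι → K)}, (↑k : Set K).Definable LDrg s → 𝒟.Df s) : IsS 𝒟 (GG G) :=
  ⟨dpof (hd G.carrier_def) fun z => ⟨fun ⟨a, _, h⟩ => h ▸ a.2, fun h => ⟨⟨z, h⟩, trivial, rfl⟩⟩⟩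

theorem goG (hd : ∀ {ι : Type} [Finite ι] {s : Set (ι → K)}, (↑k : Set K).Definable LDrg s → 𝒟.Df s) : GO 𝒟 (GG G) :=
  { isSG hd with
    dmul := dpof (hd G.mul_def) fun z => by
      constructor
      · rintro ⟨⟨⟨a, b⟩, c⟩, h, rfl⟩
        exact ⟨a.2, b.2, congrArg Subtype.val h⟩
      · rintro ⟨h1, h2, h3⟩
        refine ⟨((⟨_, h1⟩, ⟨_, h2⟩), ⟨z ∘ Sum.inr, h3 ▸ G.mul_mem _ h1 _ h2⟩), Subtype.ext h3, ?_⟩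
        funext i; rcases i with (i | i) | i <;> rfl
    dinv := dpof (hd G.inv_def) fun z => by
      constructor
      · rintro ⟨⟨a, c⟩, h, rfl⟩
        exact ⟨a.2, congrArg Subtype.val h⟩
      · rintro ⟨h1, h3⟩
        refine ⟨(⟨_, h1⟩, ⟨z ∘ Sum.inr, h3 ▸ G.inv_mem _ h1⟩), Subtype.ext h3, ?_⟩
        funext i; rcases i with i | i <;> rfl }

end
end PG

namespace PaperGroups

open FirstOrder FirstOrder.Language

open PG in
theorem DCF0_group_embeds_in_ring_definable_group
    (K : Type) [Field K] [DiffFieldStruct K] (hK : IsDCF0 K)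
    (k : Subfield K) (hk : ∀ x ∈ k, DiffFieldStruct.der x ∈ k)
    (n : ℕ) (G : DefGroupOn LDrg K (↑k : Set K) n) :
    ∃ (m : ℕ) (H : DefGroupOn Language.ring K (↑k : Set K) m)
      (h : (Fin n → K) → (Fin m → K)),
      -- `h` is `L_{D-rg}(k)`-definable
      (↑k : Set K).Definable LDrg {z : Fin n ⊕ Fin m → K |
        z ∘ Sum.inl ∈ G.carrier ∧ h (z ∘ Sum.inl) = z ∘ Sum.inr} ∧
      -- `h` is a one-to-one group morphism from `G` into `H`
      Set.InjOn h G.carrier ∧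
      (∀ x ∈ G.carrier, h x ∈ H.carrier) ∧
      (∀ x ∈ G.carrier, ∀ y ∈ G.carrier, h (G.mul x y) = H.mul (h x) (h y)) := by
  classical
  haveI := hK.1
  let S : Stg K := ⟨DiffFieldStruct.der, ⟨DiffFieldStruct.der_add, DiffFieldStruct.der_mul⟩, blum_of_dcf hK, k, hk⟩
  haveI : GO S.dk.str (GG G) := goG fun h => def_df (fun a ha => cstφ (C := S.dk) ⟨a, ha⟩) (Cx.der S.dk) h
  obtain ⟨M, J, _, _, ⟨Q⟩⟩ := exHd S (GG G)
  have tr : ∀ {ι : Type} [Finite ι] (s : Set (ι → K)), S.st.Df s → (rstr (↑k : Set K)).Df s := fun s h =>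
    Con.df (C := S.rk) (fun c => cst_r c.2) (DF.const (0 : K)) (prP _ s rfl h)
  have td : ∀ {ι : Type} [Finite ι] (s : Set (ι → K)), S.dk.str.Df s → (dstr (↑k : Set K)).Df s := fun s h =>
    Con.df (C := S.dk) (fun c => cst_d c.2) der_d h
  haveI : IsS (dstr (↑k : Set K)) (GG G) := isSG fun h => h
  have dC : DF (rstr (↑k : Set K)) Q.Car := DF.mono' tr Q.dC
  have dm : DF (rstr (↑k : Set K)) (fun p : Cd K M J × Cd K M J => Q.mul p.1 p.2) := DF.mono' tr Q.dm
  have di : DF (rstr (↑k : Set K)) Q.inv := DF.mono' tr Q.di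
  have dh : DF (dstr (↑k : Set K)) Q.h := DF.mono' td Q.dh
  obtain ⟨m, ⟨e⟩⟩ := Finite.exists_equiv_fin (J × (M ⊕ M) × (M ⊕ M))
  let E : Cd K M J → Fin m → K := fun z i => z (e.symm i).1 (e.symm i).2.1 (e.symm i).2.2
  let E' : (Fin m → K) → Cd K M J := fun x a b c => x (e (a, b, c))
  have hE : ∀ z, E' (E z) = z := fun z => by funext a b c; simp [E, E']
  have hE' : ∀ z, E (E' z) = z := fun z => by funext i; simp [E, E']
  have dE : ∀ 𝒟 : DStr K, DF 𝒟 E := fun 𝒟 => DF.pi fun i => by fun_prop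
  have dE' : ∀ 𝒟 : DStr K, DF 𝒟 E' := fun 𝒟 => DF.pi fun a => DF.pi fun b => DF.pi fun c => by fun_prop
  have d1 := dE (rstr (↑k : Set K))
  have d2 := dE' (rstr (↑k : Set K))
  have dl : ∀ {ι κ : Type} [Finite ι] [Finite κ] (f : ι → κ), DF (rstr (↑k : Set K)) (fun z : κ → K => z ∘ f) := fun f => DF.pi fun i => DF.app _
  have d3 : ∀ {ι : Type} [Finite ι] {P : (ι → K) → Prop}, DF (rstr (↑k : Set K)) P → (↑k : Set K).Definable Language.ring {z | P z} := fun h =>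
    DP.of.mp (DF.iff_dp.mp h)
  let h0 : (Fin n → K) → Fin m → K := fun x => if hx : x ∈ G.carrier then E (Q.h ⟨x, hx⟩) else 0
  have h0e : ∀ x (hx : x ∈ G.carrier), h0 x = E (Q.h ⟨x, hx⟩) := fun x hx => dif_pos hx
  refine ⟨m, {
    carrier := {x | Q.Car (E' x)}
    mul := fun x y => E (Q.mul (E' x) (E' y))
    one := E Q.one
    inv := fun x => E (Q.inv (E' x))
    carrier_def := d3 (DF.comp dC d2)
    mul_def := d3 (DF.and (DF.comp (f := fun x => Q.Car (E' x)) (DF.comp dC d2) (dl _)) (DF.and (DF.comp (f := fun x => Q.Car (E' x)) (DF.comp dC d2) (dl _))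
      (DF.eq (DF.comp d1 (DF.comp (f := fun p : Cd K M J × Cd K M J => Q.mul p.1 p.2) dm (DF.mk (DF.comp d2 (dl _)) (DF.comp d2 (dl _))))) (dl _))))
    inv_def := d3 (DF.and (DF.comp (f := fun x => Q.Car (E' x)) (DF.comp dC d2) (dl _)) (DF.eq (DF.comp d1 (DF.comp di (DF.comp d2 (dl _)))) (dl _)))
    one_mem := by rw [Set.mem_setOf_eq, hE]; exact Q.c1
    mul_mem := fun x hx y hy => by rw [Set.mem_setOf_eq, hE]; exact Q.cm _ _ hx hy
    inv_mem := fun x hx => by rw [Set.mem_setOf_eq, hE]; exact Q.ci _ hx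
    mul_assoc := fun x hx y hy z hz => by simp only [hE]; rw [Q.as _ _ _ hx hy hz]
    one_mul := fun x hx => by simp only [hE]; rw [Q.om _ hx, hE']
    mul_one := fun x hx => by simp only [hE]; rw [Q.mo _ hx, hE']
    inv_mul := fun x hx => by simp only [hE]; rw [Q.im _ hx] }, h0, ?_, ?_, ?_, ?_⟩
  · have h1 : DF (dstr (↑k : Set K)) (fun x => E (Q.h x)) := DF.comp (dE _) dh
    have h2 : (↑k : Set K).Definable LDrg _ := (dstr (↑k : Set K)).pre (Sum.map (fun i => i) (fun i : Fin m × Unit => i.1) : Fin n ⊕ Fin m × Unit → Fin n ⊕ Fin m) h1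
    convert h2 using 1
    ext z
    constructor
    · rintro ⟨ha, hb⟩
      refine ⟨(⟨_, ha⟩, z ∘ Sum.inr), (h0e _ ha).symm.trans hb, ?_⟩
      funext i; rcases i with i | i <;> rfl
    · rintro ⟨⟨a, b⟩, ha, hb⟩
      have h3 : z ∘ Sum.inl = a.1 := funext fun i => (congrFun hb (.inl i)).symm
      have h4 : z ∘ Sum.inr = b := funext fun i => (congrFun hb (.inr (i, ()))).symm
      refine ⟨h3 ▸ a.2, ?_⟩
      rw [h3, h4, h0e _ a.2]; exact ha
  · intro x hx y hy h
    rw [h0e x hx, h0e y hy] at h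
    exact congrArg Subtype.val (Q.hi ((hE _).symm.trans ((congrArg E' h).trans (hE _))))
  · intro x hx
    rw [h0e x hx, Set.mem_setOf_eq, hE]
    exact Q.hC _
  · intro x hx y hy
    rw [h0e x hx, h0e y hy, h0e _ (G.mul_mem x hx y hy)]
    simp only [hE]
    exact congrArg E (Q.hm ⟨x, hx⟩ ⟨y, hy⟩)

end PaperGroups
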